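/- Derivatives of the corrected interpolating function ψ₁: in the r-th level interpolating setup with p strictly decreasing, q strictly decreasing, and p_{k−1}q_{k−1} > p_kq_k for all k, define ψ₁(X,Y,p,q,𝔪,β,s,t) = −(sign(s)sβ/(2√n)) Σ_{k=1}^{r+1} 𝔪_k [ p_{k−1}q_{k−1} E_{G,𝒰_{r+1}}⟨‖x^{(i₁)}‖₂‖x^{(p₁)}‖₂‖y^{(i₂)}‖₂‖y^{(p₂)}‖₂⟩_{γ_k^{(r)}} − p_kq_k E_{G,𝒰_{r+1}}⟨‖x^{(i₁)}‖₂‖x^{(p₁)}‖₂‖y^{(i₂)}‖₂‖y^{(p₂)}‖₂⟩_{γ_{k+1}^{(r)}} ] + ψ(X,Y,p,q,𝔪,β,s,t), where in differentiating ψ₁ with respect to p_{k₁} and q_{k₁} the γ-averages appearing in the correction sum are treated as constants (only the explicit p_kq_k-dependence of the correction term and the full dependence of ψ are differentiated). Then for every k₁ ∈ {1,…,r}: dψ₁/dp_{k₁} = (1−t)(𝔪_{k₁}−𝔪_{k₁+1})(sign(s)sβ/(2√n)) E_{G,𝒰_{r+1}}⟨‖x^{(i₁)}‖₂‖x^{(p₁)}‖₂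 (q_{k₁}‖y^{(i₂)}‖₂‖y^{(p₂)}‖₂ − (y^{(p₂)})ᵀy^{(i₂)})⟩_{γ_{k₁+1}^{(r)}} and dψ₁/dq_{k₁} = (1−t)(𝔪_{k₁}−𝔪_{k₁+1})(sign(s)sβ/(2√n)) E_{G,𝒰_{r+1}}⟨‖y^{(i₂)}‖₂‖y^{(p₂)}‖₂ (p_{k₁}‖x^{(i₁)}‖₂‖x^{(p₁)}‖₂ − (x^{(p₁)})ᵀx^{(i₁)})⟩_{γ_{k₁+1}^{(r)}}. -/

import Mathlib

set_option linter.unusedVariables false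

open MeasureTheory Real

namespace SFLR

noncomputable section

/-- The sample space of one group `𝒰_k = (u^{(4,k)}, u^{(2,k)}, h^{(k)})`. -/
abbrev Us (m n : ℕ) : Type := ℝ × (Fin m → ℝ) × (Fin n → ℝ)

/-- Standard Gaussian measure on `ℝ`. -/
def stdG : Measure ℝ := ProbabilityTheory.gaussianReal 0 1

/-- i.i.d. standard Gaussian vector measure. -/
def gVec (d : ℕ) : Measure (Fin d → ℝ) := Measure.pi fun _ => stdG

/-- i.i.d. standard Gaussian matrix measure. -/
def gMat (m n : ℕ) : Measure (Fin m → Fin n → ℝ) := Measure.pi fun _ => gVec n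

/-- Law of one group `𝒰_k`. -/
def muU (m n : ℕ) : Measure (Us m n) := stdG.prod ((gVec m).prod (gVec n))

/-- Joint law of `(G, (𝒰_k)_{k=1}^{r+1})`; the `k`-th group `𝒰_k` is coordinate `k-1`. -/
def muAll (r m n : ℕ) : Measure ((Fin m → Fin n → ℝ) × (Fin (r+1) → Us m n)) :=
  (gMat m n).prod (Measure.pi fun _ : Fin (r+1) => muU m n)

/-- Euclidean norm. -/
def nrm2 {d : ℕ} (v : Fin d → ℝ) : ℝ := Real.sqrt (∑ i, v i ^ 2)

/-- Euclidean inner product. -/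
def dotv {d : ℕ} (a b : Fin d → ℝ) : ℝ := ∑ i, a i * b i

variable {m n l : ℕ}

/-- The `r`-th level interpolating exponent `D₀^{(i₁,i₂)}`; the factor `ε` multiplies the
`u^{(4,k)}`-terms (`ε = 1` gives `D₀`, `ε = 0` gives `D_{0,S}`). -/
def D0R (r : ℕ) (ε β s t : ℝ) (mv p q : ℕ → ℝ) (x : Fin l → Fin n → ℝ) (y : Fin l → Fin m → ℝ)
    (G : Fin m → Fin n → ℝ) (U : Fin (r+1) → Us m n) (i1 i2 : Fin l) : ℝ :=
  Real.sqrt t * (∑ j, ∑ k, y i2 j * (G j k * x i1 k))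
    + Real.sqrt (1 - t) * nrm2 (x i1) *
        (∑ j, y i2 j * (∑ k : Fin (r+1), Real.sqrt (p (k : ℕ) - p ((k : ℕ) + 1)) * (U k).2.1 j))
    + ε * (Real.sqrt t * nrm2 (x i1) * nrm2 (y i2) *
        (∑ k : Fin (r+1),
          Real.sqrt (p (k : ℕ) * q (k : ℕ) - p ((k : ℕ) + 1) * q ((k : ℕ) + 1)) * (U k).1))
    + Real.sqrt (1 - t) * nrm2 (y i2) *
        (∑ kk, (∑ k : Fin (r+1), Real.sqrt (q (k : ℕ) - q ((k : ℕ) + 1)) * (U k).2.2 kk) * x i1 kk)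

/-- `A^{(i₁,i₂)}`. -/
def AR (r : ℕ) (ε β s t : ℝ) (mv p q : ℕ → ℝ) (x : Fin l → Fin n → ℝ) (y : Fin l → Fin m → ℝ)
    (G : Fin m → Fin n → ℝ) (U : Fin (r+1) → Us m n) (i1 i2 : Fin l) : ℝ :=
  Real.exp (β * D0R r ε β s t mv p q x y G U i1 i2)

/-- `C^{(i₁)}`. -/
def CR (r : ℕ) (ε β s t : ℝ) (mv p q : ℕ → ℝ) (x : Fin l → Fin n → ℝ) (y : Fin l → Fin m → ℝ)
    (G : Fin m → Fin n → ℝ) (U : Fin (r+1) → Us m n) (i1 : Fin l) : ℝ :=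
  ∑ i2, AR r ε β s t mv p q x y G U i1 i2

/-- `Z`. -/
def ZR (r : ℕ) (ε β s t : ℝ) (mv p q : ℕ → ℝ) (x : Fin l → Fin n → ℝ) (y : Fin l → Fin m → ℝ)
    (G : Fin m → Fin n → ℝ) (U : Fin (r+1) → Us m n) : ℝ :=
  ∑ i1, CR r ε β s t mv p q x y G U i1 ^ s

/-- `ζ_k`: successively integrated partition functions, `ζ₀ = Z`,
`ζ_k = E_{𝒰_k} ζ_{k-1}^{𝔪_k/𝔪_{k-1}}`. -/
def zetaR (r : ℕ) (ε β s t : ℝ) (mv p q : ℕ → ℝ) (x : Fin l → Fin n → ℝ)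
    (y : Fin l → Fin m → ℝ) (G : Fin m → Fin n → ℝ) : ℕ → (Fin (r+1) → Us m n) → ℝ
  | 0, U => ZR r ε β s t mv p q x y G U
  | k+1, U =>
      if h : k < r + 1 then
        ∫ u, zetaR r ε β s t mv p q x y G k (Function.update U ⟨k, h⟩ u) ^ (mv (k+1) / mv k)
          ∂ muU m n
      else 0

/-- The `r`-th level interpolating function `ψ`. -/
def psiR (r : ℕ) (ε β s t : ℝ) (mv p q : ℕ → ℝ) (x : Fin l → Fin n → ℝ)
    (y : Fin l → Fin m → ℝ) : ℝ :=
  ∫ ω, (β * |s| * Real.sqrt (n : ℝ) * mv r)⁻¹ *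
      Real.log (zetaR r ε β s t mv p q x y ω.1 r ω.2) ∂ muAll r m n

/-- The operator `Φ_{𝒰_k}` (for `k ≥ 1`). -/
def PhiR (r : ℕ) (ε β s t : ℝ) (mv p q : ℕ → ℝ) (x : Fin l → Fin n → ℝ)
    (y : Fin l → Fin m → ℝ) (k : ℕ)
    (f : (Fin m → Fin n → ℝ) → (Fin (r+1) → Us m n) → ℝ) :
    (Fin m → Fin n → ℝ) → (Fin (r+1) → Us m n) → ℝ :=
  fun G U =>
    if h : k - 1 < r + 1 then
      (∫ u, zetaR r ε β s t mv p q x y G (k-1) (Function.update U ⟨k-1, h⟩ u) ^ (mv k / mv (k-1))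
          * f G (Function.update U ⟨k-1, h⟩ u) ∂ muU m n) /
        zetaR r ε β s t mv p q x y G k U
    else 0

/-- `Φ_{𝒰_hi} ∘ ⋯ ∘ Φ_{𝒰_lo}` (identity when `hi < lo`). -/
def PhiUpToR (r : ℕ) (ε β s t : ℝ) (mv p q : ℕ → ℝ) (x : Fin l → Fin n → ℝ)
    (y : Fin l → Fin m → ℝ) (lo : ℕ) :
    ℕ → ((Fin m → Fin n → ℝ) → (Fin (r+1) → Us m n) → ℝ) →
      (Fin m → Fin n → ℝ) → (Fin (r+1) → Us m n) → ℝ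
  | 0, f => f
  | hi+1, f =>
      if hi + 1 < lo then f
      else PhiR r ε β s t mv p q x y (hi+1) (PhiUpToR r ε β s t mv p q x y lo hi f)

/-- `γ₀(i₁,i₂)`. -/
def gam0R (r : ℕ) (ε β s t : ℝ) (mv p q : ℕ → ℝ) (x : Fin l → Fin n → ℝ)
    (y : Fin l → Fin m → ℝ) (i1 i2 : Fin l) :
    (Fin m → Fin n → ℝ) → (Fin (r+1) → Us m n) → ℝ :=
  fun G U =>
    CR r ε β s t mv p q x y G U i1 ^ s / ZR r ε β s t mv p q x y G U *
      (AR r ε β s t mv p q x y G U i1 i2 / CR r ε β s t mv p q x y G U i1)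

/-- The measure `γ_{k₁+1}^{(r)}`. -/
def gamR (r : ℕ) (ε β s t : ℝ) (mv p q : ℕ → ℝ) (x : Fin l → Fin n → ℝ)
    (y : Fin l → Fin m → ℝ) (k1 : ℕ) (i1 i2 pp1 pp2 : Fin l) :
    (Fin m → Fin n → ℝ) → (Fin (r+1) → Us m n) → ℝ :=
  PhiUpToR r ε β s t mv p q x y (k1+1) r
    (fun G U =>
      PhiUpToR r ε β s t mv p q x y 1 k1 (gam0R r ε β s t mv p q x y i1 i2) G U *
        PhiUpToR r ε β s t mv p q x y 1 k1 (gam0R r ε β s t mv p q x y pp1 pp2) G U)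

/-- The measure `γ₀₁^{(r)}`. -/
def gam01R (r : ℕ) (ε β s t : ℝ) (mv p q : ℕ → ℝ) (x : Fin l → Fin n → ℝ)
    (y : Fin l → Fin m → ℝ) (i1 i2 : Fin l) :
    (Fin m → Fin n → ℝ) → (Fin (r+1) → Us m n) → ℝ :=
  PhiUpToR r ε β s t mv p q x y 1 r (gam0R r ε β s t mv p q x y i1 i2)

/-- The measure `γ₀₂^{(r)}`. -/
def gam02R (r : ℕ) (ε β s t : ℝ) (mv p q : ℕ → ℝ) (x : Fin l → Fin n → ℝ)
    (y : Fin l → Fin m → ℝ) (i1 i2 p2 : Fin l) :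
    (Fin m → Fin n → ℝ) → (Fin (r+1) → Us m n) → ℝ :=
  PhiUpToR r ε β s t mv p q x y 1 r
    (fun G U =>
      gam0R r ε β s t mv p q x y i1 i2 G U * gam0R r ε β s t mv p q x y i1 p2 G U)

/-- `E_{G,𝒰_{r+1}} ⟨f⟩_{γ_{k₁+1}^{(r)}}`. -/
def EBrR (r : ℕ) (ε β s t : ℝ) (mv p q : ℕ → ℝ) (x : Fin l → Fin n → ℝ)
    (y : Fin l → Fin m → ℝ) (k1 : ℕ) (f : Fin l → Fin l → Fin l → Fin l → ℝ) : ℝ :=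
  ∫ ω, (∑ i1, ∑ i2, ∑ pp1, ∑ pp2,
      f i1 i2 pp1 pp2 * gamR r ε β s t mv p q x y k1 i1 i2 pp1 pp2 ω.1 ω.2) ∂ muAll r m n

/-- `E_{G,𝒰_{r+1}} ⟨f⟩_{γ₀₁^{(r)}}`. -/
def EB01R (r : ℕ) (ε β s t : ℝ) (mv p q : ℕ → ℝ) (x : Fin l → Fin n → ℝ)
    (y : Fin l → Fin m → ℝ) (f : Fin l → Fin l → ℝ) : ℝ :=
  ∫ ω, (∑ i1, ∑ i2, f i1 i2 * gam01R r ε β s t mv p q x y i1 i2 ω.1 ω.2) ∂ muAll r m n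

/-- `E_{G,𝒰_{r+1}} ⟨f⟩_{γ₀₂^{(r)}}`. -/
def EB02R (r : ℕ) (ε β s t : ℝ) (mv p q : ℕ → ℝ) (x : Fin l → Fin n → ℝ)
    (y : Fin l → Fin m → ℝ) (f : Fin l → Fin l → Fin l → ℝ) : ℝ :=
  ∫ ω, (∑ i1, ∑ i2, ∑ p2, f i1 i2 p2 * gam02R r ε β s t mv p q x y i1 i2 p2 ω.1 ω.2)
    ∂ muAll r m n

/-- `E_{G,𝒰_{r+1}} ⟨‖x^{(i₁)}‖‖x^{(p₁)}‖‖y^{(i₂)}‖‖y^{(p₂)}‖⟩_{γ_{k₁+1}^{(r)}}`. -/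
def EXR (r : ℕ) (ε β s t : ℝ) (mv p q : ℕ → ℝ) (x : Fin l → Fin n → ℝ)
    (y : Fin l → Fin m → ℝ) (k1 : ℕ) : ℝ :=
  EBrR r ε β s t mv p q x y k1
    (fun i1 i2 pp1 pp2 => nrm2 (x i1) * nrm2 (x pp1) * nrm2 (y i2) * nrm2 (y pp2))

/-- The corrected interpolating function `ψ₁`. -/
def psi1R (r : ℕ) (ε β s t : ℝ) (mv p q : ℕ → ℝ) (x : Fin l → Fin n → ℝ)
    (y : Fin l → Fin m → ℝ) : ℝ :=
  -(Real.sign s * s * β / (2 * Real.sqrt (n : ℝ))) *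
      (∑ k ∈ Finset.range (r+1),
        mv (k+1) * (p k * q k * EXR r ε β s t mv p q x y k
          - p (k+1) * q (k+1) * EXR r ε β s t mv p q x y (k+1)))
    + psiR r ε β s t mv p q x y

/-- The component `u_j^{(2,k)}`. -/
def u2c {r m n : ℕ} (U : Fin (r+1) → Us m n) (k : ℕ) (j : Fin m) : ℝ :=
  if h : k - 1 < r + 1 then (U ⟨k-1, h⟩).2.1 j else 0

/-- The scalar `u^{(4,k)}`. -/
def u4c {r m n : ℕ} (U : Fin (r+1) → Us m n) (k : ℕ) : ℝ :=
  if h : k - 1 < r + 1 then (U ⟨k-1, h⟩).1 else 0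

/-- `u^{(i₁,3,k)} = (h^{(k)})ᵀ x^{(i₁)} / ‖x^{(i₁)}‖₂`. -/
def u3c {r m n l : ℕ} (x : Fin l → Fin n → ℝ) (U : Fin (r+1) → Us m n) (k : ℕ)
    (i1 : Fin l) : ℝ :=
  if h : k - 1 < r + 1 then dotv (U ⟨k-1, h⟩).2.2 (x i1) / nrm2 (x i1) else 0

/-- The nested conditional expectations
`E_{𝒰_v}(ζ_{v-1}^{𝔪_v/𝔪_{v-1}-1} ⋯ E_{𝒰₁}(ζ₀^{𝔪₁/𝔪₀-1} g) ⋯)`. -/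
def nestR (r : ℕ) (ε β s t : ℝ) (mv p q : ℕ → ℝ) (x : Fin l → Fin n → ℝ)
    (y : Fin l → Fin m → ℝ) (g : (Fin m → Fin n → ℝ) → (Fin (r+1) → Us m n) → ℝ) :
    ℕ → (Fin m → Fin n → ℝ) → (Fin (r+1) → Us m n) → ℝ
  | 0 => g
  | v+1 => fun G U =>
      if h : v < r + 1 then
        ∫ u, zetaR r ε β s t mv p q x y G v (Function.update U ⟨v, h⟩ u) ^
              (mv (v+1) / mv v - 1) *
            nestR r ε β s t mv p q x y g v G (Function.update U ⟨v, h⟩ u) ∂ muU m n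
      else 0

/-- `T^p_{k,1,j}(i₁,i₂)` at the `r`-th level. -/
def TpR (r : ℕ) (ε β s t : ℝ) (mv p q : ℕ → ℝ) (x : Fin l → Fin n → ℝ)
    (y : Fin l → Fin m → ℝ) (k : ℕ) (j : Fin m) (i1 i2 : Fin l) : ℝ :=
  ∫ ω, (zetaR r ε β s t mv p q x y ω.1 r ω.2)⁻¹ *
      nestR r ε β s t mv p q x y
        (fun G U => CR r ε β s t mv p q x y G U i1 ^ (s - 1) *
          AR r ε β s t mv p q x y G U i1 i2 * y i2 j * u2c U k j) r ω.1 ω.2 ∂ muAll r m n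

/-- `T^q_{k,2}(i₁,i₂)` at the `r`-th level. -/
def TqR (r : ℕ) (ε β s t : ℝ) (mv p q : ℕ → ℝ) (x : Fin l → Fin n → ℝ)
    (y : Fin l → Fin m → ℝ) (k : ℕ) (i1 i2 : Fin l) : ℝ :=
  ∫ ω, (zetaR r ε β s t mv p q x y ω.1 r ω.2)⁻¹ *
      nestR r ε β s t mv p q x y
        (fun G U => CR r ε β s t mv p q x y G U i1 ^ (s - 1) *
          AR r ε β s t mv p q x y G U i1 i2 * u3c x U k i1) r ω.1 ω.2 ∂ muAll r m n

/-- `T^{(p,q)}_{k,3}(i₁,i₂)` at the `r`-th level. -/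
def TpqR (r : ℕ) (ε β s t : ℝ) (mv p q : ℕ → ℝ) (x : Fin l → Fin n → ℝ)
    (y : Fin l → Fin m → ℝ) (k : ℕ) (i1 i2 : Fin l) : ℝ :=
  ∫ ω, (zetaR r ε β s t mv p q x y ω.1 r ω.2)⁻¹ *
      nestR r ε β s t mv p q x y
        (fun G U => CR r ε β s t mv p q x y G U i1 ^ (s - 1) *
          AR r ε β s t mv p q x y G U i1 i2 * u4c U k) r ω.1 ω.2 ∂ muAll r m n

end

noncomputable section

instance stdG_prob : IsProbabilityMeasure stdG := by unfold stdG; infer_instance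

/-- Standard Gaussian measure on `J → ℝ`. -/
def gJ (J : Type) [Fintype J] : Measure (J → ℝ) := Measure.pi fun _ => stdG

instance gJ_prob (J : Type) [Fintype J] : IsProbabilityMeasure (gJ J) := by
  unfold gJ; infer_instance

/-- The `ℓ¹` norm. -/
def N1 {J : Type} [Fintype J] (v : J → ℝ) : ℝ := ∑ j, |v j|

lemma N1_nonneg {J : Type} [Fintype J] (v : J → ℝ) : 0 ≤ N1 v :=
  Finset.sum_nonneg fun _ _ => abs_nonneg _

lemma N1_le_exp {J : Type} [Fintype J] (v : J → ℝ) : N1 v ≤ exp (N1 v) := by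
  have := add_one_le_exp (N1 v); linarith

lemma abs_le_N1 {J : Type} [Fintype J] (v : J → ℝ) (j : J) : |v j| ≤ N1 v :=
  Finset.single_le_sum (f := fun j => |v j|) (fun _ _ => abs_nonneg _) (Finset.mem_univ j)

@[fun_prop]
lemma continuous_N1 {J : Type} [Fintype J] : Continuous (N1 : (J → ℝ) → ℝ) := by
  unfold N1; fun_prop

lemma integrable_exp_abs (c : ℝ) : Integrable (fun x => exp (c * |x|)) stdG := by
  have h1 : Integrable (fun x => exp (c * x)) stdG :=
    ProbabilityTheory.integrable_exp_mul_gaussianReal c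
  have h2 : Integrable (fun x => exp (-c * x)) stdG :=
    ProbabilityTheory.integrable_exp_mul_gaussianReal (-c)
  refine (h1.add h2).mono' (by fun_prop) (Filter.Eventually.of_forall fun x => ?_)
  simp only [norm_eq_abs, abs_exp, Pi.add_apply]
  rcases abs_cases x with h | h <;> rw [h.1]
  · have := exp_pos (-c * x); linarith
  · have := exp_pos (c * x)
    rw [show c * -x = -c * x by ring]; linarith

lemma integrable_exp_N1 {J : Type} [Fintype J] (c : ℝ) :
    Integrable (fun v => exp (c * N1 v)) (gJ J) := by
  have := Integrable.fintype_prod (ι := J) (μ := fun _ => stdG) (f := fun _ x => exp (c * |x|))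
    (fun _ => integrable_exp_abs c)
  refine this.congr (Filter.Eventually.of_forall fun v => ?_)
  simp only [N1, Finset.mul_sum, exp_sum]

lemma integrable_of_growth {J : Type} [Fintype J] {E : Type*} [NormedAddCommGroup E]
    {f : (J → ℝ) → E}
    (hf : AEStronglyMeasurable f (gJ J)) (C c : ℝ) (h : ∀ v, ‖f v‖ ≤ C * exp (c * N1 v)) :
    Integrable f (gJ J) :=
  ((integrable_exp_N1 c).const_mul C).mono' hf (Filter.Eventually.of_forall h)

lemma integrable_of_growth2 {J : Type} [Fintype J] {f : (J → ℝ) × (J → ℝ) → ℝ}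
    (hf : AEStronglyMeasurable f ((gJ J).prod (gJ J))) (C c : ℝ)
    (h : ∀ v, |f v| ≤ C * exp (c * (N1 v.1 + N1 v.2))) :
    Integrable f ((gJ J).prod (gJ J)) := by
  refine (((integrable_exp_N1 c).mul_prod (integrable_exp_N1 c)).const_mul C).mono' hf
    (Filter.Eventually.of_forall fun v => (h v).trans_eq ?_)
  rw [mul_add, exp_add]

lemma integrable_of_growth_real {f : ℝ → ℝ}
    (hf : AEStronglyMeasurable f stdG) (C c : ℝ) (h : ∀ v, |f v| ≤ C * exp (c * |v|)) :
    Integrable f stdG :=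
  ((integrable_exp_abs c).const_mul C).mono' hf (Filter.Eventually.of_forall h)

lemma integrable_of_growth_real2 {f : ℝ × ℝ → ℝ}
    (hf : AEStronglyMeasurable f (stdG.prod stdG)) (C c : ℝ)
    (h : ∀ v, |f v| ≤ C * exp (c * (|v.1| + |v.2|))) :
    Integrable f (stdG.prod stdG) := by
  refine (((integrable_exp_abs c).mul_prod (integrable_exp_abs c)).const_mul C).mono' hf
    (Filter.Eventually.of_forall fun v => (h v).trans_eq ?_)
  rw [mul_add, exp_add]

lemma integrable_stdG_iff {f : ℝ → ℝ} :
    Integrable f stdG ↔ Integrable fun x => ProbabilityTheory.gaussianPDFReal 0 1 x * f x := by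
  unfold stdG
  rw [ProbabilityTheory.gaussianReal_of_var_ne_zero _ one_ne_zero,
    integrable_withDensity_iff_integrable_smul₀']
  · simp [ProbabilityTheory.toReal_gaussianPDF]
  · exact (ProbabilityTheory.measurable_gaussianPDF _ _).aemeasurable
  · exact Filter.Eventually.of_forall fun _ => ProbabilityTheory.gaussianPDF_lt_top

/-- One-dimensional Gaussian integration by parts. -/
lemma stein1 {f f' : ℝ → ℝ} (hd : ∀ y, HasDerivAt f (f' y) y) (C c : ℝ)
    (hf : ∀ y, |f y| ≤ C * exp (c * |y|)) (hf' : ∀ y, |f' y| ≤ C * exp (c * |y|)) :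
    ∫ y, y * f y ∂stdG = ∫ y, f' y ∂stdG := by
  have hcont : Continuous f := continuous_iff_continuousAt.2 fun y => (hd y).continuousAt
  have hm' : Measurable f' := by
    have : f' = deriv f := funext fun y => (hd y).deriv.symm
    rw [this]; exact measurable_deriv f
  have i1 : Integrable f stdG := integrable_of_growth_real hcont.aestronglyMeasurable C c hf
  have i2 : Integrable f' stdG := integrable_of_growth_real hm'.aestronglyMeasurable C c hf'
  have i3 : Integrable (fun y => y * f y) stdG := by
    refine integrable_of_growth_real (by fun_prop) C (c + 1) fun y => ?_
    rw [abs_mul]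
    have : |y| ≤ exp |y| := by have := add_one_le_exp |y|; linarith
    calc |y| * |f y| ≤ exp |y| * (C * exp (c * |y|)) :=
          mul_le_mul this (hf y) (abs_nonneg _) (exp_pos _).le
      _ = C * exp ((c + 1) * |y|) := by rw [add_mul, exp_add]; ring_nf
  set g := ProbabilityTheory.gaussianPDFReal 0 1 with hg
  have hgd : ∀ y, HasDerivAt g (-y * g y) y := by
    intro y
    have hgg : g = fun x => (√(2 * π * (1 : NNReal)))⁻¹ * rexp (-(x - 0) ^ 2 / (2 * (1 : NNReal))) := by
      rw [hg, ProbabilityTheory.gaussianPDFReal_def]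
    rw [hgg]
    have h1 : HasDerivAt (fun x : ℝ => -(x - 0) ^ 2 / (2 * ((1 : NNReal) : ℝ))) (-y) y := by
      have h2 : HasDerivAt (fun x : ℝ => x ^ 2) (2 * y) y := by simpa using hasDerivAt_pow 2 y
      have h3 : HasDerivAt (fun x : ℝ => -x ^ 2 / 2) (-(2 * y) / 2) y := (h2.fun_neg).div_const 2
      have h4 : (fun x : ℝ => -(x - 0) ^ 2 / (2 * ((1 : NNReal) : ℝ))) = fun x : ℝ => -x ^ 2 / 2 := by
        funext x; simp
      rw [h4]
      exact h3.congr_deriv (by ring)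
    exact ((h1.exp).const_mul (√(2 * π * (1 : NNReal)))⁻¹).congr_deriv (by ring)
  rw [integrable_stdG_iff] at i1 i2 i3
  have key := integral_eq_zero_of_hasDerivAt_of_integrable (f := fun y => g y * f y)
    (f' := fun y => (-y * g y) * f y + g y * f' y) (fun y => (hgd y).mul (hd y))
    (by
      refine (i2.sub i3).congr (Filter.Eventually.of_forall fun y => ?_)
      simp only [Pi.sub_apply]; ring) i1
  unfold stdG
  rw [ProbabilityTheory.integral_gaussianReal_eq_integral_smul one_ne_zero,
    ProbabilityTheory.integral_gaussianReal_eq_integral_smul one_ne_zero]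
  simp only [smul_eq_mul]
  have h4 : ∫ y, (-y * g y) * f y + g y * f' y = (∫ y, g y * f' y) - ∫ y, g y * (y * f y) := by
    rw [← integral_sub i2 i3]
    congr 1; funext y; ring
  rw [h4] at key
  linarith

lemma stdG_mean : ∫ x, x ∂stdG = 0 := by
  unfold stdG; simp

/-- Rotation-type integration by parts in the plane. -/
lemma stein2 {A A' B : ℝ → ℝ} (hA : ∀ y, HasDerivAt A (A' y) y) (hB : Measurable B) (C c : ℝ)
    (hC : 0 ≤ C) (hc : 0 ≤ c)
    (bA : ∀ y, |A y| ≤ C * exp (c * |y|)) (bA' : ∀ y, |A' y| ≤ C * exp (c * |y|))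
    (bB : ∀ y, |B y| ≤ C * exp (c * |y|)) {σ1 σ2 : ℝ} (h1 : 0 < σ1) (h2 : 0 < σ2) :
    ∫ w, (-(w.1 / σ1) + w.2 / σ2) * (A w.2 * B (σ1 * w.1 + σ2 * w.2)) ∂(stdG.prod stdG) =
      ∫ w, σ2⁻¹ * (A' w.2 * B (σ1 * w.1 + σ2 * w.2)) ∂(stdG.prod stdG) := by
  have hAm : Measurable A :=
    (continuous_iff_continuousAt.2 fun y => (hA y).continuousAt).measurable
  have hA'm : Measurable A' := by
    have : A' = deriv A := funext fun y => (hA y).deriv.symm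
    rw [this]; exact measurable_deriv A
  set V := √(σ1 ^ 2 + σ2 ^ 2) with hV
  have hV0 : 0 < V := by positivity
  have hVV : V ^ 2 = σ1 ^ 2 + σ2 ^ 2 := sq_sqrt (by positivity)
  obtain ⟨θ, hcos, hsin⟩ : ∃ θ : ℝ, cos θ = σ1 / V ∧ sin θ = -(σ2 / V) := by
    have hn : ‖(⟨σ1 / V, -(σ2 / V)⟩ : ℂ)‖ = 1 := by
      rw [Complex.norm_def, Complex.normSq_mk]
      rw [show σ1 / V * (σ1 / V) + -(σ2 / V) * -(σ2 / V) = (σ1 ^ 2 + σ2 ^ 2) / V ^ 2 by ring, hVV,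
        div_self (by positivity), sqrt_one]
    have hne : (⟨σ1 / V, -(σ2 / V)⟩ : ℂ) ≠ 0 := by
      intro h; rw [h] at hn; simp at hn
    refine ⟨Complex.arg ⟨σ1 / V, -(σ2 / V)⟩, ?_, ?_⟩
    · rw [Complex.cos_arg hne, hn]; simp
    · rw [Complex.sin_arg, hn]; simp
  have hrot : (stdG.prod stdG).map (ContinuousLinearMap.rotation θ) = stdG.prod stdG := by
    have : ProbabilityTheory.IsGaussian stdG := by unfold stdG; infer_instance
    exact ProbabilityTheory.IsGaussian.map_rotation_eq_self (by simpa using stdG_mean) θ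
  have hmr : Measurable (ContinuousLinearMap.rotation θ : ℝ × ℝ → ℝ × ℝ) :=
    (ContinuousLinearMap.rotation θ).continuous.measurable
  have hS : ∀ w : ℝ × ℝ, σ1 * (ContinuousLinearMap.rotation θ w).1
      + σ2 * (ContinuousLinearMap.rotation θ w).2 = V * w.1 := by
    intro w
    simp only [ContinuousLinearMap.rotation_apply, hcos, hsin, smul_eq_mul]
    field_simp
    rw [hVV]; ring
  have h22 : ∀ w : ℝ × ℝ, (ContinuousLinearMap.rotation θ w).2 = σ2 / V * w.1 + σ1 / V * w.2 := by
    intro w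
    simp only [ContinuousLinearMap.rotation_apply, hcos, hsin, smul_eq_mul]
    ring
  have h23 : ∀ w : ℝ × ℝ, -((ContinuousLinearMap.rotation θ w).1 / σ1)
      + (ContinuousLinearMap.rotation θ w).2 / σ2 = V / (σ1 * σ2) * w.2 := by
    intro w
    simp only [ContinuousLinearMap.rotation_apply, hcos, hsin, smul_eq_mul]
    field_simp
    rw [hVV]; ring
  have hsub : ∀ φ : ℝ × ℝ → ℝ, Measurable φ → ∫ w, φ w ∂(stdG.prod stdG)
      = ∫ w, φ (ContinuousLinearMap.rotation θ w) ∂(stdG.prod stdG) := by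
    intro φ hφ
    conv_lhs => rw [← hrot]
    rw [integral_map hmr.aemeasurable hφ.aestronglyMeasurable]
  rw [hsub _ (by fun_prop), hsub (fun w => σ2⁻¹ * (A' w.2 * B (σ1 * w.1 + σ2 * w.2))) (by fun_prop)]
  simp only [hS, h23]
  simp only [h22]
  have ha1 : |σ2 / V| ≤ 1 := by
    rw [abs_of_pos (by positivity), div_le_one hV0]
    exact le_of_sq_le_sq (by nlinarith) hV0.le
  have ha2 : |σ1 / V| ≤ 1 := by
    rw [abs_of_pos (by positivity), div_le_one hV0]
    exact le_of_sq_le_sq (by nlinarith) hV0.le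
  have hlin : ∀ x y : ℝ, |σ2 / V * x + σ1 / V * y| ≤ |x| + |y| := by
    intro x y
    refine (abs_add_le _ _).trans ?_
    rw [abs_mul, abs_mul]
    nlinarith [abs_nonneg x, abs_nonneg y]
  have hgA : ∀ (D : ℝ → ℝ), (∀ y, |D y| ≤ C * exp (c * |y|)) → ∀ x y,
      |D (σ2 / V * x + σ1 / V * y)| ≤ C * exp (c * (|x| + |y|)) := by
    intro D hD x y
    refine (hD _).trans ?_
    have := hlin x y
    gcongr
  have hgB : ∀ x y : ℝ, |B (V * x)| ≤ C * exp (c * V * (|x| + |y|)) := by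
    intro x y
    refine (bB _).trans ?_
    rw [abs_mul, abs_of_pos hV0, ← mul_assoc]
    have := abs_nonneg y
    gcongr
    linarith
  have hprod : ∀ (D : ℝ → ℝ), (∀ y, |D y| ≤ C * exp (c * |y|)) → ∀ x y,
      |D (σ2 / V * x + σ1 / V * y) * B (V * x)| ≤ C ^ 2 * exp ((c + c * V) * (|x| + |y|)) := by
    intro D hD x y
    rw [abs_mul]
    refine (mul_le_mul (hgA D hD x y) (hgB x y) (abs_nonneg _) (by positivity)).trans_eq ?_
    rw [add_mul, exp_add]; ring
  have I1 : Integrable (fun w : ℝ × ℝ => V / (σ1 * σ2) * w.2 *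
      (A (σ2 / V * w.1 + σ1 / V * w.2) * B (V * w.1))) (stdG.prod stdG) := by
    refine integrable_of_growth_real2 (by fun_prop) (V / (σ1 * σ2) * C ^ 2) (c + c * V + 1) ?_
    rintro ⟨x, y⟩
    rw [abs_mul, abs_mul, abs_of_pos (show 0 < V / (σ1 * σ2) by positivity)]
    have h5 : |y| ≤ exp (|x| + |y|) := by
      have := add_one_le_exp (|x| + |y|); have := abs_nonneg x; linarith
    calc _ ≤ V / (σ1 * σ2) * exp (|x| + |y|) * (C ^ 2 * exp ((c + c * V) * (|x| + |y|))) := by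
            have := hprod A bA x y
            dsimp only
            gcongr
      _ = _ := by
        dsimp only
        generalize |x| + |y| = S
        rw [add_mul (c + c * V), exp_add, one_mul]; ring
  have I2 : Integrable (fun w : ℝ × ℝ => σ2⁻¹ *
      (A' (σ2 / V * w.1 + σ1 / V * w.2) * B (V * w.1))) (stdG.prod stdG) := by
    refine Integrable.const_mul ?_ _
    refine integrable_of_growth_real2 (by fun_prop) (C ^ 2) (c + c * V) ?_
    rintro ⟨x, y⟩
    exact hprod A' bA' x y
  rw [integral_prod _ I1, integral_prod _ I2]
  congr 1; funext x
  have hst := stein1 (f := fun y => A (σ2 / V * x + σ1 / V * y))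
    (f' := fun y => σ1 / V * A' (σ2 / V * x + σ1 / V * y)) (fun y => by
      have hl : HasDerivAt (fun y : ℝ => σ2 / V * x + σ1 / V * y) (σ1 / V) y := by
        simpa using ((hasDerivAt_id y).const_mul (σ1 / V)).const_add (σ2 / V * x)
      have := (hA (σ2 / V * x + σ1 / V * y)).comp y hl
      simpa [mul_comm, Function.comp_def] using this) (C * exp (c * |x|)) c
    (fun y => (hgA A bA x y).trans_eq (by rw [mul_add, exp_add]; ring))
    (fun y => by
      rw [abs_mul]
      have h6 := hgA A' bA' x y
      have : |σ1 / V| * |A' (σ2 / V * x + σ1 / V * y)| ≤ 1 * (C * exp (c * (|x| + |y|))) := by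
        gcongr
      refine this.trans_eq (by rw [mul_add, exp_add]; ring))
  calc _ = V / (σ1 * σ2) * B (V * x) * ∫ y, y * A (σ2 / V * x + σ1 / V * y) ∂stdG := by
        rw [← integral_const_mul]; congr 1; funext y; ring
    _ = ∫ y, σ2⁻¹ * (A' (σ2 / V * x + σ1 / V * y) * B (V * x)) ∂stdG := by
        rw [hst, ← integral_const_mul]; congr 1; funext y; field_simp

/-- Resampling one coordinate of a product measure. -/
lemma resample {J X : Type} [Fintype J] [DecidableEq J] [MeasurableSpace X] (μ : Measure X)
    [IsProbabilityMeasure μ] (j : J) :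
    MeasurePreserving (fun w : (J → X) × X => Function.update w.1 j w.2)
      ((Measure.pi fun _ : J => μ).prod μ) (Measure.pi fun _ : J => μ) := by
  have hm : Measurable (fun w : (J → X) × X => Function.update w.1 j w.2) := by
    refine measurable_pi_iff.2 fun i => ?_
    by_cases h : i = j
    · subst h; simpa using measurable_snd
    · have h' : (fun w : (J → X) × X => Function.update w.1 j w.2 i) = fun w => w.1 i := by
        funext w; exact Function.update_of_ne h _ _
      rw [h']; fun_prop
  refine ⟨hm, ?_⟩
  symm
  refine Measure.pi_eq fun s hs => ?_
  rw [Measure.map_apply hm (MeasurableSet.univ_pi hs)]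
  have : (fun w : (J → X) × X => Function.update w.1 j w.2) ⁻¹' (Set.univ.pi s)
      = (Set.univ.pi (Function.update s j Set.univ)) ×ˢ s j := by
    ext w
    simp only [Set.mem_preimage, Set.mem_univ_pi, Set.mem_prod]
    constructor
    · intro h
      refine ⟨fun i => ?_, by simpa using h j⟩
      by_cases hi : i = j
      · subst hi; simp
      · simpa [Function.update_of_ne hi] using h i
    · rintro ⟨h, h'⟩ i
      by_cases hi : i = j
      · subst hi; simpa using h'
      · simpa [Function.update_of_ne hi] using h i
  rw [this, Measure.prod_prod, Measure.pi_pi, ← Finset.mul_prod_erase _ _ (Finset.mem_univ j),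
    ← Finset.mul_prod_erase Finset.univ (fun i => μ (s i)) (Finset.mem_univ j)]
  simp only [Function.update_self, measure_univ, one_mul]
  rw [mul_comm]
  congr 1
  refine Finset.prod_congr rfl fun i hi => ?_
  rw [Function.update_of_ne (Finset.ne_of_mem_erase hi)]

lemma N1_update_le {J : Type} [Fintype J] [DecidableEq J] (v : J → ℝ) (j : J) (a : ℝ) :
    N1 (Function.update v j a) ≤ N1 v + |a| := by
  have h : ∀ i, |Function.update v j a i| ≤ |v i| + if i = j then |a| else 0 := by
    intro i
    by_cases h : i = j
    · subst h; simp
    · simp [h]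
  refine (Finset.sum_le_sum fun i _ => h i).trans_eq ?_
  simp [Finset.sum_add_distrib, N1]

/-- Coordinatewise integration by parts for a pair of Gaussian vectors. -/
lemma steinJ {J : Type} [Fintype J] [DecidableEq J] (j : J) {A A' B : (J → ℝ) → ℝ}
    (hA : ∀ v, HasDerivAt (fun a => A (Function.update v j a)) (A' v) (v j))
    (hAm : Measurable A) (hA'm : Measurable A') (hBm : Measurable B)
    (C c : ℝ) (hC : 0 ≤ C) (hc : 0 ≤ c)
    (bA : ∀ y, |A y| ≤ C * exp (c * N1 y)) (bA' : ∀ y, |A' y| ≤ C * exp (c * N1 y))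
    (bB : ∀ y, |B y| ≤ C * exp (c * N1 y)) {σ1 σ2 : J → ℝ} (h1 : 0 < σ1 j) (h2 : 0 < σ2 j) :
    Integrable (fun w : (J → ℝ) × (J → ℝ) => (-(w.1 j / σ1 j) + w.2 j / σ2 j) *
      (A w.2 * B (fun i => σ1 i * w.1 i + σ2 i * w.2 i))) ((gJ J).prod (gJ J)) ∧
    Integrable (fun w : (J → ℝ) × (J → ℝ) => (σ2 j)⁻¹ *
      (A' w.2 * B (fun i => σ1 i * w.1 i + σ2 i * w.2 i))) ((gJ J).prod (gJ J)) ∧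
    ∫ w, (-(w.1 j / σ1 j) + w.2 j / σ2 j) * (A w.2 * B (fun i => σ1 i * w.1 i + σ2 i * w.2 i))
        ∂((gJ J).prod (gJ J)) =
      ∫ w, (σ2 j)⁻¹ * (A' w.2 * B (fun i => σ1 i * w.1 i + σ2 i * w.2 i))
        ∂((gJ J).prod (gJ J)) := by
  have hB2 : Measurable (fun w : (J → ℝ) × (J → ℝ) => B (fun i => σ1 i * w.1 i + σ2 i * w.2 i)) :=
    hBm.comp (by fun_prop)
  set s : ℝ := ∑ i, (|σ1 i| + |σ2 i|) with hs
  have hs1 : ∀ i, |σ1 i| ≤ s := fun i => by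
    refine le_trans ?_ (Finset.single_le_sum (f := fun i => |σ1 i| + |σ2 i|)
      (fun _ _ => by positivity) (Finset.mem_univ i))
    simp
  have hs2 : ∀ i, |σ2 i| ≤ s := fun i => by
    refine le_trans ?_ (Finset.single_le_sum (f := fun i => |σ1 i| + |σ2 i|)
      (fun _ _ => by positivity) (Finset.mem_univ i))
    simp
  have hs0 : 0 ≤ s := Finset.sum_nonneg fun _ _ => by positivity
  have hN : ∀ u v : J → ℝ, N1 (fun i => σ1 i * u i + σ2 i * v i) ≤ s * (N1 u + N1 v) := by
    intro u v
    simp only [N1]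
    rw [← Finset.sum_add_distrib, Finset.mul_sum]
    refine Finset.sum_le_sum fun i _ => (abs_add_le _ _).trans ?_
    rw [abs_mul, abs_mul, mul_add]
    have := hs1 i; have := hs2 i
    gcongr
  have hgr : ∀ D : (J → ℝ) → ℝ, (∀ y, |D y| ≤ C * exp (c * N1 y)) → ∀ u v : J → ℝ,
      |D v * B (fun i => σ1 i * u i + σ2 i * v i)| ≤ C ^ 2 * exp ((c + c * s) * (N1 u + N1 v)) := by
    intro D hD u v
    rw [abs_mul]
    have e1 : |D v| ≤ C * exp (c * (N1 u + N1 v)) := by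
      refine (hD v).trans ?_
      have := N1_nonneg u
      gcongr; linarith
    have e2 : |B (fun i => σ1 i * u i + σ2 i * v i)| ≤ C * exp (c * s * (N1 u + N1 v)) := by
      refine (bB _).trans ?_
      rw [mul_assoc]
      have := hN u v
      gcongr
    refine (mul_le_mul e1 e2 (abs_nonneg _) (by positivity)).trans_eq ?_
    rw [add_mul, exp_add]; ring
  have I1 : Integrable (fun w : (J → ℝ) × (J → ℝ) => (-(w.1 j / σ1 j) + w.2 j / σ2 j) *
      (A w.2 * B (fun i => σ1 i * w.1 i + σ2 i * w.2 i))) ((gJ J).prod (gJ J)) := by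
    refine integrable_of_growth2 (by
      refine Measurable.aestronglyMeasurable ?_
      exact Measurable.mul (by fun_prop) ((hAm.comp measurable_snd).mul hB2))
      (((σ1 j)⁻¹ + (σ2 j)⁻¹) * C ^ 2) (c + c * s + 1) ?_
    rintro ⟨u, v⟩
    rw [abs_mul]
    have h5 : N1 u + N1 v ≤ exp (N1 u + N1 v) := by
      have := add_one_le_exp (N1 u + N1 v); linarith
    have h6 : |-(u j / σ1 j) + v j / σ2 j| ≤ ((σ1 j)⁻¹ + (σ2 j)⁻¹) * exp (N1 u + N1 v) := by
      refine (abs_add_le _ _).trans ?_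
      rw [abs_neg, abs_div, abs_div, abs_of_pos h1, abs_of_pos h2, add_mul, div_eq_inv_mul,
        div_eq_inv_mul]
      have a1 : |u j| ≤ exp (N1 u + N1 v) := by
        have := abs_le_N1 u j; have := N1_nonneg v; linarith
      have a2 : |v j| ≤ exp (N1 u + N1 v) := by
        have := abs_le_N1 v j; have := N1_nonneg u; linarith
      gcongr
    refine (mul_le_mul h6 (hgr A bA u v) (abs_nonneg _) (by positivity)).trans_eq ?_
    dsimp only
    generalize N1 u + N1 v = S
    rw [add_mul (c + c * s), exp_add, one_mul]; ring
  have I2 : Integrable (fun w : (J → ℝ) × (J → ℝ) => (σ2 j)⁻¹ *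
      (A' w.2 * B (fun i => σ1 i * w.1 i + σ2 i * w.2 i))) ((gJ J).prod (gJ J)) := by
    refine Integrable.const_mul ?_ _
    refine integrable_of_growth2 (by
      refine Measurable.aestronglyMeasurable ?_
      exact ((hA'm.comp measurable_snd).mul hB2)) (C ^ 2) (c + c * s) ?_
    rintro ⟨u, v⟩
    exact hgr A' bA' u v
  have mp := measurePreserving_arrowProdEquivProdArrow ℝ ℝ J (fun _ => stdG) (fun _ => stdG)
  have mr := resample (J := J) (stdG.prod stdG) j
  have mq := mp.comp mr
  change MeasurePreserving _ _ ((gJ J).prod (gJ J)) at mq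
  have hred : ∀ φ : (J → ℝ) × (J → ℝ) → ℝ, Integrable φ ((gJ J).prod (gJ J)) →
      ∫ w, φ w ∂((gJ J).prod (gJ J)) = ∫ z, ∫ a, φ (Function.update (fun i => (z i).1) j a.1,
        Function.update (fun i => (z i).2) j a.2) ∂(stdG.prod stdG)
        ∂(Measure.pi fun _ : J => stdG.prod stdG) := by
    intro φ hφ
    have hφ' := (mq.integrable_comp hφ.aestronglyMeasurable).2 hφ
    conv_lhs => rw [← mq.map_eq]
    rw [integral_map mq.measurable.aemeasurable (by rw [mq.map_eq]; exact hφ.aestronglyMeasurable)]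
    refine (integral_prod _ hφ').trans ?_
    congr 1; funext z; congr 1; funext a
    simp only [Function.comp_def, MeasurableEquiv.arrowProdEquivProdArrow, MeasurableEquiv.coe_mk,
      Equiv.arrowProdEquivProdArrow, Equiv.coe_fn_mk]
    congr 1
    refine Prod.ext ?_ ?_ <;>
    · funext i
      by_cases h : i = j
      · subst h; simp
      · simp [h]
  refine ⟨I1, I2, ?_⟩
  rw [hred _ I1, hred _ I2]
  congr 1; funext z
  set u := fun i => (z i).1
  set v := fun i => (z i).2
  have hupd : ∀ a b : ℝ, (fun i => σ1 i * Function.update u j a i + σ2 i * Function.update v j b i)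
      = Function.update (fun i => σ1 i * u i + σ2 i * v i) j (σ1 j * a + σ2 j * b) := by
    intro a b; funext i
    by_cases h : i = j
    · subst h; simp
    · simp [h]
  simp only [Function.update_self, hupd]
  set w0 := fun i => σ1 i * u i + σ2 i * v i
  have hgu : ∀ D : (J → ℝ) → ℝ, (∀ y, |D y| ≤ C * exp (c * N1 y)) → ∀ (w : J → ℝ) (y : ℝ),
      |D (Function.update w j y)| ≤ C * exp (c * N1 w) * exp (c * |y|) := by
    intro D hD w y
    refine (hD _).trans ?_
    rw [mul_assoc, ← exp_add, ← mul_add]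
    have := N1_update_le w j y
    gcongr
  refine stein2 (A := fun y => A (Function.update v j y)) (A' := fun y => A' (Function.update v j y))
    (B := fun y => B (Function.update w0 j y)) ?_ ?_
    (C * exp (c * N1 v) + C * exp (c * N1 w0)) c (by positivity) hc ?_ ?_ ?_ h1 h2
  · intro y
    have := hA (Function.update v j y)
    simpa using this
  · exact hBm.comp (measurable_update w0)
  · intro y; refine (hgu A bA v y).trans ?_
    gcongr; have : 0 ≤ C * exp (c * N1 w0) := by positivity
    linarith
  · intro y; refine (hgu A' bA' v y).trans ?_
    gcongr; have : 0 ≤ C * exp (c * N1 w0) := by positivity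
    linarith
  · intro y; refine (hgu B bB w0 y).trans ?_
    gcongr; have : 0 ≤ C * exp (c * N1 v) := by positivity
    linarith

/-- Normalised log-moment (plain mean when `m = 0`). -/
def TT {V : Type} [MeasurableSpace V] (m : ℝ) (μ : Measure V) (g : V → ℝ) : ℝ :=
  if m = 0 then ∫ v, g v ∂μ else (1 / m) * log (∫ v, exp (m * g v) ∂μ)

/-- Tilted average. -/
def Av {V : Type} [MeasurableSpace V] (m : ℝ) (μ : Measure V) (g h : V → ℝ) : ℝ :=
  (∫ v, exp (m * g v) ∂μ)⁻¹ * ∫ v, exp (m * g v) * h v ∂μ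

lemma exp_TT {V : Type} [MeasurableSpace V] (m : ℝ) (μ : Measure V) [IsProbabilityMeasure μ]
    (g : V → ℝ) (hg : Integrable (fun v => exp (m * g v)) μ) :
    exp (m * TT m μ g) = ∫ v, exp (m * g v) ∂μ := by
  unfold TT
  split_ifs with h
  · simp [h]
  · rw [← mul_assoc, mul_one_div_cancel h, one_mul, exp_log (integral_exp_pos hg)]

section growth
variable {J : Type} [Fintype J]

lemma int_exp_of_lin {m : ℝ} {g : (J → ℝ) → ℝ} (hm : Measurable g) {a b : ℝ}
    (h : ∀ v, |g v| ≤ a + b * N1 v) : Integrable (fun v => exp (m * g v)) (gJ J) := by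
  refine integrable_of_growth (by fun_prop) (exp (|m| * a)) (|m| * b) fun v => ?_
  rw [norm_eq_abs, abs_exp, ← exp_add, exp_le_exp]
  calc m * g v ≤ |m * g v| := le_abs_self _
    _ ≤ |m| * (a + b * N1 v) := by rw [abs_mul]; have := h v; gcongr
    _ = _ := by ring

lemma int_of_lin {g : (J → ℝ) → ℝ} (hm : Measurable g) {a b : ℝ} 
    (h : ∀ v, |g v| ≤ a + b * N1 v) : Integrable g (gJ J) := by
  refine integrable_of_growth (by fun_prop) (|a| + |b|) 1 fun v => ?_
  rw [norm_eq_abs, one_mul]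
  refine (h v).trans ?_
  have h1 := N1_le_exp v
  have h2 := N1_nonneg v
  have h3 : 1 ≤ exp (N1 v) := one_le_exp h2
  rw [add_mul]
  have : b * N1 v ≤ |b| * exp (N1 v) := by
    calc b * N1 v ≤ |b| * N1 v := by gcongr; exact le_abs_self b
      _ ≤ _ := by gcongr
  have : a ≤ |a| * exp (N1 v) := by
    calc a ≤ |a| * 1 := by simpa using le_abs_self a
      _ ≤ _ := by gcongr
  linarith

lemma TT_le_of_shift {m : ℝ} {g g' : (J → ℝ) → ℝ} (hg : Measurable g) (hg' : Measurable g')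
    {a b c : ℝ} (h : ∀ v, |g v| ≤ a + b * N1 v) (h' : ∀ v, |g' v| ≤ a + b * N1 v)
    (hc : ∀ v, |g v - g' v| ≤ c) : |TT m (gJ J) g - TT m (gJ J) g'| ≤ c := by
  have key : ∀ g g' : (J → ℝ) → ℝ, Measurable g → Measurable g' → (∀ v, |g v| ≤ a + b * N1 v) →
      (∀ v, |g' v| ≤ a + b * N1 v) → (∀ v, |g v - g' v| ≤ c) →
      TT m (gJ J) g - TT m (gJ J) g' ≤ c := by
    intro g g' hg hg' h h' hc
    unfold TT
    split_ifs with hm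
    · rw [← integral_sub (int_of_lin hg h) (int_of_lin hg' h')]
      calc _ ≤ ∫ v, c ∂(gJ J) := integral_mono ((int_of_lin hg h).sub (int_of_lin hg' h'))
            (integrable_const _) fun v => (le_abs_self _).trans (hc v)
        _ = c := by simp
    · have i1 := int_exp_of_lin (m := m) hg h
      have i2 := int_exp_of_lin (m := m) hg' h'
      rcases lt_or_gt_of_ne hm with hneg | hpos
      · have : ∫ v, exp (m * g' v) ∂(gJ J) ≤ exp (-(m * c)) * ∫ v, exp (m * g v) ∂(gJ J) := by
          rw [← integral_const_mul]
          refine integral_mono i2 (i1.const_mul _) fun v => ?_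
          dsimp only
          rw [← exp_add, exp_le_exp]
          have := le_of_abs_le (hc v); nlinarith
        have h3 := log_le_log (integral_exp_pos i2) this
        rw [log_mul (exp_pos _).ne' (integral_exp_pos i1).ne', log_exp] at h3
        rw [← mul_sub, one_div, inv_mul_eq_div, div_le_iff_of_neg hneg]
        linarith
      · have : ∫ v, exp (m * g v) ∂(gJ J) ≤ exp (m * c) * ∫ v, exp (m * g' v) ∂(gJ J) := by
          rw [← integral_const_mul]
          refine integral_mono i1 (i2.const_mul _) fun v => ?_
          dsimp only
          rw [← exp_add, exp_le_exp]
          have := le_of_abs_le (hc v); nlinarith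
        have h3 := log_le_log (integral_exp_pos i1) this
        rw [log_mul (exp_pos _).ne' (integral_exp_pos i2).ne', log_exp] at h3
        rw [← mul_sub, one_div, inv_mul_le_iff₀ hpos]
        linarith
  rw [abs_le]
  have h1 := key g g' hg hg' h h' hc
  have h2 := key g' g hg' hg h' h fun v => by rw [abs_sub_comm]; exact hc v
  constructor <;> linarith

lemma abs_exp_sub_le (x y d : ℝ) (h : |x - y| ≤ d) : |exp x - exp y| ≤ exp (y + d) * |x - y| := by
  have h1 : ∀ a b : ℝ, exp a - exp b ≤ exp a * (a - b) := by
    intro a b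
    have := add_one_le_exp (b - a)
    have h2 : exp b = exp a * exp (b - a) := by rw [← exp_add]; ring_nf
    rw [h2]; nlinarith [exp_pos a]
  have hd := abs_le.1 h
  have e1 : exp x ≤ exp (y + d) := exp_le_exp.2 (by linarith)
  have e2 : exp y ≤ exp (y + d) := exp_le_exp.2 (by linarith [abs_nonneg (x - y)])
  rcases le_total y x with hxy | hxy
  · rw [abs_of_nonneg (sub_nonneg.2 (exp_le_exp.2 hxy)), abs_of_nonneg (sub_nonneg.2 hxy)]
    refine (h1 x y).trans ?_
    gcongr
  · rw [abs_of_nonpos (sub_nonpos.2 (exp_le_exp.2 hxy)), abs_of_nonpos (sub_nonpos.2 hxy)]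
    have := h1 y x
    calc _ ≤ exp y * (y - x) := by linarith
      _ ≤ exp (y + d) * (y - x) := by gcongr
      _ = _ := by ring

lemma TT_add_const {m : ℝ} {g : (J → ℝ) → ℝ} (hg : Measurable g)
    {a b : ℝ} (h : ∀ v, |g v| ≤ a + b * N1 v) (c : ℝ) :
    TT m (gJ J) (fun v => g v + c) = TT m (gJ J) g + c := by
  unfold TT
  split_ifs with hm
  · rw [integral_add (int_of_lin hg h) (integrable_const _)]; simp
  · have i1 := int_exp_of_lin (m := m) hg h
    have : ∫ v, exp (m * (g v + c)) ∂(gJ J) = (∫ v, exp (m * g v) ∂(gJ J)) * exp (m * c) := by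
      rw [← integral_mul_const]; congr 1; funext v; rw [mul_add, exp_add]
    rw [this, log_mul (integral_exp_pos i1).ne' (exp_pos _).ne', log_exp]
    field_simp

/-- Uniform modulus of `TT` with respect to perturbations growing like `N1`. -/
lemma TT_diff (m b : ℝ) (hb : 0 ≤ b) : ∃ C, 0 ≤ C ∧ ∀ (δ g0 : ℝ) (g g' : (J → ℝ) → ℝ), 0 ≤ δ →
    Measurable g → Measurable g' → (∀ v, |g v - g0| ≤ b * N1 v) → (∀ v, |g' v - g0| ≤ b * N1 v) →
    (∀ v, |g v - g' v| ≤ δ * N1 v) → |TT m (gJ J) g - TT m (gJ J) g'| ≤ C * δ := by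
  set C1 := ∫ v, |m| * N1 v * exp (3 * |m| * b * N1 v) ∂(gJ J) with hC1
  set c0 := ∫ v, exp (-(|m| * b) * N1 v) ∂(gJ J) with hc0
  have hc0p : 0 < c0 := integral_exp_pos (integrable_exp_N1 _)
  have hC1p : 0 ≤ C1 := integral_nonneg fun v => by have := N1_nonneg v; positivity
  have iN : Integrable (fun v => N1 v) (gJ J) :=
    int_of_lin (a := 0) (b := 1) (by fun_prop) fun v => by
      rw [abs_of_nonneg (N1_nonneg v)]; linarith
  have iC1 : Integrable (fun v => |m| * N1 v * exp (3 * |m| * b * N1 v)) (gJ J) := by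
    refine integrable_of_growth (by fun_prop) |m| (1 + 3 * |m| * b) fun v => ?_
    have h2 := N1_nonneg v
    rw [norm_eq_abs, abs_of_nonneg (by positivity), add_mul, exp_add, one_mul, ← mul_assoc]
    gcongr; exact N1_le_exp v
  by_cases hm : m = 0
  · refine ⟨∫ v, N1 v ∂(gJ J), integral_nonneg fun v => N1_nonneg v, ?_⟩
    intro δ g0 g g' hδ hg hg' h h' hd
    unfold TT
    rw [if_pos hm, if_pos hm]
    have b1 : ∀ v, |g v| ≤ |g0| + b * N1 v := fun v => by
      have := h v; have := abs_sub_abs_le_abs_sub (g v) g0; linarith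
    have b2 : ∀ v, |g' v| ≤ |g0| + b * N1 v := fun v => by
      have := h' v; have := abs_sub_abs_le_abs_sub (g' v) g0; linarith
    have i1 := int_of_lin hg b1
    have i2 := int_of_lin hg' b2
    rw [← integral_sub i1 i2, mul_comm, ← integral_const_mul]
    exact (abs_integral_le_integral_abs).trans
      (integral_mono (i1.sub i2).abs (iN.const_mul _) hd)
  · refine ⟨|1 / m| * (C1 / c0), by positivity, ?_⟩
    have main : ∀ (δ : ℝ) (g g' : (J → ℝ) → ℝ), 0 ≤ δ →
      Measurable g → Measurable g' → (∀ v, |g v| ≤ b * N1 v) → (∀ v, |g' v| ≤ b * N1 v) →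
      (∀ v, |g v - g' v| ≤ δ * N1 v) → |TT m (gJ J) g - TT m (gJ J) g'| ≤
        |1 / m| * (C1 / c0) * δ := by
      intro δ g g' hδ hg hg' h h' hd
      unfold TT
      rw [if_neg hm, if_neg hm, ← mul_sub, abs_mul, mul_assoc]
      gcongr
      have i1 : Integrable (fun v => exp (m * g v)) (gJ J) :=
        int_exp_of_lin (a := 0) (b := b) hg (by simpa using h)
      have i2 : Integrable (fun v => exp (m * g' v)) (gJ J) :=
        int_exp_of_lin (a := 0) (b := b) hg' (by simpa using h')
      have low : ∀ g : (J → ℝ) → ℝ, (∀ v, |g v| ≤ b * N1 v) →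
          Integrable (fun v => exp (m * g v)) (gJ J) → c0 ≤ ∫ v, exp (m * g v) ∂(gJ J) := by
        intro g h i
        refine integral_mono (integrable_exp_N1 _) i fun v => exp_le_exp.2 ?_
        have : |m * g v| ≤ |m| * (b * N1 v) := by rw [abs_mul]; have := h v; gcongr
        have := neg_le_of_abs_le this; linarith
      have l1 := low g h i1
      have l2 := low g' h' i2
      have hdI : |(∫ v, exp (m * g v) ∂(gJ J)) - ∫ v, exp (m * g' v) ∂(gJ J)| ≤ C1 * δ := by
        rw [← integral_sub i1 i2, hC1, mul_comm, ← integral_const_mul]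
        refine (abs_integral_le_integral_abs).trans
          (integral_mono (i1.sub i2).abs (iC1.const_mul _) fun v => ?_)
        dsimp only
        have hN := N1_nonneg v
        have e0 : |m * g v - m * g' v| ≤ |m| * (δ * N1 v) := by
          rw [← mul_sub, abs_mul]; have := hd v; gcongr
        have e1 : |m * g v - m * g' v| ≤ 2 * |m| * b * N1 v := by
          rw [← mul_sub, abs_mul]
          have : |g v - g' v| ≤ 2 * b * N1 v := by
            refine (abs_sub _ _).trans ?_
            have := h v; have := h' v; linarith
          calc |m| * |g v - g' v| ≤ |m| * (2 * b * N1 v) := by gcongr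
            _ = _ := by ring
        refine (abs_exp_sub_le _ _ _ e1).trans ?_
        have e2 : m * g' v ≤ |m| * b * N1 v := by
          calc m * g' v ≤ |m * g' v| := le_abs_self _
            _ ≤ |m| * (b * N1 v) := by rw [abs_mul]; have := h' v; gcongr
            _ = _ := by ring
        calc _ ≤ exp (3 * |m| * b * N1 v) * (|m| * (δ * N1 v)) := by
              gcongr; linarith
          _ = _ := by ring
      have hlog : ∀ a b : ℝ, c0 ≤ a → c0 ≤ b → log a - log b ≤ |a - b| / c0 := by
        intro a b ha hb
        have ha0 := hc0p.trans_le ha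
        have hb0 := hc0p.trans_le hb
        rw [← log_div ha0.ne' hb0.ne']
        have := log_le_sub_one_of_pos (div_pos ha0 hb0)
        calc _ ≤ a / b - 1 := this
          _ = (a - b) / b := by field_simp
          _ ≤ |a - b| / b := by gcongr; exact le_abs_self _
          _ ≤ _ := by gcongr
      have f1 := hlog _ _ l1 l2
      have f2 := hlog _ _ l2 l1
      rw [abs_sub_comm (∫ v, exp (m * g' v) ∂(gJ J))] at f2
      refine (abs_le.2 ⟨by linarith, f1⟩).trans ?_
      rw [div_mul_eq_mul_div]
      gcongr
    intro δ g0 g g' hδ hg hg' h h' hd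
    have := main δ (fun v => g v - g0) (fun v => g' v - g0) hδ (by fun_prop) (by fun_prop) h h'
      (by simpa using hd)
    have a1 := TT_add_const (m := m) (g := fun v => g v - g0) (a := 0) (b := b) (by fun_prop)
      (by simpa using h) g0
    have a2 := TT_add_const (m := m) (g := fun v => g' v - g0) (a := 0) (b := b) (by fun_prop)
      (by simpa using h') g0
    simp only [sub_add_cancel] at a1 a2
    rw [a1, a2]
    simpa using this

end growth

section LSE
variable {J : Type} [Fintype J]

lemma LSE {H : Type} [NormedAddCommGroup H] [NormedSpace ℝ H] (m : ℝ) (f : H → (J → ℝ) → ℝ)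
    (f' : (J → ℝ) → H →L[ℝ] ℝ) (w0 : H) (a b : ℝ)
    (hmeas : ∀ w, Measurable (f w)) (hf' : AEStronglyMeasurable f' (gJ J))
    (hgrow : ∀ v, |f w0 v| ≤ a + b * N1 v)
    (hlip : ∀ᶠ w in nhds w0, ∀ v, |f w v - f w0 v| ≤ (a + b * N1 v) * ‖w - w0‖)
    (hd : ∀ v, HasFDerivAt (fun w => f w v) (f' v) w0) :
    ∃ L : H →L[ℝ] ℝ, HasFDerivAt (fun w => TT m (gJ J) (f w)) L w0 ∧
      ∀ h, L h = Av m (gJ J) (f w0) (fun v => f' v h) := by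
  have hab : ∀ v, 0 ≤ a + b * N1 v := fun v => (abs_nonneg _).trans (hgrow v)
  have i0 : Integrable (fun v : J → ℝ => a + b * N1 v) (gJ J) :=
    int_of_lin (by fun_prop) fun v => (abs_of_nonneg (hab v)).le
  unfold Av TT
  by_cases hm : m = 0
  · simp only [hm, if_true]
    have key := hasFDerivAt_integral_of_dominated_loc_of_lip' (μ := gJ J) (F := f) (x₀ := w0)
      (F' := f') (bound := fun v => a + b * N1 v) hlip
      (fun w _ => (hmeas w).aestronglyMeasurable) (int_of_lin (hmeas w0) hgrow) hf'
      (Filter.Eventually.of_forall fun v w hw => hw v) i0 (Filter.Eventually.of_forall hd)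
    refine ⟨_, key.2, fun h => ?_⟩
    rw [ContinuousLinearMap.integral_apply key.1]
    simp
  · simp only [hm, if_false]
    have i1 := int_exp_of_lin (m := m) (hmeas w0) hgrow
    have hs : {w | ∀ v, |f w v - f w0 v| ≤ (a + b * N1 v) * ‖w - w0‖} ∩ Metric.closedBall w0 1
        ∈ nhds w0 := Filter.inter_mem hlip (Metric.closedBall_mem_nhds _ one_pos)
    have ib : Integrable (fun v : J → ℝ => |m| * exp ((2 * |m| + 1) * (a + b * N1 v))) (gJ J) := by
      refine Integrable.const_mul ?_ _
      exact int_exp_of_lin (by fun_prop) fun v => (abs_of_nonneg (hab v)).le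
    have key := hasFDerivAt_integral_of_dominated_loc_of_lip' (μ := gJ J)
      (F := fun w v => exp (m * f w v)) (x₀ := w0)
      (F' := fun v => exp (m * f w0 v) • (m • f' v))
      (bound := fun v => |m| * exp ((2 * |m| + 1) * (a + b * N1 v))) hs
      (fun w _ => by have := hmeas w; fun_prop) i1
      (by
        have hm1 : AEStronglyMeasurable (fun v => exp (m * f w0 v)) (gJ J) := i1.aestronglyMeasurable
        exact hm1.smul (hf'.const_smul m))
      (Filter.Eventually.of_forall fun v w hw => by
        obtain ⟨hw1, hw2⟩ := hw
        have h1 := hw1 v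
        have h2 : ‖w - w0‖ ≤ 1 := by simpa [dist_eq_norm] using hw2
        have h3 := hab v
        have e1 : |m * f w v - m * f w0 v| ≤ |m| * (a + b * N1 v) := by
          rw [← mul_sub, abs_mul]
          have : |f w v - f w0 v| ≤ (a + b * N1 v) * 1 := h1.trans (by gcongr)
          rw [mul_one] at this
          gcongr
        have e2 : |m * f w v - m * f w0 v| ≤ |m| * ((a + b * N1 v) * ‖w - w0‖) := by
          rw [← mul_sub, abs_mul]; gcongr
        have e3 : m * f w0 v ≤ |m| * (a + b * N1 v) := by
          refine (le_abs_self _).trans ?_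
          rw [abs_mul]; have := hgrow v; gcongr
        have e4 : a + b * N1 v ≤ exp (a + b * N1 v) := by
          have := add_one_le_exp (a + b * N1 v); linarith
        rw [norm_eq_abs]
        refine (abs_exp_sub_le _ _ _ e1).trans ?_
        calc exp (m * f w0 v + |m| * (a + b * N1 v)) * |m * f w v - m * f w0 v|
            ≤ exp (2 * |m| * (a + b * N1 v)) * (|m| * (exp (a + b * N1 v) * ‖w - w0‖)) := by
              refine mul_le_mul (exp_le_exp.2 (by linarith)) (e2.trans ?_) (abs_nonneg _)
                (exp_pos _).le
              gcongr
          _ = _ := by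
              generalize a + b * N1 v = S
              rw [add_mul, exp_add, one_mul]; ring)
      ib (Filter.Eventually.of_forall fun v => ((hd v).const_mul m).exp)
    have hpos := integral_exp_pos i1
    refine ⟨_, (key.2.log hpos.ne').const_mul (1 / m), fun h => ?_⟩
    simp only [smul_apply, smul_eq_mul]
    rw [ContinuousLinearMap.integral_apply key.1]
    simp only [smul_apply, smul_eq_mul]
    have : ∀ v, exp (m * f w0 v) * (m * f' v h) = m * (exp (m * f w0 v) * f' v h) := by
      intro v; ring
    simp only [this, integral_const_mul]
    field_simp

lemma LSE_real (m : ℝ) (f : ℝ → (J → ℝ) → ℝ)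
    (f' : (J → ℝ) → ℝ) (w0 : ℝ) (a b : ℝ)
    (hmeas : ∀ w, Measurable (f w)) 
    (hgrow : ∀ v, |f w0 v| ≤ a + b * N1 v)
    (hlip : ∀ᶠ w in nhds w0, ∀ v, |f w v - f w0 v| ≤ (a + b * N1 v) * |w - w0|)
    (hd : ∀ v, HasDerivAt (fun w => f w v) (f' v) w0) :
    HasDerivAt (fun w => TT m (gJ J) (f w)) (Av m (gJ J) (f w0) f') w0 := by
  have hf' : AEStronglyMeasurable f' (gJ J) := by
    refine aestronglyMeasurable_of_tendsto_ae (nhdsWithin w0 {w0}ᶜ)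
      (f := fun w v => slope (fun w => f w v) w0 w) (fun w => ?_)
      (Filter.Eventually.of_forall fun v => (hd v).tendsto_slope)
    refine Measurable.aestronglyMeasurable ?_
    simp only [slope_def_field]
    have h1 := hmeas w; have h2 := hmeas w0
    fun_prop
  obtain ⟨L, hL, hL2⟩ := LSE m f (fun v => ContinuousLinearMap.toSpanSingleton ℝ (f' v)) w0 a b hmeas
    (by
      exact (ContinuousLinearMap.toSpanSingletonLE ℝ ℝ ℝ).continuous_of_finiteDimensional.comp_aestronglyMeasurable hf') hgrow hlip
    (fun v => (hd v).hasFDerivAt)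
  have := hL.hasDerivAt
  rw [hL2] at this
  simpa using this

end LSE

/-- Globally differentiable and Lipschitz functions. -/
structure Good {E : Type} [NormedAddCommGroup E] [NormedSpace ℝ E] (K : ℝ) (F : E → ℝ) : Prop where
  nonneg : 0 ≤ K
  diff : Differentiable ℝ F
  lip : ∀ z z', |F z - F z'| ≤ K * ‖z - z'‖

section Top
variable {J : Type} [Fintype J] {E : Type} [NormedAddCommGroup E] [NormedSpace ℝ E]

/-- Linear combination of directions. -/
def lin (e : J → E) (σ v : J → ℝ) : E := ∑ j, (σ j * v j) • e j

/-- Total size of the directions. -/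
def Lsz (e : J → E) : ℝ := ∑ j, ‖e j‖

lemma Lsz_nonneg (e : J → E) : 0 ≤ Lsz e := Finset.sum_nonneg fun _ _ => norm_nonneg _

lemma norm_lin_le (e : J → E) (σ v : J → ℝ) {M : ℝ} (h : ∀ j, |σ j| ≤ M) :
    ‖lin e σ v‖ ≤ M * Lsz e * N1 v := by
  unfold lin Lsz
  refine (norm_sum_le _ _).trans ?_
  rw [Finset.mul_sum, Finset.sum_mul]
  refine Finset.sum_le_sum fun j _ => ?_
  rw [norm_smul, norm_eq_abs, abs_mul]
  have h1 := h j
  have h2 := abs_le_N1 v j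
  have h3 : 0 ≤ M := (abs_nonneg _).trans h1
  calc |σ j| * |v j| * ‖e j‖ ≤ M * N1 v * ‖e j‖ := by gcongr
    _ = _ := by ring

lemma lin_sub (e : J → E) (σ σ' v : J → ℝ) : lin e σ v - lin e σ' v = lin e (fun j => σ j - σ' j) v := by
  unfold lin
  rw [← Finset.sum_sub_distrib]
  refine Finset.sum_congr rfl fun j _ => ?_
  rw [← sub_smul]; ring_nf

@[fun_prop]
lemma continuous_lin (e : J → E) (σ : J → ℝ) : Continuous (lin e σ) := by
  unfold lin; fun_prop

/-- Bound on the coefficients. -/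
def Mb (σ : J → ℝ) : ℝ := ∑ j, |σ j|

lemma Mb_nonneg (σ : J → ℝ) : 0 ≤ Mb σ := Finset.sum_nonneg fun _ _ => abs_nonneg _

lemma le_Mb (σ : J → ℝ) (j : J) : |σ j| ≤ Mb σ :=
  Finset.single_le_sum (f := fun j => |σ j|) (fun _ _ => abs_nonneg _) (Finset.mem_univ j)

/-- The Parisi-type operator. -/
def Top (e : J → E) (m : ℝ) (σ : J → ℝ) (F : E → ℝ) (z : E) : ℝ :=
  TT m (gJ J) fun v => F (z + lin e σ v)

/-- The associated tilted average operator. -/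
def Aop (e : J → E) (m : ℝ) (σ : J → ℝ) (F h : E → ℝ) (z : E) : ℝ :=
  Av m (gJ J) (fun v => F (z + lin e σ v)) (fun v => h (z + lin e σ v))

lemma Good.continuous {K : ℝ} {F : E → ℝ} (h : Good K F) : Continuous F := h.diff.continuous

lemma Good.fderiv_le {K : ℝ} {F : E → ℝ} (h : Good K F) (z : E) : ‖fderiv ℝ F z‖ ≤ K :=
  norm_fderiv_le_of_lip' ℝ h.nonneg (Filter.Eventually.of_forall fun w => by
    simpa using h.lip w z)

lemma Good.fderiv_apply_le {K : ℝ} {F : E → ℝ} (h : Good K F) (z w : E) :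
    |fderiv ℝ F z w| ≤ K * ‖w‖ :=
  (ContinuousLinearMap.le_opNorm _ _).trans (mul_le_mul_of_nonneg_right (h.fderiv_le z) (norm_nonneg w))

lemma Good.sub_le {K : ℝ} {F : E → ℝ} (h : Good K F) (e : J → E) (σ : J → ℝ) {M : ℝ}
    (hM : ∀ j, |σ j| ≤ M) (z : E) (v : J → ℝ) :
    |F (z + lin e σ v) - F z| ≤ K * (M * Lsz e) * N1 v := by
  refine (h.lip _ _).trans ?_
  rw [add_sub_cancel_left, mul_assoc]
  have := norm_lin_le e σ v hM
  have := h.nonneg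
  gcongr

lemma Good.abs_le {K : ℝ} {F : E → ℝ} (h : Good K F) (e : J → E) (σ : J → ℝ) {M : ℝ}
    (hM : ∀ j, |σ j| ≤ M) (z : E) (v : J → ℝ) :
    |F (z + lin e σ v)| ≤ |F z| + K * (M * Lsz e) * N1 v := by
  have h1 := h.sub_le e σ hM z v
  have h2 := abs_sub_abs_le_abs_sub (F (z + lin e σ v)) (F z)
  linarith

lemma Good.cont_lin {K : ℝ} {F : E → ℝ} (h : Good K F) (e : J → E) (σ : J → ℝ) (z : E) :
    Continuous fun v => F (z + lin e σ v) := by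
  have := h.continuous; fun_prop

lemma Good.int_exp {K : ℝ} {F : E → ℝ} (h : Good K F) (e : J → E) (m : ℝ) (σ : J → ℝ) (z : E) :
    Integrable (fun v => exp (m * F (z + lin e σ v))) (gJ J) :=
  int_exp_of_lin (h.cont_lin e σ z).measurable (h.abs_le e σ (le_Mb σ) z)

lemma Good.int_exp_pos {K : ℝ} {F : E → ℝ} (h : Good K F) (e : J → E) (m : ℝ) (σ : J → ℝ) (z : E) :
    0 < ∫ v, exp (m * F (z + lin e σ v)) ∂(gJ J) :=
  integral_exp_pos (h.int_exp e m σ z)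

lemma exp_Top {K : ℝ} {F : E → ℝ} (h : Good K F) (e : J → E) (m : ℝ) (σ : J → ℝ) (z : E) :
    exp (m * Top e m σ F z) = ∫ v, exp (m * F (z + lin e σ v)) ∂(gJ J) :=
  exp_TT _ _ _ (h.int_exp e m σ z)

lemma Top_lip {K : ℝ} {F : E → ℝ} (h : Good K F) (e : J → E) (m : ℝ) (σ : J → ℝ) (z z' : E) :
    |Top e m σ F z - Top e m σ F z'| ≤ K * ‖z - z'‖ := by
  have h1 := h.abs_le e σ (le_Mb σ)
  refine TT_le_of_shift (a := |F z| + |F z'|) (b := K * (Mb σ * Lsz e))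
    (h.cont_lin e σ z).measurable (h.cont_lin e σ z').measurable
    (fun v => (h1 z v).trans (by linarith [abs_nonneg (F z')]))
    (fun v => (h1 z' v).trans (by linarith [abs_nonneg (F z)])) fun v => ?_
  refine (h.lip _ _).trans_eq ?_
  congr 2; abel

variable [FiniteDimensional ℝ E] [MeasurableSpace E] [BorelSpace E]

lemma Top_fderiv {K : ℝ} {F : E → ℝ} (h : Good K F) (e : J → E) (m : ℝ) (σ : J → ℝ) (z : E) :
    ∃ L : E →L[ℝ] ℝ, HasFDerivAt (Top e m σ F) L z ∧
      ∀ w, L w = Aop e m σ F (fun z => fderiv ℝ F z w) z := by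
  refine LSE m (fun z v => F (z + lin e σ v)) (fun v => fderiv ℝ F (z + lin e σ v)) z (|F z| + K)
    (K * (Mb σ * Lsz e)) (fun w => (h.cont_lin e σ w).measurable) ?_ ?_ ?_ ?_
  · refine Measurable.aestronglyMeasurable ?_
    exact (measurable_fderiv ℝ F).comp (by fun_prop : Continuous fun v => z + lin e σ v).measurable
  · intro v; exact (h.abs_le e σ (le_Mb σ) z v).trans (by linarith [h.nonneg])
  · refine Filter.Eventually.of_forall fun w v => (h.lip _ _).trans ?_
    rw [add_sub_add_right_eq_sub]
    have := h.nonneg; have := Mb_nonneg σ; have := Lsz_nonneg e; have := N1_nonneg v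
    gcongr
    have : 0 ≤ K * (Mb σ * Lsz e) * N1 v := by positivity
    linarith [abs_nonneg (F z)]
  · intro v
    have h1 : HasFDerivAt (fun w => w + lin e σ v) (ContinuousLinearMap.id ℝ E) z :=
      (hasFDerivAt_id z).add_const _
    have := (h.diff (z + lin e σ v)).hasFDerivAt.comp z h1
    rw [ContinuousLinearMap.comp_id] at this
    exact this

lemma Good.top {K : ℝ} {F : E → ℝ} (h : Good K F) (e : J → E) (m : ℝ) (σ : J → ℝ) :
    Good K (Top e m σ F) :=
  ⟨h.nonneg, fun z => (Top_fderiv h e m σ z).choose_spec.1.differentiableAt, Top_lip h e m σ⟩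

lemma fderiv_Top {K : ℝ} {F : E → ℝ} (h : Good K F) (e : J → E) (m : ℝ) (σ : J → ℝ) (z w : E) :
    fderiv ℝ (Top e m σ F) z w = Aop e m σ F (fun z => fderiv ℝ F z w) z := by
  obtain ⟨L, hL, hL2⟩ := Top_fderiv h e m σ z
  rw [hL.fderiv, hL2]

lemma meas_fderiv (F : E → ℝ) (w : E) : Measurable fun z => fderiv ℝ F z w :=
  measurable_fderiv_apply_const ℝ F w

end Top

section Aop
variable {J : Type} [Fintype J] {E : Type} [NormedAddCommGroup E] [NormedSpace ℝ E]

lemma Good.int_weight {K : ℝ} {F : E → ℝ} (hF : Good K F) (e : J → E) (m : ℝ) (σ : J → ℝ) (z : E)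
    {h : (J → ℝ) → ℝ} (hm : Measurable h) {a b : ℝ} (hb : ∀ v, |h v| ≤ a + b * N1 v) :
    Integrable (fun v => exp (m * F (z + lin e σ v)) * h v) (gJ J) := by
  have h1 := hF.cont_lin e σ z
  have hab : ∀ v, 0 ≤ a + b * N1 v := fun v => (abs_nonneg _).trans (hb v)
  refine integrable_of_growth (by
      have h2 : Measurable (fun v => F (z + lin e σ v)) := h1.measurable
      exact ((h2.const_mul m).exp.mul hm).aestronglyMeasurable) (exp (|m| * |F z| + a))
    (|m| * (K * (Mb σ * Lsz e)) + b) fun v => ?_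
  rw [norm_eq_abs, abs_mul, abs_exp, ← exp_add]
  have h2 : |h v| ≤ exp (a + b * N1 v) := (hb v).trans (by
    have := add_one_le_exp (a + b * N1 v); linarith)
  have h3 : m * F (z + lin e σ v) ≤ |m| * (|F z| + K * (Mb σ * Lsz e) * N1 v) := by
    refine (le_abs_self _).trans ?_
    rw [abs_mul]; have := hF.abs_le e σ (le_Mb σ) z v; gcongr
  calc _ ≤ exp (|m| * (|F z| + K * (Mb σ * Lsz e) * N1 v)) * exp (a + b * N1 v) := by gcongr
    _ = _ := by rw [← exp_add]; congr 1; ring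

lemma Av_sum {K : ℝ} {F : E → ℝ} (hF : Good K F) (e : J → E) (m : ℝ) (σ : J → ℝ) (z : E)
    {ι : Type} (s : Finset ι) {h : ι → (J → ℝ) → ℝ} (hm : ∀ i ∈ s, Measurable (h i)) {a b : ι → ℝ}
    (hb : ∀ i ∈ s, ∀ v, |h i v| ≤ a i + b i * N1 v) :
    Av m (gJ J) (fun v => F (z + lin e σ v)) (fun v => ∑ i ∈ s, h i v)
      = ∑ i ∈ s, Av m (gJ J) (fun v => F (z + lin e σ v)) (h i) := by
  unfold Av
  rw [← Finset.mul_sum, ← integral_finsetSum s fun i hi =>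
    hF.int_weight e m σ z (hm i hi) (hb i hi)]
  simp only [Finset.mul_sum]

lemma Av_const_mul (m c : ℝ) (g h : (J → ℝ) → ℝ) :
    Av m (gJ J) g (fun v => c * h v) = c * Av m (gJ J) g h := by
  unfold Av
  have : ∀ v, exp (m * g v) * (c * h v) = c * (exp (m * g v) * h v) := fun v => by ring
  simp only [this, integral_const_mul]
  ring

lemma Aop_const_mul (e : J → E) (m : ℝ) (σ : J → ℝ) (F h : E → ℝ) (c : ℝ) :
    Aop e m σ F (fun z => c * h z) = fun z => c * Aop e m σ F h z :=
  funext fun z => Av_const_mul m c _ _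

lemma abs_Aop_le {K : ℝ} {F : E → ℝ} (hF : Good K F) (e : J → E) (m : ℝ) (σ : J → ℝ) (z : E)
    {h : E → ℝ} {B : ℝ} (hb : ∀ z, |h z| ≤ B) : |Aop e m σ F h z| ≤ B := by
  unfold Aop Av
  have hp := hF.int_exp_pos e m σ z
  rw [abs_mul, abs_inv, abs_of_pos hp, inv_mul_le_iff₀ hp, ← integral_mul_const]
  refine abs_integral_le_integral_abs.trans ?_
  refine integral_mono_of_nonneg (Filter.Eventually.of_forall fun v => abs_nonneg _)
    ((hF.int_exp e m σ z).mul_const B) (Filter.Eventually.of_forall fun v => ?_)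
  dsimp only
  rw [abs_mul, abs_exp]
  have := hb (z + lin e σ v)
  gcongr

variable [FiniteDimensional ℝ E] [MeasurableSpace E] [BorelSpace E] [SecondCountableTopology E]

lemma Aop_sum {K : ℝ} {F : E → ℝ} (hF : Good K F) (e : J → E) (m : ℝ) (σ : J → ℝ)
    {ι : Type} (s : Finset ι) {h : ι → E → ℝ} (hm : ∀ i, Measurable (h i))
    (hb : ∀ i, ∃ B, ∀ z, |h i z| ≤ B) :
    Aop e m σ F (fun z => ∑ i ∈ s, h i z) = fun z => ∑ i ∈ s, Aop e m σ F (h i) z := by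
  choose B hB using hb
  funext z
  refine Av_sum hF e m σ z s (a := B) (b := fun _ => 0) (fun i _ => (hm i).comp
    (by fun_prop : Continuous fun v => z + lin e σ v).measurable) (fun i _ v => by
      simpa using hB i _)

lemma measurable_Aop {K : ℝ} {F : E → ℝ} (hF : Good K F) (e : J → E) (m : ℝ) (σ : J → ℝ)
    {h : E → ℝ} (hm : Measurable h) : Measurable (Aop e m σ F h) := by
  unfold Aop Av
  have hc : Continuous fun w : E × (J → ℝ) => w.1 + lin e σ w.2 := by
    have := continuous_lin e σ
    fun_prop
  have hFc := hF.continuous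
  have h1 : Measurable fun z => ∫ v, exp (m * F (z + lin e σ v)) ∂(gJ J) := by
    refine (StronglyMeasurable.integral_prod_right' (f := fun w : E × (J → ℝ) =>
      exp (m * F (w.1 + lin e σ w.2))) ?_).measurable
    exact Continuous.stronglyMeasurable (by fun_prop)
  have h2 : Measurable fun z => ∫ v, exp (m * F (z + lin e σ v)) * h (z + lin e σ v) ∂(gJ J) := by
    refine (StronglyMeasurable.integral_prod_right' (f := fun w : E × (J → ℝ) =>
      exp (m * F (w.1 + lin e σ w.2)) * h (w.1 + lin e σ w.2)) ?_).measurable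
    refine Measurable.stronglyMeasurable ?_
    exact Measurable.mul (Continuous.measurable (by fun_prop)) (hm.comp hc.measurable)
  exact h1.inv.mul h2

end Aop

section param
variable {J : Type} [Fintype J] {E : Type} [NormedAddCommGroup E] [NormedSpace ℝ E]

lemma Top_mono_lip {K : ℝ} {F F' : E → ℝ} (hF : Good K F) (hF' : Good K F') (e : J → E) (m : ℝ)
    (σ : J → ℝ) {c : ℝ} (h : ∀ z, |F z - F' z| ≤ c) (z : E) :
    |Top e m σ F z - Top e m σ F' z| ≤ c := by
  have h1 := hF.abs_le e σ (le_Mb σ) z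
  have h2 := hF'.abs_le e σ (le_Mb σ) z
  exact TT_le_of_shift (a := |F z| + |F' z|) (b := K * (Mb σ * Lsz e))
    (hF.cont_lin e σ z).measurable (hF'.cont_lin e σ z).measurable
    (fun v => (h1 v).trans (by linarith [abs_nonneg (F' z)]))
    (fun v => (h2 v).trans (by linarith [abs_nonneg (F z)])) fun v => h _

lemma T_sigma (e : J → E) (m K M : ℝ) (hK : 0 ≤ K) (hM : 0 ≤ M) : ∃ C, 0 ≤ C ∧ ∀ F : E → ℝ,
    Good K F → ∀ (σ σ' : J → ℝ) (δ : ℝ), 0 ≤ δ → (∀ j, |σ j| ≤ M) → (∀ j, |σ' j| ≤ M) →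
    (∀ j, |σ j - σ' j| ≤ δ) → ∀ z, |Top e m σ F z - Top e m σ' F z| ≤ C * δ := by
  have hL := Lsz_nonneg e
  obtain ⟨C, hC, h⟩ := TT_diff (J := J) m (K * (M * Lsz e)) (by positivity)
  refine ⟨C * (K * Lsz e), by positivity, fun F hF σ σ' δ hδ h1 h2 h3 z => ?_⟩
  have := h (K * (δ * Lsz e)) (F z) (fun v => F (z + lin e σ v)) (fun v => F (z + lin e σ' v))
    (by positivity) (hF.cont_lin e σ z).measurable (hF.cont_lin e σ' z).measurable
    (hF.sub_le e σ h1 z) (hF.sub_le e σ' h2 z) (fun v => by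
      refine (hF.lip _ _).trans ?_
      rw [add_sub_add_left_eq_sub, lin_sub, mul_assoc]
      have := norm_lin_le e (fun j => σ j - σ' j) v h3
      gcongr)
  refine this.trans_eq (by ring)

lemma loclip {s : ℝ → J → ℝ} {d : J → ℝ} {ρ0 : ℝ} (hd : ∀ j, HasDerivAt (fun ρ => s ρ j) (d j) ρ0) :
    ∃ D M, 0 ≤ D ∧ 0 ≤ M ∧ ∀ᶠ ρ in nhds ρ0,
      (∀ j, |s ρ j - s ρ0 j| ≤ D * |ρ - ρ0|) ∧ ∀ j, |s ρ j| ≤ M := by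
  have h : HasDerivAt s d ρ0 := hasDerivAt_pi.2 hd
  obtain ⟨D, hD, hb⟩ := h.isBigO_sub.exists_pos
  refine ⟨D, ‖s ρ0‖ + 1, hD.le, by positivity, ?_⟩
  have h2 : ∀ᶠ ρ in nhds ρ0, ‖s ρ‖ < ‖s ρ0‖ + 1 :=
    h.continuousAt.norm.eventually_lt continuousAt_const (by simp)
  filter_upwards [hb.bound, h2] with ρ h1 h2
  exact ⟨fun j => (norm_le_pi_norm (s ρ - s ρ0) j).trans h1,
    fun j => (norm_le_pi_norm (s ρ) j).trans h2.le⟩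

lemma Top_rho_lip (e : J → E) (m K : ℝ) (hK : 0 ≤ K) {s : ℝ → J → ℝ} {d : J → ℝ} {ρ0 : ℝ}
    (hd : ∀ j, HasDerivAt (fun ρ => s ρ j) (d j) ρ0) :
    ∃ C, 0 ≤ C ∧ ∀ᶠ ρ in nhds ρ0, ∀ F : E → ℝ, Good K F → ∀ z,
      |Top e m (s ρ) F z - Top e m (s ρ0) F z| ≤ C * |ρ - ρ0| := by
  obtain ⟨D, M, hD, hM, hl⟩ := loclip hd
  obtain ⟨C, hC, hT⟩ := T_sigma e m K M hK hM
  have h0 := hl.self_of_nhds.2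
  refine ⟨C * D, by positivity, ?_⟩
  filter_upwards [hl] with ρ h F hF z
  refine (hT F hF (s ρ) (s ρ0) (D * |ρ - ρ0|) (by positivity) h.2 h0 h.1 z).trans_eq (by ring)

lemma hasDerivAt_lin (e : J → E) {s : ℝ → J → ℝ} {d : J → ℝ} {ρ0 : ℝ}
    (hd : ∀ j, HasDerivAt (fun ρ => s ρ j) (d j) ρ0) (v : J → ℝ) :
    HasDerivAt (fun ρ => lin e (s ρ) v) (lin e d v) ρ0 := by
  unfold lin
  exact HasDerivAt.fun_sum fun j _ => ((hd j).mul_const (v j)).smul_const (e j)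

/-- Propagation of parameter derivatives through a level not depending on the parameter. -/
lemma Top_param {K : ℝ} {H : ℝ → E → ℝ} (hG : ∀ ρ, Good K (H ρ)) {h : E → ℝ} {ρ0 C : ℝ}
    (hd : ∀ z, HasDerivAt (fun ρ => H ρ z) (h z) ρ0) (hC : 0 ≤ C)
    (hl : ∀ᶠ ρ in nhds ρ0, ∀ z, |H ρ z - H ρ0 z| ≤ C * |ρ - ρ0|) (e : J → E) (m : ℝ)
    (σ : J → ℝ) (z : E) :
    HasDerivAt (fun ρ => Top e m σ (H ρ) z) (Aop e m σ (H ρ0) h z) ρ0 := by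
  have hK := (hG ρ0).nonneg
  refine LSE_real m (fun ρ v => H ρ (z + lin e σ v)) (fun v => h (z + lin e σ v)) ρ0
    (|H ρ0 z| + C) (K * (Mb σ * Lsz e)) (fun ρ => ((hG ρ).cont_lin e σ z).measurable) ?_ ?_ ?_
  · intro v
    have := (hG ρ0).abs_le e σ (le_Mb σ) z v
    linarith
  · filter_upwards [hl] with ρ h v
    refine (h _).trans ?_
    have := Mb_nonneg σ; have := Lsz_nonneg e; have := N1_nonneg v
    gcongr
    have : 0 ≤ K * (Mb σ * Lsz e) * N1 v := by positivity
    linarith [abs_nonneg (H ρ0 z)]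
  · intro v; exact hd _

/-- Inner derivative when both scales vary. -/
lemma inner_deriv {K : ℝ} {F : E → ℝ} (hF : Good K F) (e : J → E) (m : ℝ) {s1 s2 : ℝ → J → ℝ}
    {d1 d2 : J → ℝ} {ρ0 : ℝ} (hd1 : ∀ j, HasDerivAt (fun ρ => s1 ρ j) (d1 j) ρ0)
    (hd2 : ∀ j, HasDerivAt (fun ρ => s2 ρ j) (d2 j) ρ0) (z : E) (u2 : J → ℝ) :
    HasDerivAt (fun ρ => Top e m (s1 ρ) F (z + lin e (s2 ρ) u2))
      (Av m (gJ J) (fun u1 => F (z + lin e (s2 ρ0) u2 + lin e (s1 ρ0) u1))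
        (fun u1 => fderiv ℝ F (z + lin e (s2 ρ0) u2 + lin e (s1 ρ0) u1)
          (lin e d2 u2 + lin e d1 u1))) ρ0 := by
  obtain ⟨D1, M1, hD1, hM1, hl1⟩ := loclip hd1
  obtain ⟨D2, M2, hD2, hM2, hl2⟩ := loclip hd2
  have hK := hF.nonneg
  have hL := Lsz_nonneg e
  have hN2 := N1_nonneg u2
  refine LSE_real m (fun ρ u1 => F (z + lin e (s2 ρ) u2 + lin e (s1 ρ) u1)) _ ρ0
    (|F (z + lin e (s2 ρ0) u2)| + K * (D2 * Lsz e * N1 u2)) (K * (M1 * Lsz e) + K * (D1 * Lsz e))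
    (fun ρ => (hF.cont_lin e _ _).measurable) ?_ ?_ ?_
  · intro u1
    have h1 := hF.abs_le e (s1 ρ0) hl1.self_of_nhds.2 (z + lin e (s2 ρ0) u2) u1
    have := N1_nonneg u1
    have : 0 ≤ K * (D2 * Lsz e * N1 u2) := by positivity
    have : 0 ≤ K * (D1 * Lsz e) * N1 u1 := by positivity
    linarith
  · filter_upwards [hl1, hl2] with ρ h1 h2 u1
    refine (hF.lip _ _).trans ?_
    have e1 : z + lin e (s2 ρ) u2 + lin e (s1 ρ) u1 - (z + lin e (s2 ρ0) u2 + lin e (s1 ρ0) u1)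
        = lin e (fun j => s2 ρ j - s2 ρ0 j) u2 + lin e (fun j => s1 ρ j - s1 ρ0 j) u1 := by
      rw [← lin_sub, ← lin_sub]; abel
    rw [e1]
    have a1 := norm_lin_le e (fun j => s1 ρ j - s1 ρ0 j) u1 h1.1
    have a2 := norm_lin_le e (fun j => s2 ρ j - s2 ρ0 j) u2 h2.1
    have a3 := norm_add_le (lin e (fun j => s2 ρ j - s2 ρ0 j) u2)
      (lin e (fun j => s1 ρ j - s1 ρ0 j) u1)
    have := N1_nonneg u1
    calc _ ≤ K * (D2 * |ρ - ρ0| * Lsz e * N1 u2 + D1 * |ρ - ρ0| * Lsz e * N1 u1) := by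
          gcongr; linarith
      _ = (K * (D2 * Lsz e * N1 u2) + K * (D1 * Lsz e) * N1 u1) * |ρ - ρ0| := by ring
      _ ≤ _ := by
          refine mul_le_mul_of_nonneg_right ?_ (abs_nonneg _)
          have : 0 ≤ K * (M1 * Lsz e) * N1 u1 := by positivity
          linarith [abs_nonneg (F (z + lin e (s2 ρ0) u2))]
  · intro u1
    have h1 : HasDerivAt (fun ρ => z + lin e (s2 ρ) u2 + lin e (s1 ρ) u1)
        (lin e d2 u2 + lin e d1 u1) ρ0 :=
      ((hasDerivAt_lin e hd2 u2).const_add z).add (hasDerivAt_lin e hd1 u1)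
    exact (hF.diff _).hasFDerivAt.comp_hasDerivAt ρ0 h1

end param

section core
lemma Av_def {V : Type} [MeasurableSpace V] (m : ℝ) (μ : Measure V) (g h : V → ℝ) :
    Av m μ g h = (∫ v, exp (m * g v) ∂μ)⁻¹ * ∫ v, exp (m * g v) * h v ∂μ := rfl

variable {J : Type} [Fintype J] {E : Type} [NormedAddCommGroup E] [NormedSpace ℝ E]

lemma lin_update [DecidableEq J] (e : J → E) (σ v : J → ℝ) (j : J) (a : ℝ) :
    lin e σ (Function.update v j a) = lin e σ v + (σ j * (a - v j)) • e j := by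
  unfold lin
  rw [← Finset.add_sum_erase _ _ (Finset.mem_univ j), ← Finset.add_sum_erase Finset.univ
    (fun j => (σ j * v j) • e j) (Finset.mem_univ j)]
  rw [Finset.sum_congr rfl (g := fun i => (σ i * v i) • e i) fun i hi => by
    rw [Function.update_of_ne (Finset.ne_of_mem_erase hi)]]
  rw [Function.update_self, mul_sub, sub_smul]; abel

lemma lin_one (e : J → E) (σ1 σ2 u1 u2 : J → ℝ) :
    lin e (fun _ => 1) (fun i => σ1 i * u1 i + σ2 i * u2 i) = lin e σ2 u2 + lin e σ1 u1 := by
  unfold lin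
  rw [← Finset.sum_add_distrib]
  refine Finset.sum_congr rfl fun j _ => ?_
  rw [← add_smul]; congr 1; ring

variable [FiniteDimensional ℝ E] [MeasurableSpace E] [BorelSpace E] [SecondCountableTopology E]

lemma core_id [DecidableEq J] {K : ℝ} {F : E → ℝ} (hF : Good K F) (e : J → E) (m m' : ℝ)
    (σ1 σ2 : J → ℝ) (j : J) (h1 : 0 < σ1 j) (h2 : 0 < σ2 j) (z : E) :
    Integrable (fun u2 => exp (m' * Top e m σ1 F (z + lin e σ2 u2)) *
      Av m (gJ J) (fun u1 => F (z + lin e σ2 u2 + lin e σ1 u1))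
        (fun u1 => (-(u1 j / σ1 j) + u2 j / σ2 j) *
          fderiv ℝ F (z + lin e σ2 u2 + lin e σ1 u1) (e j))) (gJ J) ∧
    ∫ u2, exp (m' * Top e m σ1 F (z + lin e σ2 u2)) *
      Av m (gJ J) (fun u1 => F (z + lin e σ2 u2 + lin e σ1 u1))
        (fun u1 => (-(u1 j / σ1 j) + u2 j / σ2 j) *
          fderiv ℝ F (z + lin e σ2 u2 + lin e σ1 u1) (e j)) ∂(gJ J)
      = (m' - m) * ∫ u2, exp (m' * Top e m σ1 F (z + lin e σ2 u2)) *
        (fderiv ℝ (Top e m σ1 F) (z + lin e σ2 u2) (e j)) ^ 2 ∂(gJ J) := by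
  set F1 := Top e m σ1 F with hF1d
  have hF1 : Good K F1 := hF.top e m σ1
  have hK := hF.nonneg
  have hL := Lsz_nonneg e
  set A : (J → ℝ) → ℝ := fun u2 => exp ((m' - m) * F1 (z + lin e σ2 u2)) with hA
  set A' : (J → ℝ) → ℝ := fun u2 => (m' - m) * (σ2 j * fderiv ℝ F1 (z + lin e σ2 u2) (e j)) * A u2
    with hA'
  set B : (J → ℝ) → ℝ := fun S => exp (m * F (z + lin e (fun _ => 1) S)) *
    fderiv ℝ F (z + lin e (fun _ => 1) S) (e j) with hB
  have hcl : ∀ σ : J → ℝ, Measurable fun v => z + lin e σ v := fun σ =>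
    (by fun_prop : Continuous fun v => z + lin e σ v).measurable
  have hAm : Measurable A := ((hF1.cont_lin e σ2 z).measurable.const_mul _).exp
  have hA'm : Measurable A' :=
    ((((meas_fderiv F1 (e j)).comp (hcl σ2)).const_mul _).const_mul _).mul hAm
  have hBm : Measurable B := ((hF.cont_lin e _ z).measurable.const_mul _).exp.mul
    ((meas_fderiv F (e j)).comp (hcl _))
  have hder : ∀ v, HasDerivAt (fun a => A (Function.update v j a)) (A' v) (v j) := by
    intro v
    have p1 : HasDerivAt (fun a => z + lin e σ2 (Function.update v j a)) (σ2 j • e j) (v j) := by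
      have : HasDerivAt (fun a : ℝ => σ2 j * (a - v j)) (σ2 j) (v j) := by
        simpa using ((hasDerivAt_id (v j)).sub_const (v j)).const_mul (σ2 j)
      have := ((this.smul_const (e j)).const_add (lin e σ2 v)).const_add z
      refine this.congr_of_eventuallyEq (Filter.Eventually.of_forall fun a => ?_)
      simp only [lin_update]
    have p2 : HasFDerivAt F1 (fderiv ℝ F1 (z + lin e σ2 v))
        (z + lin e σ2 (Function.update v j (v j))) := by
      rw [Function.update_eq_self]; exact (hF1.diff _).hasFDerivAt
    have p3 := ((p2.comp_hasDerivAt (v j) p1).const_mul (m' - m)).exp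
    refine p3.congr_deriv ?_
    simp only [hA', hA, Function.comp_apply, Function.update_eq_self, map_smul, smul_eq_mul]
    ring
  set c1 := |m' - m| * (K * (Mb σ2 * Lsz e)) with hc1
  set c2 := |m| * (K * (1 * Lsz e)) with hc2
  set P1 := exp (|m' - m| * |F1 z|) with hP1
  set P2 := exp (|m| * |F z|) with hP2
  have hMb := Mb_nonneg σ2
  have c1n : 0 ≤ c1 := by positivity
  have c2n : 0 ≤ c2 := by positivity
  have bA0 : ∀ y, |A y| ≤ P1 * exp ((c1 + c2) * N1 y) := by
    intro y
    have hN := N1_nonneg y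
    rw [hA]; dsimp only
    rw [abs_exp, hP1, ← exp_add, exp_le_exp]
    refine (le_abs_self _).trans ?_
    rw [abs_mul]
    have := hF1.abs_le e σ2 (le_Mb σ2) z y
    calc _ ≤ |m' - m| * (|F1 z| + K * (Mb σ2 * Lsz e) * N1 y) := by gcongr
      _ = |m' - m| * |F1 z| + c1 * N1 y := by rw [hc1]; ring
      _ ≤ _ := by
        have : 0 ≤ c2 * N1 y := by positivity
        linarith
  set R1 := |m' - m| * (σ2 j * (K * ‖e j‖)) with hR1
  have hR1n : 0 ≤ R1 := by positivity
  have bA'0 : ∀ y, |A' y| ≤ R1 * P1 * exp ((c1 + c2) * N1 y) := by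
    intro y
    rw [hA']; dsimp only
    rw [abs_mul, abs_mul, abs_mul, abs_of_pos h2, mul_assoc R1]
    have q1 := hF1.fderiv_apply_le (z + lin e σ2 y) (e j)
    have q2 := bA0 y
    rw [hR1]
    gcongr
  have bB0 : ∀ y, |B y| ≤ (K * ‖e j‖) * P2 * exp ((c1 + c2) * N1 y) := by
    intro y
    have hN := N1_nonneg y
    rw [hB]; dsimp only
    rw [abs_mul, mul_comm]
    have q1 := hF.fderiv_apply_le (z + lin e (fun _ => 1) y) (e j)
    rw [mul_assoc]
    refine mul_le_mul q1 ?_ (abs_nonneg _) (by positivity)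
    rw [abs_exp, hP2, ← exp_add, exp_le_exp]
    refine (le_abs_self _).trans ?_
    rw [abs_mul]
    have := hF.abs_le e (fun _ => 1) (M := 1) (by simp) z y
    calc _ ≤ |m| * (|F z| + K * (1 * Lsz e) * N1 y) := by gcongr
      _ = |m| * |F z| + c2 * N1 y := by rw [hc2]; ring
      _ ≤ _ := by
        have : 0 ≤ c1 * N1 y := by positivity
        linarith
  have hP1p : 0 < P1 := exp_pos _
  have hP2p : 0 < P2 := exp_pos _
  obtain ⟨I1, I2, hst⟩ := steinJ j (A := A) (A' := A') (B := B) hder hAm hA'm hBm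
    (P1 + R1 * P1 + (K * ‖e j‖) * P2) (c1 + c2) (by positivity) (by positivity)
    (fun y => (bA0 y).trans (by
      gcongr
      have : 0 ≤ R1 * P1 := by positivity
      have : 0 ≤ (K * ‖e j‖) * P2 := by positivity
      linarith))
    (fun y => (bA'0 y).trans (by
      gcongr
      have : 0 ≤ (K * ‖e j‖) * P2 := by positivity
      linarith))
    (fun y => (bB0 y).trans (by
      gcongr
      have : 0 ≤ R1 * P1 := by positivity
      linarith)) (σ1 := σ1) (σ2 := σ2) h1 h2
  have hz : ∀ u1 u2 : J → ℝ, z + lin e (fun _ => 1) (fun i => σ1 i * u1 i + σ2 i * u2 i)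
      = z + lin e σ2 u2 + lin e σ1 u1 := by
    intro u1 u2; rw [lin_one, add_assoc]
  have hinv : ∀ u2, (∫ u1, exp (m * F (z + lin e σ2 u2 + lin e σ1 u1)) ∂(gJ J))⁻¹
      = exp (-(m * F1 (z + lin e σ2 u2))) := by
    intro u2
    rw [← exp_Top hF, exp_neg]
  have hpt : (fun u2 => exp (m' * F1 (z + lin e σ2 u2)) *
      Av m (gJ J) (fun u1 => F (z + lin e σ2 u2 + lin e σ1 u1))
        (fun u1 => (-(u1 j / σ1 j) + u2 j / σ2 j) *
          fderiv ℝ F (z + lin e σ2 u2 + lin e σ1 u1) (e j)))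
      = fun u2 => ∫ u1, (-(u1 j / σ1 j) + u2 j / σ2 j) *
          (A u2 * B (fun i => σ1 i * u1 i + σ2 i * u2 i)) ∂(gJ J) := by
    funext u2
    unfold Av
    rw [hinv, ← mul_assoc, ← exp_add, ← integral_const_mul]
    congr 1; funext u1
    rw [hA, hB]; dsimp only
    rw [hz, show m' * F1 (z + lin e σ2 u2) + -(m * F1 (z + lin e σ2 u2))
      = (m' - m) * F1 (z + lin e σ2 u2) by ring]
    ring
  rw [hpt]
  refine ⟨I1.integral_prod_right, ?_⟩
  rw [← integral_prod_symm _ I1, hst, integral_prod_symm _ I2, ← integral_const_mul]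
  congr 1; funext u2
  rw [hF1d, fderiv_Top hF, ← hF1d]
  unfold Aop Av
  rw [hinv]
  dsimp only
  have e1 : ∀ u1, (σ2 j)⁻¹ * (A' u2 * B (fun i => σ1 i * u1 i + σ2 i * u2 i))
      = ((σ2 j)⁻¹ * A' u2) * (exp (m * F (z + lin e σ2 u2 + lin e σ1 u1)) *
        fderiv ℝ F (z + lin e σ2 u2 + lin e σ1 u1) (e j)) := by
    intro u1
    rw [hB]; dsimp only; rw [hz]; ring
  simp only [e1]
  rw [integral_const_mul]
  set X := ∫ u1, exp (m * F (z + lin e σ2 u2 + lin e σ1 u1)) *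
        fderiv ℝ F (z + lin e σ2 u2 + lin e σ1 u1) (e j) ∂(gJ J) with hX
  have e2 : (σ2 j)⁻¹ * A' u2 = (m' - m) * (exp (-(m * F1 (z + lin e σ2 u2))) * X) * A u2 := by
    rw [hA']; dsimp only
    rw [hF1d, fderiv_Top hF, ← hF1d]
    unfold Aop Av
    rw [hinv, hX]
    field_simp
  rw [e2]
  have e3 : A u2 = exp (m' * F1 (z + lin e σ2 u2)) * exp (-(m * F1 (z + lin e σ2 u2))) := by
    rw [hA, ← exp_add]; dsimp only; congr 1; ring
  rw [e3]; ring

/-- The main derivative formula when two consecutive levels vary. -/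
lemma core_deriv {K : ℝ} {F : E → ℝ} (hF : Good K F) (e : J → E) (m m' : ℝ)
    {s1 s2 : ℝ → J → ℝ} {w : J → ℝ} {ρ0 : ℝ} (h1 : ∀ j, 0 < s1 ρ0 j) (h2 : ∀ j, 0 < s2 ρ0 j)
    (hd1 : ∀ j, HasDerivAt (fun ρ => s1 ρ j) (-(w j / (2 * s1 ρ0 j))) ρ0)
    (hd2 : ∀ j, HasDerivAt (fun ρ => s2 ρ j) (w j / (2 * s2 ρ0 j)) ρ0) (z : E) :
    HasDerivAt (fun ρ => Top e m' (s2 ρ) (Top e m (s1 ρ) F) z)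
      ((m' - m) / 2 * Aop e m' (s2 ρ0) (Top e m (s1 ρ0) F)
        (fun z => ∑ j, w j * (fderiv ℝ (Top e m (s1 ρ0) F) z (e j)) ^ 2) z) ρ0 := by
  classical
  have hK := hF.nonneg
  have hL := Lsz_nonneg e
  obtain ⟨C, hC, hC2⟩ := Top_rho_lip e m K hK hd1
  obtain ⟨D2, M2, hD2, hM2, hl2⟩ := loclip hd2
  set F1 := Top e m (s1 ρ0) F with hF1d
  have hF1 : Good K F1 := hF.top e m _
  have key := LSE_real m' (fun ρ u2 => Top e m (s1 ρ) F (z + lin e (s2 ρ) u2)) _ ρ0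
    (|F1 z| + C) (K * (M2 * Lsz e) + K * (D2 * Lsz e))
    (fun ρ => ((hF.top e m (s1 ρ)).cont_lin e _ _).measurable)
    (fun v => by
      have a1 := hF1.abs_le e (s2 ρ0) hl2.self_of_nhds.2 z v
      have := N1_nonneg v
      have : 0 ≤ K * (D2 * Lsz e) * N1 v := by positivity
      linarith)
    (by
      filter_upwards [hC2, hl2] with ρ h1 h2 v
      have a1 := h1 F hF (z + lin e (s2 ρ0) v)
      have a2 := Top_lip hF e m (s1 ρ) (z + lin e (s2 ρ) v) (z + lin e (s2 ρ0) v)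
      rw [add_sub_add_left_eq_sub, lin_sub] at a2
      have a3 := norm_lin_le e (fun j => s2 ρ j - s2 ρ0 j) v h2.1
      have hN := N1_nonneg v
      have a4 : K * ‖lin e (fun j => s2 ρ j - s2 ρ0 j) v‖ ≤ K * (D2 * |ρ - ρ0| * Lsz e * N1 v) := by
        gcongr
      have a5 := abs_sub_le (Top e m (s1 ρ) F (z + lin e (s2 ρ) v))
        (Top e m (s1 ρ) F (z + lin e (s2 ρ0) v)) (F1 (z + lin e (s2 ρ0) v))
      calc _ ≤ (C + K * (D2 * Lsz e) * N1 v) * |ρ - ρ0| := by linarith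
        _ ≤ _ := by
          refine mul_le_mul_of_nonneg_right ?_ (abs_nonneg _)
          have : 0 ≤ K * (M2 * Lsz e) * N1 v := by positivity
          linarith [abs_nonneg (F1 z)])
    (fun v => inner_deriv hF e m hd1 hd2 z v)
  refine key.congr_deriv ?_
  unfold Aop
  -- split the inner average
  set σ1 := s1 ρ0 with hσ1
  set σ2 := s2 ρ0 with hσ2
  have hin : ∀ u2, Av m (gJ J) (fun u1 => F (z + lin e σ2 u2 + lin e σ1 u1))
        (fun u1 => fderiv ℝ F (z + lin e σ2 u2 + lin e σ1 u1)
          (lin e (fun j => w j / (2 * σ2 j)) u2 + lin e (fun j => -(w j / (2 * σ1 j))) u1))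
      = ∑ j, w j / 2 * Av m (gJ J) (fun u1 => F (z + lin e σ2 u2 + lin e σ1 u1))
        (fun u1 => (-(u1 j / σ1 j) + u2 j / σ2 j) *
          fderiv ℝ F (z + lin e σ2 u2 + lin e σ1 u1) (e j)) := by
    intro u2
    simp only [← Av_const_mul]
    rw [← Av_sum hF e m σ1 (z + lin e σ2 u2) Finset.univ
      (a := fun j => |w j / 2| * (|u2 j / σ2 j| * (K * ‖e j‖)))
      (b := fun j => |w j / 2| * ((σ1 j)⁻¹ * (K * ‖e j‖)))]
    · congr 1; funext u1
      unfold lin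
      rw [← Finset.sum_add_distrib, map_sum]
      refine Finset.sum_congr rfl fun j _ => ?_
      rw [← add_smul, map_smul, smul_eq_mul]
      have := (h1 j).ne'; have := (h2 j).ne'
      field_simp
      ring
    · intro j _
      refine Measurable.const_mul (Measurable.mul (by fun_prop) ?_) _
      exact (meas_fderiv F (e j)).comp
        (by fun_prop : Continuous fun v => z + lin e σ2 u2 + lin e σ1 v).measurable
    · intro j _ v
      rw [abs_mul, abs_mul]
      have q1 := hF.fderiv_apply_le (z + lin e σ2 u2 + lin e σ1 v) (e j)
      have q2 : |-(v j / σ1 j) + u2 j / σ2 j| ≤ |u2 j / σ2 j| + (σ1 j)⁻¹ * N1 v := by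
        refine (abs_add_le _ _).trans ?_
        rw [abs_neg, add_comm, abs_div (v j), abs_of_pos (h1 j), div_eq_inv_mul |v j|]
        have := abs_le_N1 v j
        have := (h1 j).le
        gcongr
      have q3 := N1_nonneg v
      have q4 := (h1 j).le
      calc _ ≤ |w j / 2| * ((|u2 j / σ2 j| + (σ1 j)⁻¹ * N1 v) * (K * ‖e j‖)) := by gcongr
        _ = _ := by ring
  simp only [hin]
  rw [Av_def m', Av_def m']
  rw [← mul_assoc, mul_comm ((m' - m) / 2), mul_assoc]
  congr 1
  have hid := fun j => core_id hF e m m' σ1 σ2 j (h1 j) (h2 j) z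
  simp only [← hF1d] at hid
  simp only [Finset.mul_sum]
  rw [integral_finsetSum, integral_finsetSum, Finset.mul_sum]
  · refine Finset.sum_congr rfl fun j _ => ?_
    have e1 := (hid j).2
    have e2 : ∀ a b : ℝ, a * (w j / 2 * b) = w j / 2 * (a * b) := fun a b => by ring
    have e3 : ∀ a b : ℝ, a * (w j * b) = w j * (a * b) := fun a b => by ring
    simp only [e2, e3, integral_const_mul]
    rw [e1]; ring
  · intro j _
    refine hF1.int_weight e m' σ2 z (a := |w j| * (K * ‖e j‖) ^ 2) (b := 0) ?_ fun v => ?_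
    · exact (((meas_fderiv F1 (e j)).comp
        (by fun_prop : Continuous fun v => z + lin e σ2 v).measurable).pow_const 2).const_mul _
    · rw [abs_mul, abs_pow, zero_mul, add_zero]
      have q1 := hF1.fderiv_apply_le (z + lin e σ2 v) (e j)
      gcongr
  · intro j _
    refine ((hid j).1.const_mul (w j / 2)).congr (Filter.Eventually.of_forall fun u2 => ?_)
    dsimp only; ring

/-- Uniform parameter-Lipschitz bound for the two varying levels. -/
lemma core_lip {K : ℝ} {F : E → ℝ} (hF : Good K F) (e : J → E) (m m' : ℝ)
    {s1 s2 : ℝ → J → ℝ} {d1 d2 : J → ℝ} {ρ0 : ℝ}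
    (hd1 : ∀ j, HasDerivAt (fun ρ => s1 ρ j) (d1 j) ρ0)
    (hd2 : ∀ j, HasDerivAt (fun ρ => s2 ρ j) (d2 j) ρ0) :
    ∃ C, 0 ≤ C ∧ ∀ᶠ ρ in nhds ρ0, ∀ z, |Top e m' (s2 ρ) (Top e m (s1 ρ) F) z
      - Top e m' (s2 ρ0) (Top e m (s1 ρ0) F) z| ≤ C * |ρ - ρ0| := by
  obtain ⟨C1, hC1, hl1⟩ := Top_rho_lip e m K hF.nonneg hd1
  obtain ⟨C2, hC2, hl2⟩ := Top_rho_lip e m' K hF.nonneg hd2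
  refine ⟨C2 + C1, by positivity, ?_⟩
  filter_upwards [hl1, hl2] with ρ h1 h2 z
  have a1 := h2 _ (hF.top e m (s1 ρ)) z
  have a2 := Top_mono_lip (hF.top e m (s1 ρ)) (hF.top e m (s1 ρ0)) e m' (s2 ρ0) (h1 F hF) z
  have a3 := abs_sub_le (Top e m' (s2 ρ) (Top e m (s1 ρ) F) z)
    (Top e m' (s2 ρ0) (Top e m (s1 ρ) F) z) (Top e m' (s2 ρ0) (Top e m (s1 ρ0) F) z)
  linarith

end core

section Levels
variable {J : Type} [Fintype J] {E : Type} [NormedAddCommGroup E] [NormedSpace ℝ E]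

/-- Successive log-Laplace transforms. -/
def Lam (e : J → E) (mv : ℕ → ℝ) (σ : ℕ → J → ℝ) (F0 : E → ℝ) : ℕ → E → ℝ
  | 0 => F0
  | k+1 => Top e (mv (k+1)) (σ k) (Lam e mv σ F0 k)

/-- Iterated tilted averages. -/
def AA (e : J → E) (mv : ℕ → ℝ) (σ : ℕ → J → ℝ) (F0 : E → ℝ) (lo : ℕ) :
    ℕ → (E → ℝ) → E → ℝ
  | 0, h => h
  | hi+1, h => if hi + 1 < lo then h
      else Aop e (mv (hi+1)) (σ hi) (Lam e mv σ F0 hi) (AA e mv σ F0 lo hi h)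

lemma AA_of_lt (e : J → E) (mv : ℕ → ℝ) (σ : ℕ → J → ℝ) (F0 : E → ℝ) (lo hi : ℕ) (h : E → ℝ)
    (hlt : hi < lo) : AA e mv σ F0 lo hi h = h := by
  cases hi with
  | zero => rfl
  | succ k => simp [AA, hlt]

lemma AA_succ (e : J → E) (mv : ℕ → ℝ) (σ : ℕ → J → ℝ) (F0 : E → ℝ) (lo hi : ℕ) (h : E → ℝ)
    (hlt : lo ≤ hi + 1) : AA e mv σ F0 lo (hi+1) h =
      Aop e (mv (hi+1)) (σ hi) (Lam e mv σ F0 hi) (AA e mv σ F0 lo hi h) := by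
  simp [AA, Nat.not_lt.2 hlt]

lemma Lam_congr (e : J → E) (mv : ℕ → ℝ) (σ σ' : ℕ → J → ℝ) (F0 : E → ℝ) (k : ℕ)
    (h : ∀ i < k, σ i = σ' i) : Lam e mv σ F0 k = Lam e mv σ' F0 k := by
  induction k with
  | zero => rfl
  | succ k ih =>
    simp only [Lam]
    rw [ih fun i hi => h i (by omega), h k (by omega)]

variable [FiniteDimensional ℝ E] [MeasurableSpace E] [BorelSpace E]

lemma Good.lam {K : ℝ} {F0 : E → ℝ} (h : Good K F0) (e : J → E) (mv : ℕ → ℝ) (σ : ℕ → J → ℝ)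
    (k : ℕ) : Good K (Lam e mv σ F0 k) := by
  induction k with
  | zero => exact h
  | succ k ih => exact ih.top e _ _

variable [SecondCountableTopology E]

lemma fderiv_Lam {K : ℝ} {F0 : E → ℝ} (h : Good K F0) (e : J → E) (mv : ℕ → ℝ) (σ : ℕ → J → ℝ)
    (k : ℕ) (w : E) : (fun z => fderiv ℝ (Lam e mv σ F0 k) z w)
      = AA e mv σ F0 1 k (fun z => fderiv ℝ F0 z w) := by
  induction k with
  | zero => rfl
  | succ k ih =>
    rw [AA_succ _ _ _ _ _ _ _ (by omega), ← ih]
    funext z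
    exact fderiv_Top (h.lam e mv σ k) e _ _ z w

lemma AA_meas {K : ℝ} {F0 : E → ℝ} (hF : Good K F0) (e : J → E) (mv : ℕ → ℝ) (σ : ℕ → J → ℝ)
    (lo hi : ℕ) {h : E → ℝ} (hm : Measurable h) : Measurable (AA e mv σ F0 lo hi h) := by
  induction hi with
  | zero => exact hm
  | succ k ih =>
    by_cases hk : k + 1 < lo
    · rwa [AA_of_lt _ _ _ _ _ _ _ hk]
    · rw [AA_succ _ _ _ _ _ _ _ (by omega)]
      exact measurable_Aop (hF.lam e mv σ k) e _ _ ih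

lemma AA_abs_le {K : ℝ} {F0 : E → ℝ} (hF : Good K F0) (e : J → E) (mv : ℕ → ℝ) (σ : ℕ → J → ℝ)
    (lo hi : ℕ) {h : E → ℝ} {B : ℝ} (hb : ∀ z, |h z| ≤ B) (z : E) :
    |AA e mv σ F0 lo hi h z| ≤ B := by
  induction hi generalizing z with
  | zero => exact hb z
  | succ k ih =>
    by_cases hk : k + 1 < lo
    · rw [AA_of_lt _ _ _ _ _ _ _ hk]; exact hb z
    · rw [AA_succ _ _ _ _ _ _ _ (by omega)]
      exact abs_Aop_le (hF.lam e mv σ k) e _ _ z ih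

lemma AA_const_mul {F0 : E → ℝ} (e : J → E) (mv : ℕ → ℝ) (σ : ℕ → J → ℝ)
    (lo hi : ℕ) (h : E → ℝ) (c : ℝ) :
    AA e mv σ F0 lo hi (fun z => c * h z) = fun z => c * AA e mv σ F0 lo hi h z := by
  induction hi with
  | zero => rfl
  | succ k ih =>
    by_cases hk : k + 1 < lo
    · rw [AA_of_lt _ _ _ _ _ _ _ hk, AA_of_lt _ _ _ _ _ _ _ hk]
    · rw [AA_succ _ _ _ _ _ _ _ (by omega), AA_succ _ _ _ _ _ _ _ (by omega), ih,
        Aop_const_mul]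

lemma AA_sum {ι : Type} {K : ℝ} {F0 : E → ℝ} (hF : Good K F0) (e : J → E) (mv : ℕ → ℝ)
    (σ : ℕ → J → ℝ) (lo hi : ℕ) (s : Finset ι) (h : ι → E → ℝ) (hm : ∀ i, Measurable (h i))
    (hb : ∀ i, ∃ B, ∀ z, |h i z| ≤ B) :
    AA e mv σ F0 lo hi (fun z => ∑ i ∈ s, h i z) = fun z => ∑ i ∈ s, AA e mv σ F0 lo hi (h i) z := by
  induction hi with
  | zero => rfl
  | succ k ih =>
    by_cases hk : k + 1 < lo
    · simp only [AA_of_lt _ _ _ _ _ _ _ hk]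
    · simp only [AA_succ _ _ _ _ _ _ _ (show lo ≤ k + 1 by omega)]
      rw [ih, Aop_sum (hF.lam e mv σ k) e _ _ s (fun i => AA_meas hF e mv σ lo k (hm i))]
      intro i
      obtain ⟨B, hB⟩ := hb i
      exact ⟨B, AA_abs_le hF e mv σ lo k hB⟩

lemma Lam_deriv {K : ℝ} {F0 : E → ℝ} (hF : Good K F0) (e : J → E) (mv : ℕ → ℝ)
    (σ : ℝ → ℕ → J → ℝ) (κ : ℕ) (w : J → ℝ) (ρ0 : ℝ)
    (hne : ∀ ρ i, i ≠ κ → i ≠ κ + 1 → σ ρ i = σ ρ0 i)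
    (h1 : ∀ j, 0 < σ ρ0 κ j) (h2 : ∀ j, 0 < σ ρ0 (κ+1) j)
    (hd1 : ∀ j, HasDerivAt (fun ρ => σ ρ κ j) (-(w j / (2 * σ ρ0 κ j))) ρ0)
    (hd2 : ∀ j, HasDerivAt (fun ρ => σ ρ (κ+1) j) (w j / (2 * σ ρ0 (κ+1) j)) ρ0) (d : ℕ) :
    (∀ z, HasDerivAt (fun ρ => Lam e mv (σ ρ) F0 (κ+2+d) z)
      ((mv (κ+2) - mv (κ+1)) / 2 * AA e mv (σ ρ0) F0 (κ+2) (κ+2+d)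
        (fun z => ∑ j, w j * (fderiv ℝ (Lam e mv (σ ρ0) F0 (κ+1)) z (e j)) ^ 2) z) ρ0) ∧
    ∃ C, 0 ≤ C ∧ ∀ᶠ ρ in nhds ρ0, ∀ z, |Lam e mv (σ ρ) F0 (κ+2+d) z
      - Lam e mv (σ ρ0) F0 (κ+2+d) z| ≤ C * |ρ - ρ0| := by
  induction d with
  | zero =>
    have e0 : ∀ ρ, Lam e mv (σ ρ) F0 (κ+2) = Top e (mv (κ+2)) (σ ρ (κ+1))
        (Top e (mv (κ+1)) (σ ρ κ) (Lam e mv (σ ρ0) F0 κ)) := by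
      intro ρ
      rw [← Lam_congr e mv (σ ρ) (σ ρ0) F0 κ fun i hi => hne ρ i (by omega) (by omega)]
      rfl
    have hG := hF.lam e mv (σ ρ0) κ
    constructor
    · intro z
      have := core_deriv hG e (mv (κ+1)) (mv (κ+2)) h1 h2 hd1 hd2 z
      simp only [add_zero, e0]
      rw [AA_succ e mv (σ ρ0) F0 (κ+2) (κ+1) _ (le_refl _), AA_of_lt _ _ _ _ _ _ _ (by omega)]
      exact this
    · simp only [add_zero, e0]
      exact core_lip hG e (mv (κ+1)) (mv (κ+2)) hd1 hd2
  | succ d ih =>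
    obtain ⟨ih1, C, hC, ih2⟩ := ih
    have e0 : ∀ ρ, Lam e mv (σ ρ) F0 (κ+2+(d+1)) = Top e (mv (κ+2+d+1)) (σ ρ0 (κ+2+d))
        (Lam e mv (σ ρ) F0 (κ+2+d)) := by
      intro ρ
      rw [← hne ρ (κ+2+d) (by omega) (by omega)]
      rfl
    have hG : ∀ ρ, Good K (Lam e mv (σ ρ) F0 (κ+2+d)) := fun ρ => hF.lam e mv (σ ρ) _
    constructor
    · intro z
      have := Top_param hG ih1 hC ih2 e (mv (κ+2+d+1)) (σ ρ0 (κ+2+d)) z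
      rw [Aop_const_mul] at this
      simp only [e0]
      rw [← add_assoc, AA_succ e mv (σ ρ0) F0 (κ+2) (κ+2+d) _ (by omega)]
      exact this
    · refine ⟨C, hC, ?_⟩
      filter_upwards [ih2] with ρ hρ z
      rw [e0, e0]
      exact Top_mono_lip (hG ρ) (hG ρ0) e _ _ hρ z

end Levels

section Base
variable {l : ℕ}

/-- The space of exponent fields. -/
abbrev Fld (l : ℕ) : Type := Fin l → Fin l → ℝ

/-- inner partition sum -/
def Cz (β : ℝ) (z : Fld l) (i1 : Fin l) : ℝ := ∑ i2, exp (β * z i1 i2)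

/-- outer partition sum -/
def Zz (β s : ℝ) (z : Fld l) : ℝ := ∑ i1, Cz β z i1 ^ s

/-- The log-partition function. -/
def F0z (β s : ℝ) (z : Fld l) : ℝ := log (Zz β s z)

/-- Gibbs weights. -/
def g0 (β s : ℝ) (i1 i2 : Fin l) (z : Fld l) : ℝ :=
  Cz β z i1 ^ s / Zz β s z * (exp (β * z i1 i2) / Cz β z i1)

lemma Cz_pos (β : ℝ) (z : Fld l) (i1 : Fin l) : 0 < Cz β z i1 :=
  Finset.sum_pos (fun _ _ => exp_pos _) ⟨i1, Finset.mem_univ _⟩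

lemma Zz_pos (hl : 1 ≤ l) (β s : ℝ) (z : Fld l) : 0 < Zz β s z :=
  Finset.sum_pos (fun i _ => rpow_pos_of_pos (Cz_pos β z i) s) ⟨⟨0, hl⟩, Finset.mem_univ _⟩

lemma g0_nonneg (hl : 1 ≤ l) (β s : ℝ) (i1 i2 : Fin l) (z : Fld l) : 0 ≤ g0 β s i1 i2 z := by
  have h1 := Cz_pos β z i1
  have h2 := Zz_pos hl β s z
  unfold g0; positivity

lemma g0_sum (hl : 1 ≤ l) (β s : ℝ) (z : Fld l) : ∑ i1, ∑ i2, g0 β s i1 i2 z = 1 := by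
  have h2 := Zz_pos hl β s z
  have : ∀ i1, ∑ i2, g0 β s i1 i2 z = Cz β z i1 ^ s / Zz β s z := by
    intro i1
    unfold g0
    rw [← Finset.mul_sum, ← Finset.sum_div]
    have h1 := (Cz_pos β z i1).ne'
    rw [show ∑ i2, exp (β * z i1 i2) = Cz β z i1 from rfl, div_self h1, mul_one]
  simp only [this]
  rw [← Finset.sum_div]
  exact div_self h2.ne'

lemma g0_abs_le (hl : 1 ≤ l) (β s : ℝ) (i1 i2 : Fin l) (z : Fld l) : |g0 β s i1 i2 z| ≤ 1 := by
  rw [abs_of_nonneg (g0_nonneg hl _ _ _ _ _), ← g0_sum hl β s z]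
  refine (Finset.single_le_sum (f := fun i2 => g0 β s i1 i2 z)
    (fun i _ => g0_nonneg hl _ _ _ _ _) (Finset.mem_univ i2)).trans ?_
  exact Finset.single_le_sum (f := fun i1 => ∑ i2, g0 β s i1 i2 z)
    (fun i _ => Finset.sum_nonneg fun j _ => g0_nonneg hl _ _ _ _ _) (Finset.mem_univ i1)

lemma g0_meas (β s : ℝ) (i1 i2 : Fin l) : Measurable (g0 β s i1 i2) := by
  have h1 : ∀ i j : Fin l, Measurable fun z : Fld l => exp (β * z i j) := fun i j => by fun_prop
  have h2 : ∀ i : Fin l, Measurable fun z : Fld l => Cz β z i := fun i =>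
    Finset.measurable_sum _ fun j _ => h1 i j
  have h3 : Measurable fun z : Fld l => Zz β s z :=
    Finset.measurable_sum _ fun j _ => (h2 j).pow_const s
  unfold g0
  exact (((h2 i1).pow_const s).div h3).mul ((h1 i1 i2).div (h2 i1))

lemma F0z_fderiv (hl : 1 ≤ l) (β s : ℝ) (z : Fld l) : ∃ L : Fld l →L[ℝ] ℝ,
    HasFDerivAt (F0z β s) L z ∧ ∀ w, L w = ∑ i1, ∑ i2, s * β * w i1 i2 * g0 β s i1 i2 z := by
  have hP : ∀ i1 i2 : Fin l, HasFDerivAt (fun z : Fld l => z i1 i2)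
      ((ContinuousLinearMap.proj (R := ℝ) (φ := fun _ : Fin l => ℝ) i2).comp
        (ContinuousLinearMap.proj (R := ℝ) (φ := fun _ : Fin l => Fin l → ℝ) i1)) z :=
    fun i1 i2 => ((ContinuousLinearMap.proj (R := ℝ) (φ := fun _ : Fin l => ℝ) i2).comp
        (ContinuousLinearMap.proj (R := ℝ) (φ := fun _ : Fin l => Fin l → ℝ) i1)).hasFDerivAt
  have hC : ∀ i1 : Fin l, HasFDerivAt (fun z : Fld l => Cz β z i1) _ z := fun i1 =>
    HasFDerivAt.fun_sum fun i2 _ => ((hP i1 i2).const_mul β).exp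
  have hZ : HasFDerivAt (fun z : Fld l => Zz β s z) _ z :=
    HasFDerivAt.fun_sum fun i1 _ => (hC i1).rpow_const (p := s) (Or.inl (Cz_pos β z i1).ne')
  have h2 := Zz_pos hl β s z
  refine ⟨_, hZ.log h2.ne', fun w => ?_⟩
  simp only [smul_apply, sum_apply, smul_eq_mul, ContinuousLinearMap.comp_apply,
    ContinuousLinearMap.proj_apply, Finset.mul_sum]
  refine Finset.sum_congr rfl fun i1 _ => Finset.sum_congr rfl fun i2 _ => ?_
  have h1 := Cz_pos β z i1
  unfold g0
  rw [rpow_sub_one h1.ne']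
  field_simp

lemma F0z_good (hl : 1 ≤ l) (β s : ℝ) (hβ : 0 ≤ β) : Good (|s| * β) (F0z (l := l) β s) := by
  have hd : ∀ z : Fld l, DifferentiableAt ℝ (F0z β s) z := fun z => by
    obtain ⟨L, hL, _⟩ := F0z_fderiv hl β s z
    exact hL.differentiableAt
  refine ⟨by positivity, fun z => hd z, fun z z' => ?_⟩
  have := Convex.norm_image_sub_le_of_norm_fderiv_le (𝕜 := ℝ) (f := F0z (l := l) β s)
    (s := Set.univ) (C := |s| * β) (x := z') (y := z) (fun z _ => hd z) (fun z _ => ?_) convex_univ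
    (Set.mem_univ _) (Set.mem_univ _)
  · simpa using this
  · obtain ⟨L, hL, hw⟩ := F0z_fderiv hl β s z
    rw [hL.fderiv]
    refine L.opNorm_le_bound (by positivity) fun w => ?_
    rw [hw, norm_eq_abs]
    calc |∑ i1, ∑ i2, s * β * w i1 i2 * g0 β s i1 i2 z|
        ≤ ∑ i1, ∑ i2, |s| * β * ‖w‖ * g0 β s i1 i2 z := by
          refine (Finset.abs_sum_le_sum_abs _ _).trans (Finset.sum_le_sum fun i1 _ => ?_)
          refine (Finset.abs_sum_le_sum_abs _ _).trans (Finset.sum_le_sum fun i2 _ => ?_)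
          have h3 := g0_nonneg hl β s i1 i2 z
          rw [abs_mul, abs_mul, abs_mul, abs_of_nonneg h3, abs_of_nonneg hβ]
          have : |w i1 i2| ≤ ‖w‖ := (norm_le_pi_norm (w i1) i2).trans (norm_le_pi_norm w i1)
          gcongr
      _ = _ := by
          simp only [← Finset.mul_sum]
          rw [g0_sum hl, mul_one]

variable {J : Type} [Fintype J]

lemma fderiv_Lam_F0 (hl : 1 ≤ l) (β s : ℝ) (hβ : 0 ≤ β) (e : J → Fld l) (mv : ℕ → ℝ)
    (σ : ℕ → J → ℝ) (k : ℕ) (w z : Fld l) :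
    fderiv ℝ (Lam e mv σ (F0z β s) k) z w =
      ∑ i1, ∑ i2, s * β * w i1 i2 * AA e mv σ (F0z β s) 1 k (g0 β s i1 i2) z := by
  have hG := F0z_good hl β s hβ
  have h := congrFun (fderiv_Lam hG e mv σ k w) z
  have e1 : (fun z => fderiv ℝ (F0z (l := l) β s) z w)
      = fun z => ∑ ii : Fin l × Fin l, s * β * w ii.1 ii.2 * g0 β s ii.1 ii.2 z := by
    funext z
    obtain ⟨L, hL, hw⟩ := F0z_fderiv hl β s z
    rw [hL.fderiv, hw, Fintype.sum_prod_type]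
  rw [h, e1, AA_sum hG e mv σ 1 k]
  · simp only [AA_const_mul]
    rw [Fintype.sum_prod_type]
  · intro i; exact (g0_meas β s i.1 i.2).const_mul _
  · intro i
    refine ⟨|s * β * w i.1 i.2| * 1, fun z => ?_⟩
    rw [abs_mul]
    exact mul_le_mul_of_nonneg_left (g0_abs_le hl _ _ _ _ _) (abs_nonneg _)

/-- The pair weights at level `k`. -/
def gk (e : J → Fld l) (mv : ℕ → ℝ) (σ : ℕ → J → ℝ) (β s : ℝ) (k : ℕ) (i : (Fin l × Fin l))
    (z : Fld l) : ℝ := AA e mv σ (F0z β s) 1 k (g0 β s i.1 i.2) z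

lemma gk_meas (hl : 1 ≤ l) (β s : ℝ) (hβ : 0 ≤ β) (e : J → Fld l) (mv : ℕ → ℝ)
    (σ : ℕ → J → ℝ) (k : ℕ) (i : (Fin l × Fin l)) : Measurable (gk e mv σ β s k i) :=
  AA_meas (F0z_good hl β s hβ) e mv σ 1 k (g0_meas β s i.1 i.2)

lemma gk_abs_le (hl : 1 ≤ l) (β s : ℝ) (hβ : 0 ≤ β) (e : J → Fld l) (mv : ℕ → ℝ)
    (σ : ℕ → J → ℝ) (k : ℕ) (i : (Fin l × Fin l)) (z : Fld l) : |gk e mv σ β s k i z| ≤ 1 :=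
  AA_abs_le (F0z_good hl β s hβ) e mv σ 1 k (g0_abs_le hl β s i.1 i.2) z

/-- Iterated average of the quadratic form in the gradient. -/
lemma AA_quad (hl : 1 ≤ l) (β s : ℝ) (hβ : 0 ≤ β) (e : J → Fld l) (mv : ℕ → ℝ)
    (σ : ℕ → J → ℝ) (k N : ℕ) (w : J → ℝ) (z : Fld l) :
    AA e mv σ (F0z β s) (k+1) N
        (fun z => ∑ j, w j * (fderiv ℝ (Lam e mv σ (F0z β s) k) z (e j)) ^ 2) z
      = (s * β) ^ 2 * ∑ i : Fin l × Fin l, ∑ i' : Fin l × Fin l,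
        (∑ j, w j * (e j i.1 i.2 * e j i'.1 i'.2)) *
        AA e mv σ (F0z β s) (k+1) N
          (fun z => gk e mv σ β s k i z * gk e mv σ β s k i' z) z := by
  have hG := F0z_good hl β s hβ
  have e1 : (fun z => ∑ j, w j * (fderiv ℝ (Lam e mv σ (F0z β s) k) z (e j)) ^ 2)
      = fun z => ∑ ii : (Fin l × Fin l) × (Fin l × Fin l),
        ((s * β) ^ 2 * (∑ j, w j * (e j ii.1.1 ii.1.2 * e j ii.2.1 ii.2.2))) *
          (gk e mv σ β s k ii.1 z * gk e mv σ β s k ii.2 z) := by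
    funext z
    have : ∀ j, w j * (fderiv ℝ (Lam e mv σ (F0z β s) k) z (e j)) ^ 2 =
        ∑ ii : (Fin l × Fin l) × (Fin l × Fin l),
        ((s * β) ^ 2 * (w j * (e j ii.1.1 ii.1.2 * e j ii.2.1 ii.2.2))) *
          (gk e mv σ β s k ii.1 z * gk e mv σ β s k ii.2 z) := by
      intro j
      rw [fderiv_Lam_F0 hl β s hβ, pow_two]
      have hp : (∑ i1, ∑ i2, s * β * e j i1 i2 * AA e mv σ (F0z β s) 1 k (g0 β s i1 i2) z)
          = ∑ i : Fin l × Fin l, s * β * e j i.1 i.2 *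
            AA e mv σ (F0z β s) 1 k (g0 β s i.1 i.2) z := by rw [Fintype.sum_prod_type]
      rw [hp, Finset.sum_mul_sum, Finset.mul_sum]
      conv_rhs => rw [Fintype.sum_prod_type]
      refine Finset.sum_congr rfl fun i _ => ?_
      rw [Finset.mul_sum]
      refine Finset.sum_congr rfl fun i' _ => ?_
      unfold gk
      ring
    simp only [this]
    rw [Finset.sum_comm]
    refine Finset.sum_congr rfl fun ii _ => ?_
    rw [Finset.mul_sum, Finset.sum_mul]
  rw [e1, AA_sum hG]
  · simp only [AA_const_mul]
    rw [Finset.mul_sum]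
    conv_lhs => rw [Fintype.sum_prod_type]
    refine Finset.sum_congr rfl fun i _ => ?_
    rw [Finset.mul_sum]
    refine Finset.sum_congr rfl fun i' _ => ?_
    ring
  · intro ii
    exact ((gk_meas hl β s hβ e mv σ k ii.1).mul (gk_meas hl β s hβ e mv σ k ii.2)).const_mul _
  · intro ii
    refine ⟨|((s * β) ^ 2 * (∑ j, w j * (e j ii.1.1 ii.1.2 * e j ii.2.1 ii.2.2)))| * (1 * 1),
      fun z => ?_⟩
    rw [abs_mul, abs_mul (gk e mv σ β s k ii.1 z)]
    gcongr
    · exact gk_abs_le hl β s hβ e mv σ k _ z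
    · exact gk_abs_le hl β s hβ e mv σ k _ z

end Base

section Iface
variable {m n l : ℕ}

instance gVec_prob (d : ℕ) : IsProbabilityMeasure (gVec d) := by unfold gVec; infer_instance
instance gMat_prob (m n : ℕ) : IsProbabilityMeasure (gMat m n) := by unfold gMat; infer_instance
instance muU_prob (m n : ℕ) : IsProbabilityMeasure (muU m n) := by unfold muU; infer_instance
instance muAll_prob (r m n : ℕ) : IsProbabilityMeasure (muAll r m n) := by
  unfold muAll; infer_instance

/-- Index set of the coordinates of one group. -/
abbrev JJ (m n : ℕ) : Type := Unit ⊕ (Fin m ⊕ Fin n)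

/-- One group as a vector. -/
def toJ : Us m n ≃ᵐ (JJ m n → ℝ) where
  toFun u := Sum.elim (fun _ => u.1) (Sum.elim u.2.1 u.2.2)
  invFun v := (v (Sum.inl ()), fun j => v (Sum.inr (Sum.inl j)), fun j => v (Sum.inr (Sum.inr j)))
  left_inv u := rfl
  right_inv v := by
    funext j
    rcases j with j | j | j <;> rfl
  measurable_toFun := by
    refine measurable_pi_iff.2 fun j => ?_
    rcases j with j | j | j
    · exact measurable_fst
    · exact (measurable_pi_apply j).comp (measurable_fst.comp measurable_snd)
    · exact (measurable_pi_apply j).comp (measurable_snd.comp measurable_snd)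
  measurable_invFun := by
    refine Measurable.prodMk (measurable_pi_apply _) (Measurable.prodMk ?_ ?_)
    · exact measurable_pi_iff.2 fun j => measurable_pi_apply _
    · exact measurable_pi_iff.2 fun j => measurable_pi_apply _

lemma toJ_inl (u : Us m n) (j : Unit) : toJ u (Sum.inl j) = u.1 := rfl
lemma toJ_inr_inl (u : Us m n) (j : Fin m) : toJ u (Sum.inr (Sum.inl j)) = u.2.1 j := rfl
lemma toJ_inr_inr (u : Us m n) (j : Fin n) : toJ u (Sum.inr (Sum.inr j)) = u.2.2 j := rfl

lemma toJ_mp : MeasurePreserving (toJ (m := m) (n := n)) (muU m n) (gJ (JJ m n)) := by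
  refine ⟨toJ.measurable, ?_⟩
  unfold gJ
  symm
  refine Measure.pi_eq fun s hs => ?_
  rw [toJ.map_apply]
  have : toJ (m := m) (n := n) ⁻¹' (Set.univ.pi s) = (s (Sum.inl ())) ×ˢ
      ((Set.univ.pi fun j => s (Sum.inr (Sum.inl j))) ×ˢ
        (Set.univ.pi fun j => s (Sum.inr (Sum.inr j)))) := by
    ext u
    simp only [Set.mem_preimage, Set.mem_univ_pi, Set.mem_prod]
    constructor
    · intro h
      exact ⟨h (Sum.inl ()), fun j => h (Sum.inr (Sum.inl j)), fun j => h (Sum.inr (Sum.inr j))⟩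
    · rintro ⟨h1, h2, h3⟩ j
      rcases j with j | j | j
      · exact h1
      · exact h2 j
      · exact h3 j
  rw [this]
  unfold muU gVec
  rw [Measure.prod_prod, Measure.prod_prod, Measure.pi_pi, Measure.pi_pi, Fintype.prod_sum_type,
    Fintype.prod_sum_type]
  simp

/-- Directions. -/
def eV (t : ℝ) (x : Fin l → Fin n → ℝ) (y : Fin l → Fin m → ℝ) : JJ m n → Fld l
  | Sum.inl _ => fun i1 i2 => sqrt t * nrm2 (x i1) * nrm2 (y i2)
  | Sum.inr (Sum.inl j) => fun i1 i2 => sqrt (1 - t) * nrm2 (x i1) * y i2 j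
  | Sum.inr (Sum.inr k) => fun i1 i2 => sqrt (1 - t) * nrm2 (y i2) * x i1 k

/-- Standard deviations. -/
def sg (m n : ℕ) (p q : ℕ → ℝ) (k : ℕ) : JJ m n → ℝ
  | Sum.inl _ => sqrt (p k * q k - p (k+1) * q (k+1))
  | Sum.inr (Sum.inl _) => sqrt (p k - p (k+1))
  | Sum.inr (Sum.inr _) => sqrt (q k - q (k+1))

/-- The part of the exponent depending on `G`. -/
def Gp (t : ℝ) (x : Fin l → Fin n → ℝ) (y : Fin l → Fin m → ℝ) (G : Fin m → Fin n → ℝ) : Fld l :=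
  fun i1 i2 => sqrt t * (∑ j, ∑ k, y i2 j * (G j k * x i1 k))

/-- The exponent with the first `k` groups removed. -/
def zf (r : ℕ) (t : ℝ) (p q : ℕ → ℝ) (x : Fin l → Fin n → ℝ) (y : Fin l → Fin m → ℝ) (k : ℕ)
    (G : Fin m → Fin n → ℝ) (U : Fin (r+1) → Us m n) : Fld l :=
  Gp t x y G + ∑ i : Fin (r+1), if k ≤ (i : ℕ) then
    lin (eV t x y) (sg m n p q i) (toJ (U i)) else 0

lemma zf_zero (r : ℕ) (β s t : ℝ) (mv p q : ℕ → ℝ) (x : Fin l → Fin n → ℝ) (y : Fin l → Fin m → ℝ)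
    (G : Fin m → Fin n → ℝ) (U : Fin (r+1) → Us m n) (i1 i2 : Fin l) :
    D0R r 1 β s t mv p q x y G U i1 i2 = zf r t p q x y 0 G U i1 i2 := by
  unfold D0R zf Gp lin
  simp only [Nat.zero_le, if_true, Fintype.sum_sum_type, Pi.add_apply, Finset.sum_apply,
    Pi.smul_apply, smul_eq_mul, Finset.univ_unique, Finset.sum_singleton, eV, sg, toJ_inl,
    toJ_inr_inl, toJ_inr_inr, one_mul]
  rw [Finset.sum_add_distrib, Finset.sum_add_distrib]
  have h1 : sqrt (1 - t) * nrm2 (x i1) *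
        (∑ j, y i2 j * (∑ k : Fin (r+1), sqrt (p (k : ℕ) - p ((k : ℕ) + 1)) * (U k).2.1 j))
      = ∑ k : Fin (r+1), ∑ j, sqrt (p (k : ℕ) - p ((k : ℕ) + 1)) * (U k).2.1 j *
        (sqrt (1 - t) * nrm2 (x i1) * y i2 j) := by
    rw [Finset.sum_comm, Finset.mul_sum]
    refine Finset.sum_congr rfl fun j _ => ?_
    rw [Finset.mul_sum, Finset.mul_sum]
    refine Finset.sum_congr rfl fun k _ => ?_
    ring
  have h2 : sqrt (1 - t) * nrm2 (y i2) *
        (∑ kk, (∑ k : Fin (r+1), sqrt (q (k : ℕ) - q ((k : ℕ) + 1)) * (U k).2.2 kk) * x i1 kk)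
      = ∑ k : Fin (r+1), ∑ j, sqrt (q (k : ℕ) - q ((k : ℕ) + 1)) * (U k).2.2 j *
        (sqrt (1 - t) * nrm2 (y i2) * x i1 j) := by
    rw [Finset.sum_comm, Finset.mul_sum]
    refine Finset.sum_congr rfl fun j _ => ?_
    rw [Finset.sum_mul, Finset.mul_sum]
    refine Finset.sum_congr rfl fun k _ => ?_
    ring
  rw [h1, h2, ← Finset.sum_mul]
  ring

lemma zf_update (r : ℕ) (t : ℝ) (p q : ℕ → ℝ) (x : Fin l → Fin n → ℝ) (y : Fin l → Fin m → ℝ)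
    (k : ℕ) (hk : k < r + 1) (G : Fin m → Fin n → ℝ) (U : Fin (r+1) → Us m n) (u : Us m n) :
    zf r t p q x y k G (Function.update U ⟨k, hk⟩ u) =
      zf r t p q x y (k+1) G U + lin (eV t x y) (sg m n p q k) (toJ u) := by
  unfold zf
  rw [add_assoc]
  congr 1
  rw [← Finset.add_sum_erase _ _ (Finset.mem_univ (⟨k, hk⟩ : Fin (r+1))),
    ← Finset.add_sum_erase Finset.univ (fun i : Fin (r+1) => if k + 1 ≤ (i : ℕ) then
      lin (eV t x y) (sg m n p q i) (toJ (U i)) else 0) (Finset.mem_univ (⟨k, hk⟩ : Fin (r+1)))]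
  simp only [le_refl, if_true, Function.update_self]
  rw [if_neg (by omega), zero_add, add_comm]
  congr 1
  refine Finset.sum_congr rfl fun i hi => ?_
  have hne := Finset.ne_of_mem_erase hi
  have hne' : (i : ℕ) ≠ k := fun h => hne (Fin.ext h)
  rw [Function.update_of_ne hne]
  by_cases h : k ≤ (i : ℕ)
  · rw [if_pos h, if_pos (by omega)]
  · rw [if_neg h, if_neg (by omega)]

lemma zf_r (r : ℕ) (t : ℝ) (p q : ℕ → ℝ) (x : Fin l → Fin n → ℝ) (y : Fin l → Fin m → ℝ)
    (G : Fin m → Fin n → ℝ) (U : Fin (r+1) → Us m n) :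
    zf r t p q x y r G U = Gp t x y G
      + lin (eV t x y) (sg m n p q r) (toJ (U (Fin.last r))) := by
  unfold zf
  congr 1
  rw [Finset.sum_eq_single (Fin.last r)]
  · simp
  · intro i _ hi
    rw [if_neg]
    intro h
    exact hi (Fin.ext (by have := i.2; simp; omega))
  · simp

section Zeta
variable (r : ℕ) (β s t : ℝ) (mv p q : ℕ → ℝ) (x : Fin l → Fin n → ℝ) (y : Fin l → Fin m → ℝ)

lemma CR_eq (G : Fin m → Fin n → ℝ) (U : Fin (r+1) → Us m n) (i1 : Fin l) :
    CR r 1 β s t mv p q x y G U i1 = Cz β (zf r t p q x y 0 G U) i1 := by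
  unfold CR Cz AR
  simp only [zf_zero]

lemma ZR_eq (G : Fin m → Fin n → ℝ) (U : Fin (r+1) → Us m n) :
    ZR r 1 β s t mv p q x y G U = Zz β s (zf r t p q x y 0 G U) := by
  unfold ZR Zz
  simp only [CR_eq]

lemma gam0R_eq (i1 i2 : Fin l) :
    gam0R r 1 β s t mv p q x y i1 i2 = fun G U => g0 β s i1 i2 (zf r t p q x y 0 G U) := by
  funext G U
  unfold gam0R g0 AR
  simp only [CR_eq, ZR_eq, zf_zero]

lemma zeta_step (hm0 : mv 0 = 1) (hmpos : ∀ k, 1 ≤ k → k ≤ r → 0 < mv k)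
    (k : ℕ) (hk : k ≤ r) (z : Fld l) (c : ℝ) :
    exp (mv k * Lam (eV t x y) mv (sg m n p q) (F0z β s) k z) ^ (c / mv k)
      = exp (c * Lam (eV t x y) mv (sg m n p q) (F0z β s) k z) := by
  have hne : mv k ≠ 0 := by
    rcases Nat.eq_zero_or_pos k with h | h
    · rw [h, hm0]; exact one_ne_zero
    · exact (hmpos k h hk).ne'
  rw [← exp_mul]
  congr 1
  field_simp

lemma zeta_eq (hl : 1 ≤ l) (hβ : 0 ≤ β) (hm0 : mv 0 = 1)
    (hmpos : ∀ k, 1 ≤ k → k ≤ r → 0 < mv k) (k : ℕ) (hk : k ≤ r)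
    (G : Fin m → Fin n → ℝ) (U : Fin (r+1) → Us m n) :
    zetaR r 1 β s t mv p q x y G k U =
      exp (mv k * Lam (eV t x y) mv (sg m n p q) (F0z β s) k (zf r t p q x y k G U)) := by
  induction k generalizing U with
  | zero =>
    rw [hm0, one_mul]
    simp only [zetaR, Lam, F0z]
    rw [exp_log (Zz_pos hl _ _ _), ZR_eq]
  | succ k ih =>
    simp only [zetaR]
    rw [dif_pos (by omega)]
    simp only [ih (by omega), zf_update, zeta_step r β s t mv p q x y hm0 hmpos k (by omega)]
    have hG := (F0z_good hl β s hβ).lam (eV t x y) mv (sg m n p q) k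
    rw [show Lam (eV t x y) mv (sg m n p q) (F0z β s) (k+1) = Top (eV t x y) (mv (k+1))
      (sg m n p q k) (Lam (eV t x y) mv (sg m n p q) (F0z β s) k) from rfl, exp_Top hG]
    exact toJ_mp.integral_comp' (g := fun v => exp (mv (k+1) *
      Lam (eV t x y) mv (sg m n p q) (F0z β s) k (zf r t p q x y (k+1) G U +
        lin (eV t x y) (sg m n p q k) v)))

lemma PhiR_eq (hl : 1 ≤ l) (hβ : 0 ≤ β) (hm0 : mv 0 = 1)
    (hmpos : ∀ k, 1 ≤ k → k ≤ r → 0 < mv k) (k : ℕ) (hk : k + 1 ≤ r) (h : Fld l → ℝ) :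
    PhiR r 1 β s t mv p q x y (k+1) (fun G U => h (zf r t p q x y k G U)) =
      fun G U => Aop (eV t x y) (mv (k+1)) (sg m n p q k)
        (Lam (eV t x y) mv (sg m n p q) (F0z β s) k) h (zf r t p q x y (k+1) G U) := by
  funext G U
  simp only [PhiR, Nat.add_sub_cancel]
  rw [dif_pos (by omega)]
  simp only [zeta_eq r β s t mv p q x y hl hβ hm0 hmpos k (by omega),
    zeta_eq r β s t mv p q x y hl hβ hm0 hmpos (k+1) (by omega), zf_update,
    zeta_step r β s t mv p q x y hm0 hmpos k (by omega)]
  have hG := (F0z_good hl β s hβ).lam (eV t x y) mv (sg m n p q) k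
  rw [show Lam (eV t x y) mv (sg m n p q) (F0z β s) (k+1) = Top (eV t x y) (mv (k+1))
      (sg m n p q k) (Lam (eV t x y) mv (sg m n p q) (F0z β s) k) from rfl, exp_Top hG]
  unfold Aop
  rw [Av_def, div_eq_inv_mul]
  congr 1
  exact toJ_mp.integral_comp' (g := fun v => exp (mv (k+1) *
      Lam (eV t x y) mv (sg m n p q) (F0z β s) k (zf r t p q x y (k+1) G U +
        lin (eV t x y) (sg m n p q k) v)) * h (zf r t p q x y (k+1) G U +
        lin (eV t x y) (sg m n p q k) v))

lemma PhiUpToR_eq (hl : 1 ≤ l) (hβ : 0 ≤ β) (hm0 : mv 0 = 1)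
    (hmpos : ∀ k, 1 ≤ k → k ≤ r → 0 < mv k) (a d : ℕ) (hk : a + d ≤ r) (h : Fld l → ℝ) :
    PhiUpToR r 1 β s t mv p q x y (a+1) (a+d) (fun G U => h (zf r t p q x y a G U)) =
      fun G U => AA (eV t x y) mv (sg m n p q) (F0z β s) (a+1) (a+d) h
        (zf r t p q x y (a+d) G U) := by
  induction d with
  | zero =>
    rw [add_zero, AA_of_lt _ _ _ _ _ _ _ (by omega)]
    cases a with
    | zero => rfl
    | succ a => simp [PhiUpToR]
  | succ d ih =>
    rw [← add_assoc, AA_succ _ _ _ _ _ _ _ (by omega)]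
    simp only [PhiUpToR]
    rw [if_neg (by omega), ih (by omega), PhiR_eq r β s t mv p q x y hl hβ hm0 hmpos _ (by omega)]

lemma gamR_eq (hl : 1 ≤ l) (hβ : 0 ≤ β) (hm0 : mv 0 = 1)
    (hmpos : ∀ k, 1 ≤ k → k ≤ r → 0 < mv k) (k : ℕ) (hk : k ≤ r) (i1 i2 p1 p2 : Fin l) :
    gamR r 1 β s t mv p q x y k i1 i2 p1 p2 = fun G U =>
      AA (eV t x y) mv (sg m n p q) (F0z β s) (k+1) r
        (fun z => gk (eV t x y) mv (sg m n p q) β s k (i1, i2) z *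
          gk (eV t x y) mv (sg m n p q) β s k (p1, p2) z) (zf r t p q x y r G U) := by
  unfold gamR
  have h : ∀ i1 i2 : Fin l, PhiUpToR r 1 β s t mv p q x y 1 k (gam0R r 1 β s t mv p q x y i1 i2)
      = fun G U => gk (eV t x y) mv (sg m n p q) β s k (i1, i2) (zf r t p q x y k G U) := by
    intro i1 i2
    have := PhiUpToR_eq r β s t mv p q x y hl hβ hm0 hmpos 0 k (by omega) (g0 β s i1 i2)
    rw [zero_add, zero_add] at this
    rw [gam0R_eq, this]
    rfl
  simp only [h]
  obtain ⟨d, rfl⟩ := Nat.exists_eq_add_of_le hk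
  exact PhiUpToR_eq (k+d) β s t mv p q x y hl hβ hm0 hmpos k d le_rfl
    (fun z => gk (eV t x y) mv (sg m n p q) β s k (i1, i2) z *
          gk (eV t x y) mv (sg m n p q) β s k (p1, p2) z)

end Zeta

section Last

lemma last_mp (r m n : ℕ) : MeasurePreserving
    (fun ω : (Fin m → Fin n → ℝ) × (Fin (r+1) → Us m n) => (ω.1, toJ (ω.2 (Fin.last r))))
    (muAll r m n) ((gMat m n).prod (gJ (JJ m n))) := by
  have h1 : MeasurePreserving (fun U : Fin (r+1) → Us m n => toJ (U (Fin.last r)))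
      (Measure.pi fun _ : Fin (r+1) => muU m n) (gJ (JJ m n)) :=
    toJ_mp.comp (measurePreserving_eval (fun _ : Fin (r+1) => muU m n) (Fin.last r))
  exact (MeasurePreserving.id (gMat m n)).prod h1

lemma continuous_Gp (t : ℝ) (x : Fin l → Fin n → ℝ) (y : Fin l → Fin m → ℝ) :
    Continuous (Gp t x y) := by
  unfold Gp
  refine continuous_pi fun i1 => continuous_pi fun i2 => ?_
  fun_prop

lemma int_last (r : ℕ) (t : ℝ) (p q : ℕ → ℝ) (x : Fin l → Fin n → ℝ) (y : Fin l → Fin m → ℝ)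
    (H : Fld l → ℝ)
    (hi : Integrable (fun w : (Fin m → Fin n → ℝ) × (JJ m n → ℝ) =>
      H (Gp t x y w.1 + lin (eV t x y) (sg m n p q r) w.2)) ((gMat m n).prod (gJ (JJ m n)))) :
    ∫ ω, H (zf r t p q x y r ω.1 ω.2) ∂muAll r m n =
      ∫ G, ∫ v, H (Gp t x y G + lin (eV t x y) (sg m n p q r) v) ∂gJ (JJ m n) ∂gMat m n := by
  simp only [zf_r]
  rw [← integral_prod _ hi]
  rw [← (last_mp r m n).map_eq] at hi ⊢
  rw [integral_map (last_mp r m n).measurable.aemeasurable hi.aestronglyMeasurable]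

lemma int_norm_Gp (t : ℝ) (x : Fin l → Fin n → ℝ) (y : Fin l → Fin m → ℝ) :
    Integrable (fun G => ‖Gp t x y G‖) (gMat m n) := by
  have h0 : ∀ j k, Integrable (fun G : Fin m → Fin n → ℝ => |G j k|) (gMat m n) := by
    intro j k
    have h1 : Integrable (fun a : ℝ => |a|) stdG := by
      refine (integrable_exp_abs 1).mono' (by fun_prop) (Filter.Eventually.of_forall fun a => ?_)
      have := add_one_le_exp |a|
      rw [norm_eq_abs, abs_abs, one_mul]
      linarith
    have h2 : MeasurePreserving (fun G : Fin m → Fin n → ℝ => G j k) (gMat m n) stdG :=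
      (measurePreserving_eval (fun _ : Fin n => stdG) k).comp
        (measurePreserving_eval (fun _ : Fin m => gVec n) j)
    exact h2.integrable_comp_of_integrable h1
  have h3 : Integrable (fun G : Fin m → Fin n → ℝ => ∑ i1 : Fin l, ∑ i2 : Fin l,
      |sqrt t| * ∑ j, ∑ k, |y i2 j| * (|G j k| * |x i1 k|)) (gMat m n) := by
    refine integrable_finsetSum _ fun i1 _ => integrable_finsetSum _ fun i2 _ => ?_
    refine Integrable.const_mul (integrable_finsetSum _ fun j _ => integrable_finsetSum _ fun k _ => ?_) _
    exact ((h0 j k).mul_const _).const_mul _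
  refine h3.mono' (by have := continuous_Gp t x y; fun_prop) (Filter.Eventually.of_forall fun G => ?_)
  rw [norm_norm]
  have hnn : ∀ i1 i2, 0 ≤ |sqrt t| * ∑ j, ∑ k, |y i2 j| * (|G j k| * |x i1 k|) := fun i1 i2 => by
    positivity
  refine (pi_norm_le_iff_of_nonneg (Finset.sum_nonneg fun i1 _ => Finset.sum_nonneg fun i2 _ =>
    hnn i1 i2)).2 fun i1 => ?_
  refine (pi_norm_le_iff_of_nonneg (Finset.sum_nonneg fun i1 _ => Finset.sum_nonneg fun i2 _ =>
    hnn i1 i2)).2 fun i2 => ?_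
  have hb : ‖Gp t x y G i1 i2‖ ≤ |sqrt t| * ∑ j, ∑ k, |y i2 j| * (|G j k| * |x i1 k|) := by
    unfold Gp
    rw [norm_eq_abs, abs_mul]
    refine mul_le_mul_of_nonneg_left ?_ (abs_nonneg _)
    refine (Finset.abs_sum_le_sum_abs _ _).trans (Finset.sum_le_sum fun j _ => ?_)
    refine (Finset.abs_sum_le_sum_abs _ _).trans (Finset.sum_le_sum fun k _ => ?_)
    rw [abs_mul, abs_mul]
  refine hb.trans ?_
  refine (Finset.single_le_sum (f := fun i2 => |sqrt t| * ∑ j, ∑ k, |y i2 j| *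
    (|G j k| * |x i1 k|)) (fun i _ => hnn i1 i) (Finset.mem_univ i2)).trans ?_
  exact Finset.single_le_sum (f := fun i1 => ∑ i2, |sqrt t| * ∑ j, ∑ k, |y i2 j| *
    (|G j k| * |x i1 k|)) (fun i _ => Finset.sum_nonneg fun i2 _ => hnn i i2) (Finset.mem_univ i1)

lemma good_int {K : ℝ} {F : Fld l → ℝ} (hF : Good K F) (t : ℝ) (x : Fin l → Fin n → ℝ)
    (y : Fin l → Fin m → ℝ) : Integrable (fun G => F (Gp t x y G)) (gMat m n) := by
  have h : Integrable (fun G => |F 0| + K * ‖Gp t x y G‖) (gMat m n) :=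
    (integrable_const _).add ((int_norm_Gp t x y).const_mul K)
  refine h.mono' ?_ (Filter.Eventually.of_forall fun G => ?_)
  · have := continuous_Gp t x y
    have := hF.continuous
    exact (Continuous.comp this ‹_›).aestronglyMeasurable
  · have h1 := hF.lip (Gp t x y G) 0
    rw [sub_zero] at h1
    have h2 := abs_sub_abs_le_abs_sub (F (Gp t x y G)) (F 0)
    rw [norm_eq_abs]
    linarith

end Last
end Iface

section Fin1
variable {m n l : ℕ}

lemma hasDerivAt_int_lip {V : Type} [MeasurableSpace V] (μ : Measure V) [IsFiniteMeasure μ]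
    {F : ℝ → V → ℝ} {F' : V → ℝ} {ρ0 C : ℝ}
    (hm : ∀ ρ, AEStronglyMeasurable (F ρ) μ) (hi : Integrable (F ρ0) μ)
    (hm' : AEStronglyMeasurable F' μ)
    (hl : ∀ᶠ ρ in nhds ρ0, ∀ v, |F ρ v - F ρ0 v| ≤ C * |ρ - ρ0|)
    (hd : ∀ v, HasDerivAt (fun ρ => F ρ v) (F' v) ρ0) :
    HasDerivAt (fun ρ => ∫ v, F ρ v ∂μ) (∫ v, F' v ∂μ) ρ0 := by
  have hL : ∀ v, HasFDerivAt (fun ρ => F ρ v)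
      (ContinuousLinearMap.smulRightL ℝ ℝ ℝ 1 (F' v)) ρ0 := fun v => (hd v).hasFDerivAt
  have key := hasFDerivAt_integral_of_dominated_loc_of_lip' (μ := μ) (F := F) (x₀ := ρ0)
      (F' := fun v => ContinuousLinearMap.smulRightL ℝ ℝ ℝ 1 (F' v)) (bound := fun _ => C) hl
      (fun w _ => hm w) hi
      ((ContinuousLinearMap.smulRightL ℝ ℝ ℝ 1).continuous.comp_aestronglyMeasurable hm')
      (Filter.Eventually.of_forall fun v w hw => hw v) (integrable_const _)
      (Filter.Eventually.of_forall hL)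
  have h2 := key.2.hasDerivAt
  rw [ContinuousLinearMap.integral_apply key.1] at h2
  simpa using h2

section W
variable (r : ℕ) (β s t : ℝ) (mv p q : ℕ → ℝ) (x : Fin l → Fin n → ℝ) (y : Fin l → Fin m → ℝ)

lemma Top_zero {J : Type} [Fintype J] {E : Type} [NormedAddCommGroup E] [NormedSpace ℝ E]
    (e : J → E) (σ : J → ℝ) (F : E → ℝ) (z : E) :
    Top e 0 σ F z = ∫ v, F (z + lin e σ v) ∂gJ J := by
  unfold Top TT; simp

lemma Aop_zero {J : Type} [Fintype J] {E : Type} [NormedAddCommGroup E] [NormedSpace ℝ E]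
    (e : J → E) (σ : J → ℝ) (F h : E → ℝ) (z : E) :
    Aop e 0 σ F h z = ∫ v, h (z + lin e σ v) ∂gJ J := by
  unfold Aop Av; simp

lemma psiR_eq (hl : 1 ≤ l) (hβ : 0 ≤ β) (hr : 1 ≤ r) (hm0 : mv 0 = 1) (hmr1 : mv (r+1) = 0)
    (hmpos : ∀ k, 1 ≤ k → k ≤ r → 0 < mv k) :
    psiR r 1 β s t mv p q x y = (β * |s| * sqrt (n : ℝ))⁻¹ *
      ∫ G, Lam (eV t x y) mv (sg m n p q) (F0z β s) (r+1) (Gp t x y G) ∂gMat m n := by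
  have hG := (F0z_good hl β s hβ).lam (eV t x y) mv (sg m n p q) r
  have hmr := (hmpos r hr le_rfl).ne'
  unfold psiR
  have e1 : ∀ ω : (Fin m → Fin n → ℝ) × (Fin (r+1) → Us m n),
      (β * |s| * sqrt (n : ℝ) * mv r)⁻¹ * log (zetaR r 1 β s t mv p q x y ω.1 r ω.2) =
      (β * |s| * sqrt (n : ℝ))⁻¹ * Lam (eV t x y) mv (sg m n p q) (F0z β s) r
        (zf r t p q x y r ω.1 ω.2) := by
    intro ω
    rw [zeta_eq r β s t mv p q x y hl hβ hm0 hmpos r le_rfl, log_exp, mul_inv, mul_assoc,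
      inv_mul_cancel_left₀ hmr]
  simp only [e1]
  rw [integral_const_mul, int_last r t p q x y]
  · congr 1
    refine integral_congr_ae (Filter.Eventually.of_forall fun G => ?_)
    simp only [Lam, hmr1]
    rw [Top_zero]
  · have h1 : Integrable (fun w : (Fin m → Fin n → ℝ) × (JJ m n → ℝ) =>
        |Lam (eV t x y) mv (sg m n p q) (F0z β s) r (Gp t x y w.1)|)
        ((gMat m n).prod (gJ (JJ m n))) :=
      ((good_int hG t x y).abs).comp_fst (gJ (JJ m n))
    have h2 : Integrable (fun v : JJ m n → ℝ => |s| * β * (Mb (sg m n p q r) * Lsz (eV t x y)) * N1 v)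
        (gJ (JJ m n)) := by
      refine Integrable.const_mul ?_ _
      refine int_of_lin (a := 0) (b := 1) (by fun_prop) fun v => ?_
      rw [abs_of_nonneg (N1_nonneg v)]; simp
    have h3 := h2.comp_snd (gMat m n)
    refine (h1.add h3).mono' ?_ (Filter.Eventually.of_forall fun w => ?_)
    · have c1 := hG.continuous
      have c2 := continuous_Gp t x y
      have c3 := continuous_lin (eV t x y) (sg m n p q r)
      have : Continuous fun w : (Fin m → Fin n → ℝ) × (JJ m n → ℝ) =>
        Gp t x y w.1 + lin (eV t x y) (sg m n p q r) w.2 :=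
        (c2.comp continuous_fst).add (c3.comp continuous_snd)
      exact (c1.comp this).aestronglyMeasurable
    · rw [norm_eq_abs]
      exact hG.abs_le (eV t x y) (sg m n p q r) (le_Mb _) (Gp t x y w.1) w.2

/-- Averaged pair weight. -/
def WW (k : ℕ) (i i' : Fin l × Fin l) : ℝ :=
  ∫ G, AA (eV t x y) mv (sg m n p q) (F0z β s) (k+1) (r+1)
    (fun z => gk (eV t x y) mv (sg m n p q) β s k i z *
      gk (eV t x y) mv (sg m n p q) β s k i' z) (Gp t x y G) ∂gMat m n

lemma bdd_int {V : Type} [MeasurableSpace V] (μ : Measure V) [IsFiniteMeasure μ] {f : V → ℝ}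
    (hf : Measurable f) {B : ℝ} (hb : ∀ v, |f v| ≤ B) : Integrable f μ :=
  Integrable.of_bound hf.aestronglyMeasurable B (Filter.Eventually.of_forall hb)

lemma pair_meas (hl : 1 ≤ l) (hβ : 0 ≤ β) (k N : ℕ) (i i' : Fin l × Fin l) :
    Measurable (AA (eV t x y) mv (sg m n p q) (F0z β s) (k+1) N
      (fun z => gk (eV t x y) mv (sg m n p q) β s k i z *
        gk (eV t x y) mv (sg m n p q) β s k i' z)) :=
  AA_meas (F0z_good hl β s hβ) _ _ _ _ _
    ((gk_meas hl β s hβ _ _ _ _ _).mul (gk_meas hl β s hβ _ _ _ _ _))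

lemma pair_le (hl : 1 ≤ l) (hβ : 0 ≤ β) (k N : ℕ) (i i' : Fin l × Fin l) (z : Fld l) :
    |AA (eV t x y) mv (sg m n p q) (F0z β s) (k+1) N
      (fun z => gk (eV t x y) mv (sg m n p q) β s k i z *
        gk (eV t x y) mv (sg m n p q) β s k i' z) z| ≤ 1 := by
  refine AA_abs_le (F0z_good hl β s hβ) _ _ _ _ _ (fun z => ?_) z
  rw [abs_mul, ← one_mul (1 : ℝ)]
  exact mul_le_mul (gk_abs_le hl β s hβ _ _ _ _ _ _) (gk_abs_le hl β s hβ _ _ _ _ _ _)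
    (abs_nonneg _) zero_le_one

lemma measurable_zf (k : ℕ) : Measurable
    (fun ω : (Fin m → Fin n → ℝ) × (Fin (r+1) → Us m n) => zf r t p q x y k ω.1 ω.2) := by
  unfold zf
  refine ((continuous_Gp t x y).measurable.comp measurable_fst).add
    (Finset.measurable_sum _ fun i _ => ?_)
  by_cases h : k ≤ (i : ℕ)
  · simp only [h, if_true]
    exact (continuous_lin _ _).measurable.comp (toJ.measurable.comp
      ((measurable_pi_apply i).comp measurable_snd))
  · simp only [h, if_false]
    exact measurable_const

lemma EBrR_eq (hl : 1 ≤ l) (hβ : 0 ≤ β) (hm0 : mv 0 = 1) (hmr1 : mv (r+1) = 0)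
    (hmpos : ∀ k, 1 ≤ k → k ≤ r → 0 < mv k) (k : ℕ) (hk : k ≤ r)
    (f : Fin l → Fin l → Fin l → Fin l → ℝ) :
    EBrR r 1 β s t mv p q x y k f = ∑ i : Fin l × Fin l, ∑ i' : Fin l × Fin l,
      f i.1 i.2 i'.1 i'.2 * WW r β s t mv p q x y k i i' := by
  unfold EBrR
  simp only [gamR_eq r β s t mv p q x y hl hβ hm0 hmpos k hk]
  have e1 : ∀ i i' : Fin l × Fin l, Integrable
      (fun ω : (Fin m → Fin n → ℝ) × (Fin (r+1) → Us m n) =>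
      f i.1 i.2 i'.1 i'.2 * AA (eV t x y) mv (sg m n p q) (F0z β s) (k+1) r
        (fun z => gk (eV t x y) mv (sg m n p q) β s k i z *
          gk (eV t x y) mv (sg m n p q) β s k i' z) (zf r t p q x y r ω.1 ω.2)) (muAll r m n) :=
    fun i i' => (bdd_int _ ((pair_meas β s t mv p q x y hl hβ k r i i').comp
      (measurable_zf r t p q x y r)) fun ω => pair_le β s t mv p q x y hl hβ k r i i' _).const_mul _
  have e2 : ∀ ω : (Fin m → Fin n → ℝ) × (Fin (r+1) → Us m n),
      (∑ i1, ∑ i2, ∑ p1, ∑ p2, f i1 i2 p1 p2 *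
        AA (eV t x y) mv (sg m n p q) (F0z β s) (k+1) r
        (fun z => gk (eV t x y) mv (sg m n p q) β s k (i1, i2) z *
          gk (eV t x y) mv (sg m n p q) β s k (p1, p2) z) (zf r t p q x y r ω.1 ω.2)) =
      ∑ i : Fin l × Fin l, ∑ i' : Fin l × Fin l, f i.1 i.2 i'.1 i'.2 *
        AA (eV t x y) mv (sg m n p q) (F0z β s) (k+1) r
        (fun z => gk (eV t x y) mv (sg m n p q) β s k i z *
          gk (eV t x y) mv (sg m n p q) β s k i' z) (zf r t p q x y r ω.1 ω.2) := by
    intro ω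
    simp only [Fintype.sum_prod_type]
  simp only [e2]
  rw [integral_finsetSum _ fun i _ => integrable_finsetSum _ fun i' _ => e1 i i']
  refine Finset.sum_congr rfl fun i _ => ?_
  rw [integral_finsetSum _ fun i' _ => e1 i i']
  refine Finset.sum_congr rfl fun i' _ => ?_
  rw [integral_const_mul]
  congr 1
  rw [int_last r t p q x y]
  · unfold WW
    refine integral_congr_ae (Filter.Eventually.of_forall fun G => ?_)
    simp only
    rw [AA_succ _ _ _ _ _ _ _ (by omega), hmr1, Aop_zero]
  · refine bdd_int _ ((pair_meas β s t mv p q x y hl hβ k r i i').comp ?_)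
      fun ω => pair_le β s t mv p q x y hl hβ k r i i' _
    exact ((continuous_Gp t x y).measurable.comp measurable_fst).add
      ((continuous_lin _ _).measurable.comp measurable_snd)

end W

lemma psi_deriv (r : ℕ) (β s t : ℝ) (mv : ℕ → ℝ) (P Q : ℝ → ℕ → ℝ) (x : Fin l → Fin n → ℝ)
    (y : Fin l → Fin m → ℝ) (hl : 1 ≤ l) (hβ : 0 ≤ β) (hr : 1 ≤ r) (hm0 : mv 0 = 1)
    (hmr1 : mv (r+1) = 0) (hmpos : ∀ k, 1 ≤ k → k ≤ r → 0 < mv k)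
    (κ : ℕ) (hκ : κ + 1 ≤ r) (w : JJ m n → ℝ) (ρ0 : ℝ)
    (hne : ∀ ρ i, i ≠ κ → i ≠ κ + 1 → sg m n (P ρ) (Q ρ) i = sg m n (P ρ0) (Q ρ0) i)
    (h1 : ∀ j, 0 < sg m n (P ρ0) (Q ρ0) κ j) (h2 : ∀ j, 0 < sg m n (P ρ0) (Q ρ0) (κ+1) j)
    (hd1 : ∀ j, HasDerivAt (fun ρ => sg m n (P ρ) (Q ρ) κ j)
      (-(w j / (2 * sg m n (P ρ0) (Q ρ0) κ j))) ρ0)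
    (hd2 : ∀ j, HasDerivAt (fun ρ => sg m n (P ρ) (Q ρ) (κ+1) j)
      (w j / (2 * sg m n (P ρ0) (Q ρ0) (κ+1) j)) ρ0) :
    HasDerivAt (fun ρ => psiR r 1 β s t mv (P ρ) (Q ρ) x y)
      ((β * |s| * sqrt (n : ℝ))⁻¹ * ((mv (κ+2) - mv (κ+1)) / 2 * ((s * β) ^ 2 *
        ∑ i : Fin l × Fin l, ∑ i' : Fin l × Fin l,
          (∑ j, w j * (eV t x y j i.1 i.2 * eV t x y j i'.1 i'.2)) *
            WW r β s t mv (P ρ0) (Q ρ0) x y (κ+1) i i'))) ρ0 := by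
  simp only [psiR_eq r β s t mv _ _ x y hl hβ hr hm0 hmr1 hmpos]
  refine HasDerivAt.const_mul _ ?_
  have hF := F0z_good hl β s hβ
  obtain ⟨d, hd⟩ := Nat.exists_eq_add_of_le hκ
  obtain ⟨hD, C, hC, hL⟩ := Lam_deriv hF (eV t x y) mv (fun ρ => sg m n (P ρ) (Q ρ)) κ w ρ0 hne
    h1 h2 hd1 hd2 d
  rw [show κ + 2 + d = r + 1 by omega] at hD hL
  have key := hasDerivAt_int_lip (gMat m n) (C := C) (ρ0 := ρ0)
    (F := fun ρ G => Lam (eV t x y) mv (sg m n (P ρ) (Q ρ)) (F0z β s) (r+1) (Gp t x y G))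
    (F' := fun G => _)
    (fun ρ => (good_int (hF.lam (eV t x y) mv (sg m n (P ρ) (Q ρ)) (r+1)) t x y).aestronglyMeasurable)
    (good_int (hF.lam (eV t x y) mv (sg m n (P ρ0) (Q ρ0)) (r+1)) t x y) ?_ ?_
    (fun G => hD (Gp t x y G))
  · refine key.congr_deriv ?_
    rw [integral_const_mul]
    congr 1
    simp only [AA_quad hl β s hβ]
    have e1 : ∀ i i' : Fin l × Fin l, Integrable (fun G =>
        (∑ j, w j * (eV t x y j i.1 i.2 * eV t x y j i'.1 i'.2)) *
        AA (eV t x y) mv (sg m n (P ρ0) (Q ρ0)) (F0z β s) (κ+1+1) (r+1)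
        (fun z => gk (eV t x y) mv (sg m n (P ρ0) (Q ρ0)) β s (κ+1) i z *
          gk (eV t x y) mv (sg m n (P ρ0) (Q ρ0)) β s (κ+1) i' z) (Gp t x y G)) (gMat m n) :=
      fun i i' => (bdd_int _ ((pair_meas β s t mv (P ρ0) (Q ρ0) x y hl hβ (κ+1) (r+1) i i').comp
        (continuous_Gp t x y).measurable)
        fun ω => pair_le β s t mv (P ρ0) (Q ρ0) x y hl hβ (κ+1) (r+1) i i' _).const_mul _
    rw [integral_const_mul]
    congr 1
    rw [integral_finsetSum _ fun i _ => integrable_finsetSum _ fun i' _ => e1 i i']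
    refine Finset.sum_congr rfl fun i _ => ?_
    rw [integral_finsetSum _ fun i' _ => e1 i i']
    refine Finset.sum_congr rfl fun i' _ => ?_
    rw [integral_const_mul]
    rfl
  · simp only [AA_quad hl β s hβ]
    refine Measurable.aestronglyMeasurable ?_
    refine Measurable.const_mul (Measurable.const_mul ?_ _) _
    refine Finset.measurable_sum _ fun i _ => Finset.measurable_sum _ fun i' _ => ?_
    refine Measurable.const_mul ?_ _
    exact (pair_meas β s t mv (P ρ0) (Q ρ0) x y hl hβ (κ+1) (r+1) i i').comp
        (continuous_Gp t x y).measurable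
  · filter_upwards [hL] with ρ h G
    exact h _

lemma corr_deriv (r κ : ℕ) (hκ : κ + 1 ≤ r) (mv a B : ℕ → ℝ) (ρ0 : ℝ) :
    HasDerivAt (fun ρ => ∑ k ∈ Finset.range (r+1), mv (k+1) *
      (Function.update a (κ+1) ρ k * B k - Function.update a (κ+1) ρ (k+1) * B (k+1)))
      ((mv (κ+2) - mv (κ+1)) * B (κ+1)) ρ0 := by
  have hu : ∀ k, HasDerivAt (fun ρ => Function.update a (κ+1) ρ k)
      (if k = κ + 1 then (1:ℝ) else 0) ρ0 := by
    intro k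
    by_cases h : k = κ + 1
    · subst h
      simp only [Function.update_self, if_true]
      exact hasDerivAt_id _
    · simp only [Function.update_of_ne h, if_neg h]
      exact hasDerivAt_const _ _
  have h := HasDerivAt.fun_sum (u := Finset.range (r+1)) fun k _ =>
    (((hu k).mul_const (B k)).sub ((hu (k+1)).mul_const (B (k+1)))).const_mul (mv (k+1))
  refine h.congr_deriv ?_
  simp only [mul_sub, Finset.sum_sub_distrib, Nat.add_right_cancel_iff, ite_mul, one_mul, zero_mul,
    mul_ite, mul_zero, Finset.sum_ite_eq', Finset.mem_range]
  rw [if_pos (by omega), if_pos (by omega)]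
  ring

end Fin1

lemma sign_mul_self_abs (s : ℝ) : Real.sign s * s = |s| := by
  rcases lt_trichotomy s 0 with h | h | h
  · rw [Real.sign_of_neg h, abs_of_neg h]; ring
  · simp [h]
  · rw [Real.sign_of_pos h, abs_of_pos h]; ring

lemma final_alg (β s t N a b c EX SD : ℝ) (hβ : 0 < β) (hs : s ≠ 0) (hN : 0 < N) :
    -(Real.sign s * s * β / (2 * N)) * ((b - a) * (c * EX)) +
      (β * |s| * N)⁻¹ * ((b - a) / 2 * ((s * β) ^ 2 * (t * c * EX + (1 - t) * SD))) =
    (1 - t) * (a - b) * (Real.sign s * s * β / (2 * N)) * (c * EX - SD) := by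
  rw [sign_mul_self_abs]
  have h : (s * β) ^ 2 = |s| ^ 2 * β ^ 2 := by rw [sq_abs, mul_pow]
  rw [h]
  have hs' : |s| ≠ 0 := abs_ne_zero.2 hs
  field_simp
  ring

/-- Derivatives of the corrected interpolating function `ψ₁` with respect to `p_{k₁}` and
`q_{k₁}`, where the `γ`-averages in the correction sum are treated as constants. -/
theorem rth_level_psi1_derivatives
    (r m n l : ℕ) (hr : 1 ≤ r) (hm : 1 ≤ m) (hn : 1 ≤ n) (hl : 1 ≤ l)
    (β s t : ℝ) (hβ : 0 < β) (hs : s ≠ 0) (ht : t ∈ Set.Ioo (0:ℝ) 1)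
    (mv p q : ℕ → ℝ)
    (hm0 : mv 0 = 1) (hmr1 : mv (r+1) = 0) (hmpos : ∀ k, 1 ≤ k → k ≤ r → 0 < mv k)
    (hp0 : p 0 ≤ 1) (hpmono : ∀ k ≤ r, p (k+1) ≤ p k) (hpend : p (r+1) = 0)
    (hq0 : q 0 ≤ 1) (hqmono : ∀ k ≤ r, q (k+1) ≤ q k) (hqend : q (r+1) = 0)
    (x : Fin l → Fin n → ℝ) (y : Fin l → Fin m → ℝ)
    (hx : ∀ i, x i ≠ 0) (hy : ∀ i, y i ≠ 0)
    (hpstrict : ∀ k < r, p (k+1) < p k) (hprpos : 0 < p r)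
    (hqstrict : ∀ k < r, q (k+1) < q k) (hqrpos : 0 < q r)
    (hpqstrict : ∀ k ≤ r, p (k+1) * q (k+1) < p k * q k) :
    ∀ k1, 1 ≤ k1 → k1 ≤ r →
      HasDerivAt (fun ρ =>
          -(Real.sign s * s * β / (2 * Real.sqrt (n : ℝ))) *
              (∑ k ∈ Finset.range (r+1),
                mv (k+1) * (Function.update p k1 ρ k * q k * EXR r 1 β s t mv p q x y k
                  - Function.update p k1 ρ (k+1) * q (k+1) * EXR r 1 β s t mv p q x y (k+1)))
            + psiR r 1 β s t mv (Function.update p k1 ρ) q x y)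
        ((1 - t) * (mv k1 - mv (k1+1)) * (Real.sign s * s * β / (2 * Real.sqrt (n : ℝ))) *
          EBrR r 1 β s t mv p q x y k1
            (fun i1 i2 pp1 pp2 => nrm2 (x i1) * nrm2 (x pp1) *
              (q k1 * (nrm2 (y i2) * nrm2 (y pp2)) - dotv (y pp2) (y i2)))) (p k1)
      ∧
      HasDerivAt (fun ρ =>
          -(Real.sign s * s * β / (2 * Real.sqrt (n : ℝ))) *
              (∑ k ∈ Finset.range (r+1),
                mv (k+1) * (p k * Function.update q k1 ρ k * EXR r 1 β s t mv p q x y k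
                  - p (k+1) * Function.update q k1 ρ (k+1) * EXR r 1 β s t mv p q x y (k+1)))
            + psiR r 1 β s t mv p (Function.update q k1 ρ) x y)
        ((1 - t) * (mv k1 - mv (k1+1)) * (Real.sign s * s * β / (2 * Real.sqrt (n : ℝ))) *
          EBrR r 1 β s t mv p q x y k1
            (fun i1 i2 pp1 pp2 => nrm2 (y i2) * nrm2 (y pp2) *
              (p k1 * (nrm2 (x i1) * nrm2 (x pp1)) - dotv (x pp1) (x i1)))) (q k1) := by
  intro k1 hk1 hk1r
  obtain ⟨κ, rfl⟩ := Nat.exists_eq_add_of_le' hk1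
  have hN : 0 < Real.sqrt (n : ℝ) := Real.sqrt_pos.2 (by exact_mod_cast hn)
  have hsp : ∀ k ≤ r, 0 < p k - p (k+1) := by
    intro k hk
    rcases Nat.lt_or_eq_of_le hk with h | h
    · exact sub_pos.2 (hpstrict k h)
    · rw [h, hpend]; simpa using hprpos
  have hsq : ∀ k ≤ r, 0 < q k - q (k+1) := by
    intro k hk
    rcases Nat.lt_or_eq_of_le hk with h | h
    · exact sub_pos.2 (hqstrict k h)
    · rw [h, hqend]; simpa using hqrpos
  have hspq : ∀ k ≤ r, 0 < p k * q k - p (k+1) * q (k+1) := fun k hk => sub_pos.2 (hpqstrict k hk)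
  have hsg : ∀ k ≤ r, ∀ j, 0 < sg m n p q k j := by
    intro k hk j
    rcases j with j | j | j
    · exact Real.sqrt_pos.2 (hspq k hk)
    · exact Real.sqrt_pos.2 (hsp k hk)
    · exact Real.sqrt_pos.2 (hsq k hk)
  have htt : Real.sqrt t * Real.sqrt t = t := Real.mul_self_sqrt ht.1.le
  have htt' : Real.sqrt (1 - t) * Real.sqrt (1 - t) = 1 - t :=
    Real.mul_self_sqrt (by linarith [ht.2])
  have hEX := EBrR_eq r β s t mv p q x y hl hβ.le hm0 hmr1 hmpos (κ+1) hk1r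
  have hup : Function.update p (κ+1) (p (κ+1)) = p := Function.update_eq_self _ _
  have huq : Function.update q (κ+1) (q (κ+1)) = q := Function.update_eq_self _ _
  have n1 : κ ≠ κ + 1 := by omega
  have n2 : κ + 1 + 1 ≠ κ + 1 := by omega
  constructor
  · have hpsi := psi_deriv r β s t mv (fun ρ => Function.update p (κ+1) ρ) (fun _ => q) x y hl hβ.le
      hr hm0 hmr1 hmpos κ hk1r (Sum.elim (fun _ => q (κ+1)) (Sum.elim (fun _ => 1) fun _ => 0)) (p (κ+1)) ?_ ?_ ?_ ?_ ?_
    · have hcorr := corr_deriv r κ hk1r mv p (fun k => q k * EXR r 1 β s t mv p q x y k)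
        (p (κ+1))
      have hcorr2 : HasDerivAt (fun ρ => ∑ k ∈ Finset.range (r+1), mv (k+1) *
          (Function.update p (κ+1) ρ k * q k * EXR r 1 β s t mv p q x y k
            - Function.update p (κ+1) ρ (k+1) * q (k+1) * EXR r 1 β s t mv p q x y (k+1)))
          ((mv (κ+2) - mv (κ+1)) * (q (κ+1) * EXR r 1 β s t mv p q x y (κ+1))) (p (κ+1)) := by
        refine hcorr.congr_of_eventuallyEq (Filter.Eventually.of_forall fun ρ => ?_)
        exact Finset.sum_congr rfl fun k _ => by ring
      refine ((hcorr2.const_mul _).add hpsi).congr_deriv ?_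
      rw [hup]
      have eT : EBrR r 1 β s t mv p q x y (κ+1) (fun i1 i2 p1 p2 => nrm2 (x i1) * nrm2 (x p1) * (q (κ+1) * (nrm2 (y i2) * nrm2 (y p2)) - dotv (y p2) (y i2)))
          = q (κ+1) * EXR r 1 β s t mv p q x y (κ+1) - EBrR r 1 β s t mv p q x y (κ+1)
            (fun i1 i2 p1 p2 => nrm2 (x i1) * nrm2 (x p1) * dotv (y p2) (y i2)) := by
        unfold EXR
        rw [hEX, hEX, hEX, Finset.mul_sum, ← Finset.sum_sub_distrib]
        refine Finset.sum_congr rfl fun i _ => ?_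
        rw [Finset.mul_sum, ← Finset.sum_sub_distrib]
        refine Finset.sum_congr rfl fun i' _ => ?_
        ring
      have eS : (∑ i : Fin l × Fin l, ∑ i' : Fin l × Fin l,
          (∑ j, (Sum.elim (fun _ => q (κ+1)) (Sum.elim (fun _ => 1) fun _ => 0) : JJ m n → ℝ) j *
            (eV t x y j i.1 i.2 * eV t x y j i'.1 i'.2)) * WW r β s t mv p q x y (κ+1) i i')
          = t * q (κ+1) * EXR r 1 β s t mv p q x y (κ+1) +
            (1 - t) * EBrR r 1 β s t mv p q x y (κ+1) (fun i1 i2 p1 p2 => nrm2 (x i1) * nrm2 (x p1) * dotv (y p2) (y i2)) := by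
        unfold EXR
        rw [hEX, hEX, Finset.mul_sum, Finset.mul_sum, ← Finset.sum_add_distrib]
        refine Finset.sum_congr rfl fun i _ => ?_
        rw [Finset.mul_sum, Finset.mul_sum, ← Finset.sum_add_distrib]
        refine Finset.sum_congr rfl fun i' _ => ?_
        have hj : (∑ j, (Sum.elim (fun _ => q (κ+1)) (Sum.elim (fun _ => 1) fun _ => 0) : JJ m n → ℝ) j *
            (eV t x y j i.1 i.2 * eV t x y j i'.1 i'.2)) =
            t * q (κ+1) * (nrm2 (x i.1) * nrm2 (x i'.1) * nrm2 (y i.2) * nrm2 (y i'.2)) +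
            (1 - t) * (nrm2 (x i.1) * nrm2 (x i'.1) * dotv (y i'.2) (y i.2)) := by
          simp only [Fintype.sum_sum_type, Sum.elim_inl, Sum.elim_inr, eV, Finset.univ_unique,
            Finset.sum_singleton, zero_mul, one_mul, Finset.sum_const_zero, add_zero, zero_add]
          unfold dotv
          rw [Finset.mul_sum, Finset.mul_sum]
          congr 1
          · conv_rhs => rw [← htt]
            ring
          · refine Finset.sum_congr rfl fun j _ => ?_
            conv_rhs => rw [← htt']
            ring
        rw [hj]
        ring
      rw [eT, eS]
      exact final_alg β s t _ (mv (κ+1)) (mv (κ+2)) (q (κ+1)) _ _ hβ hs hN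
    · intro ρ i hi1 hi2
      funext j
      have a1 : Function.update p (κ+1) ρ i = p i := Function.update_of_ne hi2 _ _
      have a2 : Function.update p (κ+1) ρ (i+1) = p (i+1) :=
        Function.update_of_ne (by omega) _ _
      rcases j with j | j | j <;> simp only [sg, a1, a2, hup]
    · simp only [hup]
      exact hsg κ (by omega)
    · simp only [hup]
      exact hsg (κ+1) hk1r
    · intro j
      have hid := hasDerivAt_id' (p (κ+1))
      simp only [hup]
      rcases j with j | j | j
      · simp only [sg, Function.update_self, Function.update_of_ne n1, Sum.elim_inl]
        refine (((hid.mul_const (q (κ+1))).const_sub (p κ * q κ)).sqrt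
          (hspq κ (by omega)).ne').congr_deriv (by ring)
      · simp only [sg, Function.update_self, Function.update_of_ne n1, Sum.elim_inl, Sum.elim_inr]
        refine ((hid.const_sub (p κ)).sqrt (hsp κ (by omega)).ne').congr_deriv (by ring)
      · simp only [sg, Sum.elim_inr]
        refine (hasDerivAt_const _ _).congr_deriv (by ring)
    · intro j
      have hid := hasDerivAt_id' (p (κ+1))
      simp only [hup]
      rcases j with j | j | j
      · simp only [sg, Function.update_self, Function.update_of_ne n2, Sum.elim_inl]
        refine (((hid.mul_const (q (κ+1))).sub_const
          (p (κ+1+1) * q (κ+1+1))).sqrt (hspq (κ+1) hk1r).ne').congr_deriv (by ring)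
      · simp only [sg, Function.update_self, Function.update_of_ne n2, Sum.elim_inl, Sum.elim_inr]
        refine ((hid.sub_const (p (κ+1+1))).sqrt (hsp (κ+1) hk1r).ne').congr_deriv (by ring)
      · simp only [sg, Sum.elim_inr]
        refine (hasDerivAt_const _ _).congr_deriv (by ring)
  · have hpsi := psi_deriv r β s t mv (fun _ => p) (fun ρ => Function.update q (κ+1) ρ) x y hl hβ.le
      hr hm0 hmr1 hmpos κ hk1r (Sum.elim (fun _ => p (κ+1)) (Sum.elim (fun _ => 0) fun _ => 1)) (q (κ+1)) ?_ ?_ ?_ ?_ ?_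
    · have hcorr := corr_deriv r κ hk1r mv q (fun k => p k * EXR r 1 β s t mv p q x y k)
        (q (κ+1))
      have hcorr2 : HasDerivAt (fun ρ => ∑ k ∈ Finset.range (r+1), mv (k+1) *
          (p k * Function.update q (κ+1) ρ k * EXR r 1 β s t mv p q x y k
            - p (k+1) * Function.update q (κ+1) ρ (k+1) * EXR r 1 β s t mv p q x y (k+1)))
          ((mv (κ+2) - mv (κ+1)) * (p (κ+1) * EXR r 1 β s t mv p q x y (κ+1))) (q (κ+1)) := by
        refine hcorr.congr_of_eventuallyEq (Filter.Eventually.of_forall fun ρ => ?_)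
        exact Finset.sum_congr rfl fun k _ => by ring
      refine ((hcorr2.const_mul _).add hpsi).congr_deriv ?_
      rw [huq]
      have eT : EBrR r 1 β s t mv p q x y (κ+1) (fun i1 i2 p1 p2 => nrm2 (y i2) * nrm2 (y p2) * (p (κ+1) * (nrm2 (x i1) * nrm2 (x p1)) - dotv (x p1) (x i1)))
          = p (κ+1) * EXR r 1 β s t mv p q x y (κ+1) - EBrR r 1 β s t mv p q x y (κ+1)
            (fun i1 i2 p1 p2 => nrm2 (y i2) * nrm2 (y p2) * dotv (x p1) (x i1)) := by
        unfold EXR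
        rw [hEX, hEX, hEX, Finset.mul_sum, ← Finset.sum_sub_distrib]
        refine Finset.sum_congr rfl fun i _ => ?_
        rw [Finset.mul_sum, ← Finset.sum_sub_distrib]
        refine Finset.sum_congr rfl fun i' _ => ?_
        ring
      have eS : (∑ i : Fin l × Fin l, ∑ i' : Fin l × Fin l,
          (∑ j, (Sum.elim (fun _ => p (κ+1)) (Sum.elim (fun _ => 0) fun _ => 1) : JJ m n → ℝ) j *
            (eV t x y j i.1 i.2 * eV t x y j i'.1 i'.2)) * WW r β s t mv p q x y (κ+1) i i')
          = t * p (κ+1) * EXR r 1 β s t mv p q x y (κ+1) +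
            (1 - t) * EBrR r 1 β s t mv p q x y (κ+1) (fun i1 i2 p1 p2 => nrm2 (y i2) * nrm2 (y p2) * dotv (x p1) (x i1)) := by
        unfold EXR
        rw [hEX, hEX, Finset.mul_sum, Finset.mul_sum, ← Finset.sum_add_distrib]
        refine Finset.sum_congr rfl fun i _ => ?_
        rw [Finset.mul_sum, Finset.mul_sum, ← Finset.sum_add_distrib]
        refine Finset.sum_congr rfl fun i' _ => ?_
        have hj : (∑ j, (Sum.elim (fun _ => p (κ+1)) (Sum.elim (fun _ => 0) fun _ => 1) : JJ m n → ℝ) j *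
            (eV t x y j i.1 i.2 * eV t x y j i'.1 i'.2)) =
            t * p (κ+1) * (nrm2 (x i.1) * nrm2 (x i'.1) * nrm2 (y i.2) * nrm2 (y i'.2)) +
            (1 - t) * (nrm2 (y i.2) * nrm2 (y i'.2) * dotv (x i'.1) (x i.1)) := by
          simp only [Fintype.sum_sum_type, Sum.elim_inl, Sum.elim_inr, eV, Finset.univ_unique,
            Finset.sum_singleton, zero_mul, one_mul, Finset.sum_const_zero, add_zero, zero_add]
          unfold dotv
          rw [Finset.mul_sum, Finset.mul_sum]
          congr 1
          · conv_rhs => rw [← htt]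
            ring
          · refine Finset.sum_congr rfl fun j _ => ?_
            conv_rhs => rw [← htt']
            ring
        rw [hj]
        ring
      rw [eT, eS]
      exact final_alg β s t _ (mv (κ+1)) (mv (κ+2)) (p (κ+1)) _ _ hβ hs hN
    · intro ρ i hi1 hi2
      funext j
      have a1 : Function.update q (κ+1) ρ i = q i := Function.update_of_ne hi2 _ _
      have a2 : Function.update q (κ+1) ρ (i+1) = q (i+1) :=
        Function.update_of_ne (by omega) _ _
      rcases j with j | j | j <;> simp only [sg, a1, a2, huq]
    · simp only [huq]
      exact hsg κ (by omega)
    · simp only [huq]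
      exact hsg (κ+1) hk1r
    · intro j
      have hid := hasDerivAt_id' (q (κ+1))
      simp only [huq]
      rcases j with j | j | j
      · simp only [sg, Function.update_self, Function.update_of_ne n1, Sum.elim_inl]
        refine (((hid.const_mul (p (κ+1))).const_sub (p κ * q κ)).sqrt
          (hspq κ (by omega)).ne').congr_deriv (by ring)
      · simp only [sg, Sum.elim_inl, Sum.elim_inr]
        refine (hasDerivAt_const _ _).congr_deriv (by ring)
      · simp only [sg, Function.update_self, Function.update_of_ne n1, Sum.elim_inr]
        refine ((hid.const_sub (q κ)).sqrt (hsq κ (by omega)).ne').congr_deriv (by ring)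
    · intro j
      have hid := hasDerivAt_id' (q (κ+1))
      simp only [huq]
      rcases j with j | j | j
      · simp only [sg, Function.update_self, Function.update_of_ne n2, Sum.elim_inl]
        refine (((hid.const_mul (p (κ+1))).sub_const
          (p (κ+1+1) * q (κ+1+1))).sqrt (hspq (κ+1) hk1r).ne').congr_deriv (by ring)
      · simp only [sg, Sum.elim_inl, Sum.elim_inr]
        refine (hasDerivAt_const _ _).congr_deriv (by ring)
      · simp only [sg, Function.update_self, Function.update_of_ne n2, Sum.elim_inr]
        refine ((hid.sub_const (q (κ+1+1))).sqrt (hsq (κ+1) hk1r).ne').congr_deriv (by ring)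

end

end SFLR
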